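/- Every double spider (a tree containing exactly two vertices of degree at least 3) is strongly antimagic, i.e. it admits a bijective edge labeling f : E → {1,2,...,|E|} such that the vertex sums φ_f(u) = Σ_{e incident to u} f(e) are pairwise distinct and, whenever deg(u) < deg(v), one has φ_f(u) < φ_f(v). -/

import Mathlib

open Classical

noncomputable section

/-- The vertex sum at `u` of an edge labeling `f`: the sum of the labels of the
edges incident to `u`. -/
def vertexSum {V : Type*} [Fintype V] (G : SimpleGraph V) (f : Sym2 V → ℕ) (u : V) : ℕ :=
  ∑ e ∈ G.incidenceFinset u, f e

/-- `f` is an antimagic labeling of `G`: it is a bijection from the edge set of `G`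
onto `{1, …, |E|}` and the vertex sums are pairwise distinct. -/
def IsAntimagicLabeling {V : Type*} [Fintype V] (G : SimpleGraph V)
    (f : Sym2 V → ℕ) : Prop :=
  Set.BijOn f G.edgeSet (Set.Icc 1 G.edgeFinset.card) ∧
  Function.Injective (vertexSum G f)

/-- `f` is a strongly antimagic labeling of `G`: it is an antimagic labeling and moreover
`deg u < deg v` implies `vertexSum u < vertexSum v`. -/
def IsStronglyAntimagicLabeling {V : Type*} [Fintype V] (G : SimpleGraph V)
    (f : Sym2 V → ℕ) : Prop :=
  Set.BijOn f G.edgeSet (Set.Icc 1 G.edgeFinset.card) ∧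
  Function.Injective (vertexSum G f) ∧
  ∀ u v : V, G.degree u < G.degree v → vertexSum G f u < vertexSum G f v

/-- `G` is antimagic if it admits an antimagic labeling. -/
def IsAntimagic {V : Type*} [Fintype V] (G : SimpleGraph V) : Prop :=
  ∃ f : Sym2 V → ℕ, IsAntimagicLabeling G f

/-- `G` is strongly antimagic if it admits a strongly antimagic labeling. -/
def IsStronglyAntimagic {V : Type*} [Fintype V] (G : SimpleGraph V) : Prop :=
  ∃ f : Sym2 V → ℕ, IsStronglyAntimagicLabeling G f

namespace DS

/-- A labelled path: `none` is the core, `some false` a leg at `a`, `some true` a leg at `b`.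
Legs are listed from the inner edge to the leaf edge, the core from `a` to `b`. -/
abbrev Pth := Option Bool × List ℕ

def inc (v : Bool) : Pth → List ℕ
  | (none, w) => if v then w.getLast?.toList else w.head?.toList
  | (some u, w) => if u = v then w.head?.toList else []

def lf : Pth → List ℕ
  | (none, _) => []
  | (some _, w) => w.getLast?.toList

def prs (w : List ℕ) : List (ℕ × ℕ) := w.zip w.tail

def mp (f : ℕ → ℕ) (p : Pth) : Pth := (p.1, p.2.map f)

def labs (ps : List Pth) : Multiset ℕ := (ps.flatMap Prod.snd : List ℕ)
def pairs (ps : List Pth) : List (ℕ × ℕ) := ps.flatMap (fun p => prs p.2)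
def sms (ps : List Pth) : Multiset ℕ := ((pairs ps).map (fun q => q.1 + q.2) : List ℕ)
def incs (v : Bool) (ps : List Pth) : List ℕ := ps.flatMap (inc v)
def lfs (ps : List Pth) : List ℕ := ps.flatMap lf
def spec (ps : List Pth) : Multiset (Option Bool × ℕ) := (ps.map (fun p => (p.1, p.2.length)) : List _)

/-- the interval `[i,j)` as a multiset -/
def R (i j : ℕ) : Multiset ℕ := Multiset.Ico i j

lemma R_add {i j k : ℕ} (h1 : i ≤ j) (h2 : j ≤ k) : R i j + R j k = R i k :=
  Multiset.Ico_add_Ico_eq_Ico h1 h2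

lemma R_self (i : ℕ) : R i i = 0 := by simp [R]

lemma R_succ (i : ℕ) : R i (i+1) = {i} := by
  simp [R, Multiset.Ico]

lemma mem_R {i j x : ℕ} : x ∈ R i j ↔ i ≤ x ∧ x < j := by simp [R]

lemma R_nodup (i j : ℕ) : (R i j).Nodup := Multiset.nodup_Ico

lemma R_card (i j : ℕ) : (R i j).card = j - i := by
  show (Finset.Ico i j).val.card = _
  exact Nat.card_Ico i j

lemma R_map (i j d : ℕ) : (R i j).map (· + d) = R (i+d) (j+d) := by
  simp only [R]
  exact Multiset.map_add_right_Ico i j d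

/-- Alternating block: `x, y, x+1, y+1, ...`. -/
def alt : ℕ → ℕ → ℕ → List ℕ
  | _, _, 0 => []
  | x, y, n+1 => x :: alt y (x+1) n

lemma alt_length (n x y : ℕ) : (alt x y n).length = n := by
  induction n generalizing x y with
  | zero => rfl
  | succ n ih => simp [alt, ih]

lemma alt_labs (n x y : ℕ) : ((alt x y n : List ℕ) : Multiset ℕ) = R x (x + (n+1)/2) + R y (y + n/2) := by
  induction n generalizing x y with
  | zero => simp [alt, R_self]
  | succ n ih =>
    have h : (x + (n+1+1)/2) = x + 1 + n/2 := by omega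
    rw [alt, ← Multiset.cons_coe, ih, h, ← R_add (show x ≤ x+1 by omega) (show x+1 ≤ x+1+n/2 by omega), R_succ,
      ← Multiset.singleton_add]
    abel

lemma alt_prs_sums (n x y : ℕ) : (((prs (alt x y n)).map (fun q => q.1+q.2) : List ℕ) : Multiset ℕ) = R (x+y) (x+y+(n-1)) := by
  induction n generalizing x y with
  | zero => simp [alt, prs, R_self]
  | succ n ih =>
    cases n with
    | zero => simp [alt, prs, R_self]
    | succ n =>
      have := ih y (x+1)
      simp only [alt, prs, List.zip_cons_cons, List.tail_cons, List.map_cons] at this ⊢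
      rw [← Multiset.cons_coe, this, ← R_add (show x+y ≤ x+y+1 by omega) (show x+y+1 ≤ x+y+(n+1+1-1) by omega), R_succ,
        ← Multiset.singleton_add]
      congr 2 <;> omega

/-- every pair of the block contains a label from each of the two sequences -/
lemma alt_prs_mem (n x y : ℕ) : ∀ q ∈ prs (alt x y n), (x ≤ q.1 ∧ y ≤ q.2) ∨ (x ≤ q.2 ∧ y ≤ q.1) := by
  induction n generalizing x y with
  | zero => simp [alt, prs]
  | succ n ih =>
    cases n with
    | zero => simp [alt, prs]
    | succ n =>
      have := ih y (x+1)
      intro q hq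
      simp only [alt, prs, List.zip_cons_cons, List.tail_cons, List.mem_cons] at this hq
      rcases hq with rfl | hq
      · simp
      · have := this q hq
        omega

lemma alt_head (n x y : ℕ) (h : 0 < n) : (alt x y n).head? = some x := by
  cases n with
  | zero => omega
  | succ n => simp [alt]

lemma alt_last_odd (r x y : ℕ) : (alt x y (2*r+1)).getLast? = some (x+r) := by
  induction r generalizing x y with
  | zero => simp [alt]
  | succ r ih =>
    have : 2*(r+1)+1 = (2*r+1)+1+1 := by ring
    rw [this]
    have h2 := ih (x+1) (y+1)
    have h3 : (alt (x+1) (y+1) (2*r+1)) ≠ [] := by simp [alt]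
    simp only [alt] at h2 ⊢
    rw [List.getLast?_cons_cons, List.getLast?_cons_cons, h2]
    congr 1; omega

lemma alt_last_even (r x y : ℕ) (h : 0 < r) : (alt x y (2*r)).getLast? = some (y+r-1) := by
  obtain ⟨r, rfl⟩ : ∃ s, r = s+1 := ⟨r-1, by omega⟩
  have : 2*(r+1) = (2*r+1)+1 := by ring
  rw [this]
  have h2 := alt_last_odd r y (x+1)
  simp only [alt] at h2 ⊢
  rw [List.getLast?_cons_cons, h2]
  simp

lemma prs_append (u w : List ℕ) (x y : ℕ) (hu : u.getLast? = some x) (hw : w.head? = some y) :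
    prs (u ++ w) = prs u ++ (x,y) :: prs w := by
  induction u with
  | nil => simp at hu
  | cons c u ih =>
    cases u with
    | nil =>
      simp at hu
      subst hu
      cases w with
      | nil => simp at hw
      | cons d w => simp at hw; subst hw; simp [prs]
    | cons d u =>
      have := ih (by simpa using hu)
      simp only [prs, List.cons_append, List.tail_cons, List.zip_cons_cons] at this ⊢
      rw [this]

lemma prs_reverse (w : List ℕ) : (prs w.reverse).Perm ((prs w).map Prod.swap) := by
  induction w with
  | nil => simp [prs]
  | cons c w ih =>
    cases w with
    | nil => simp [prs]
    | cons d w =>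
      rw [List.reverse_cons, prs_append _ [c] d c (by simp) (by simp)]
      have e : prs (c :: d :: w) = (c,d) :: prs (d :: w) := by simp [prs]
      rw [e]
      have e2 : prs [c] = [] := by simp [prs]
      rw [e2, List.map_cons]
      refine (List.perm_append_singleton _ _).trans ?_
      exact ih.cons _

end DS

namespace DS

lemma labs_append (u w : List Pth) : labs (u ++ w) = labs u + labs w := by simp [labs]
lemma pairs_append (u w : List Pth) : pairs (u ++ w) = pairs u ++ pairs w := by simp [pairs]
lemma sms_append (u w : List Pth) : sms (u ++ w) = sms u + sms w := by simp [sms, pairs_append]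
lemma incs_append (v) (u w : List Pth) : incs v (u ++ w) = incs v u ++ incs v w := by simp [incs]
lemma lfs_append (u w : List Pth) : lfs (u ++ w) = lfs u ++ lfs w := by simp [lfs]
lemma spec_append (u w : List Pth) : spec (u ++ w) = spec u + spec w := by simp [spec]

lemma labs_mp (f) (ps : List Pth) : labs (ps.map (mp f)) = (labs ps).map f := by
  simp [labs, List.flatMap_map, mp, List.map_flatMap]
lemma pairs_mp (f) (ps : List Pth) : pairs (ps.map (mp f)) = (pairs ps).map (fun q => (f q.1, f q.2)) := by
  have h : ∀ w : List ℕ, prs (w.map f) = (prs w).map (fun q => (f q.1, f q.2)) := by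
    intro w
    simp only [prs, ← List.map_tail, List.zip_map]
    rfl
  simp [pairs, List.flatMap_map, mp, List.map_flatMap, h]
lemma sms_mp (f) (ps : List Pth) : sms (ps.map (mp f)) = ((pairs ps).map (fun q => f q.1 + f q.2) : List ℕ) := by
  simp only [sms, pairs_mp, List.map_map]; rfl
lemma inc_mp (v f) (p : Pth) : inc v (mp f p) = (inc v p).map f := by
  obtain ⟨t, w⟩ := p
  cases t with
  | none => cases v <;> simp [inc, mp] <;> [cases w.head? ; cases w.getLast?] <;> simp
  | some u =>
    by_cases h : u = v
    · simp [inc, mp, h]; cases w.head? <;> simp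
    · simp [inc, mp, h]
lemma lf_mp (f) (p : Pth) : lf (mp f p) = (lf p).map f := by
  obtain ⟨t, w⟩ := p
  cases t with
  | none => simp [lf, mp]
  | some u => simp [lf, mp]; cases w.getLast? <;> simp
lemma incs_mp (v f) (ps : List Pth) : incs v (ps.map (mp f)) = (incs v ps).map f := by
  simp [incs, List.flatMap_map, List.map_flatMap, inc_mp]
lemma lfs_mp (f) (ps : List Pth) : lfs (ps.map (mp f)) = (lfs ps).map f := by
  simp [lfs, List.flatMap_map, List.map_flatMap, lf_mp]
lemma spec_mp (f) (ps : List Pth) : spec (ps.map (mp f)) = spec ps := by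
  simp [spec, mp, Function.comp_def]

/-- number of entries above the threshold -/
def cnt (μ : ℕ) (l : List ℕ) : ℕ := l.countP (fun x => decide (μ < x))

lemma cnt_append (μ) (l l' : List ℕ) : cnt μ (l ++ l') = cnt μ l + cnt μ l' := by simp [cnt]

/-- the shift -/
def sh (μ δ η x : ℕ) : ℕ := if x ≤ μ then x + δ else x + δ + η

lemma sh_sum (μ δ η) (l : List ℕ) : (l.map (sh μ δ η)).sum = l.sum + δ * l.length + η * cnt μ l := by
  induction l with
  | nil => simp [cnt]
  | cons x l ih =>
    simp only [List.map_cons, List.sum_cons, ih, List.length_cons, cnt, List.countP_cons, sh]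
    by_cases h : x ≤ μ
    · simp [h, not_lt.mpr h]; ring
    · simp [h, not_le.mp h]; ring

lemma sh_cnt (μ δ η μ') (h1 : μ + δ ≤ μ') (h2 : μ' ≤ μ + δ + η) (l : List ℕ) :
    cnt μ' (l.map (sh μ δ η)) = cnt μ l := by
  simp only [cnt, List.countP_map]
  congr 1
  funext x
  simp only [Function.comp]
  apply decide_eq_decide.mpr
  simp only [sh]
  split_ifs <;> omega

lemma sh_R (μ δ η m : ℕ) (h : μ ≤ m) : (R 1 (m+1)).map (sh μ δ η) + (R 1 (δ+1) + R (μ+δ+1) (μ+δ+η+1))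
    = R 1 (m+δ+η+1) := by
  have e : R 1 (m+1) = R 1 (μ+1) + R (μ+1) (m+1) := (R_add (by omega) (by omega)).symm
  have e1 : (R 1 (μ+1)).map (sh μ δ η) = R (1+δ) (μ+1+δ) := by
    rw [← R_map 1 (μ+1) δ]
    apply Multiset.map_congr rfl
    intro x hx; rw [mem_R] at hx; simp [sh]; omega
  have e2 : (R (μ+1) (m+1)).map (sh μ δ η) = R (μ+1+(δ+η)) (m+1+(δ+η)) := by
    rw [← R_map (μ+1) (m+1) (δ+η)]
    apply Multiset.map_congr rfl
    intro x hx; rw [mem_R] at hx; simp only [sh]; split_ifs <;> omega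
  rw [e, Multiset.map_add, e1, e2]
  have g1 : R 1 (δ+1) + R (1+δ) (μ+1+δ) = R 1 (μ+δ+1) := by
    have := R_add (show 1 ≤ δ+1 by omega) (show δ+1 ≤ μ+δ+1 by omega)
    rw [← this]; congr 2 <;> omega
  have g2 : R (μ+δ+1) (μ+δ+η+1) + R (μ+1+(δ+η)) (m+1+(δ+η)) = R (μ+δ+1) (m+δ+η+1) := by
    have := R_add (show μ+δ+1 ≤ μ+δ+η+1 by omega) (show μ+δ+η+1 ≤ m+δ+η+1 by omega)
    rw [← this]; congr 2 <;> omega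
  rw [← R_add (show 1 ≤ μ+δ+1 by omega) (show μ+δ+1 ≤ m+δ+η+1 by omega), ← g1, ← g2]
  abel

structure St (m μ p q : ℕ) (ps : List Pth) : Prop where
  lab : labs ps = R 1 (m+1)
  mu : μ ≤ m
  nd : (sms ps).Nodup
  leaf : ∀ x ∈ lfs ps, x ≤ μ
  smu : ∀ s ∈ sms ps, μ < s
  vmu : ∀ v, μ < (incs v ps).sum
  smax : ∀ v, ∀ s ∈ sms ps, s < (incs v ps).sum
  da : (incs false ps).length = p + 1
  db : (incs true ps).length = q + 1
  deg : ∀ v, 3 ≤ (incs v ps).length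
  dn : ∀ v, 4 ≤ (incs v ps).length + cnt μ (incs v ps)
  mono : ∃ X1 X2, μ < X1 ∧ μ < X2 ∧ ∀ r ∈ pairs ps,
    ((μ < r.1 ∨ μ < r.2) ↔ X1 ≤ r.1 + r.2) ∧ ((μ < r.1 ∧ μ < r.2) ↔ X2 ≤ r.1 + r.2)

/-- every degree two vertex has an incident label above the threshold -/
def J (μ : ℕ) (ps : List Pth) : Prop := ∀ r ∈ pairs ps, μ < r.1 ∨ μ < r.2

lemma nodup_of_lt {α} (l : List α) (F G : α → ℕ) (h : ((l.map F : List ℕ) : Multiset ℕ).Nodup)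
    (hG : ∀ x ∈ l, ∀ y ∈ l, F x < F y → G x < G y) : ((l.map G : List ℕ) : Multiset ℕ).Nodup := by
  rw [Multiset.coe_nodup] at h ⊢
  induction l with
  | nil => simp
  | cons x l ih =>
    simp only [List.map_cons, List.nodup_cons, List.mem_map, not_exists, not_and] at h ⊢
    refine ⟨?_, ih h.2 (fun a ha b hb => hG a (by simp [ha]) b (by simp [hb]))⟩
    intro y hy he
    rcases lt_trichotomy (F x) (F y) with hl | hl | hl
    · have := hG x (by simp) y (by simp [hy]) hl; omega
    · exact h.1 y hy hl.symm
    · have := hG y (by simp [hy]) x (by simp) hl; omega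

lemma St.extend {m μ p q : ℕ} {ps : List Pth} (S : St m μ p q ps) (δ η μ' a' b' : ℕ) (nw : List Pth)
    (hδ : η ≤ δ) (h1 : μ + δ ≤ μ') (h2 : μ' ≤ μ + δ + η)
    (hlab : labs nw = R 1 (δ+1) + R (μ+δ+1) (μ+δ+η+1))
    (hnd : (sms nw).Nodup) (hlf : ∀ x ∈ lfs nw, x ≤ μ')
    (hs : ∀ s ∈ sms nw, μ' < s)
    (ha : (incs false nw).length = a') (hb : (incs true nw).length = b')
    (mode : (J μ ps ∧ ∀ r ∈ pairs nw, r.1 + r.2 ≤ μ + 2*δ + η ∧ (μ' < r.1 ∨ μ' < r.2) ∧ ¬ (μ' < r.1 ∧ μ' < r.2)) ∨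
      (∀ r ∈ pairs nw, r.1 + r.2 ≤ μ + 2*δ ∧ ¬ (μ' < r.1 ∨ μ' < r.2))) :
    St (m+δ+η) μ' (p+a') (q+b') (nw ++ ps.map (mp (sh μ δ η))) ∧
    (J μ ps → (∀ r ∈ pairs nw, μ' < r.1 ∨ μ' < r.2) → J μ' (nw ++ ps.map (mp (sh μ δ η)))) ∧
    (∀ v, (incs v (nw ++ ps.map (mp (sh μ δ η)))).sum = (incs v nw).sum + (incs v ps).sum
        + δ * (incs v ps).length + η * cnt μ (incs v ps)) ∧
    (∀ v, cnt μ' (incs v (nw ++ ps.map (mp (sh μ δ η)))) = cnt μ' (incs v nw) + cnt μ (incs v ps)) := by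
  have hsum : ∀ v, (incs v (nw ++ ps.map (mp (sh μ δ η)))).sum = (incs v nw).sum + (incs v ps).sum
        + δ * (incs v ps).length + η * cnt μ (incs v ps) := by
    intro v; rw [incs_append, incs_mp, List.sum_append, sh_sum]; ring
  have hcnt : ∀ v, cnt μ' (incs v (nw ++ ps.map (mp (sh μ δ η)))) = cnt μ' (incs v nw) + cnt μ (incs v ps) := by
    intro v; rw [incs_append, incs_mp, cnt_append, sh_cnt _ _ _ _ h1 h2]
  have hmulti : ∀ v, 2*δ + 2*η ≤ δ * (incs v ps).length + η * cnt μ (incs v ps) := by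
    intro v
    have d1 := S.deg v
    have d2 := S.dn v
    generalize (incs v ps).length = d at *
    generalize cnt μ (incs v ps) = n at *
    rcases Nat.lt_or_ge d 4 with h | h
    · have : d = 3 := by omega
      subst this
      have : η * 1 ≤ η * n := Nat.mul_le_mul_left _ (by omega)
      omega
    · have : δ * 4 ≤ δ * d := Nat.mul_le_mul_left _ h
      have : 0 ≤ η * n := Nat.zero_le _
      omega
  obtain ⟨X1, X2, hX1, hX2, hX⟩ := S.mono
  have hshb : ∀ x, x + δ ≤ sh μ δ η x ∧ sh μ δ η x ≤ x + δ + η ∧ (μ < x → sh μ δ η x = x + δ + η) ∧ (x ≤ μ → sh μ δ η x = x + δ) := by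
    intro x; simp only [sh]; split_ifs <;> omega
  have hsmem : ∀ s ∈ sms nw, ∃ r ∈ pairs nw, r.1 + r.2 = s := by
    intro s h; simpa [sms] using h
  have hpsmem : ∀ s ∈ sms ps, ∃ r ∈ pairs ps, r.1 + r.2 = s := by
    intro s h; simpa [sms] using h
  have hpsmem' : ∀ r ∈ pairs ps, r.1 + r.2 ∈ sms ps := by
    intro r h; simp only [sms, Multiset.mem_coe, List.mem_map]; exact ⟨r, h, rfl⟩
  have hold : ∀ s ∈ sms (ps.map (mp (sh μ δ η))), ∃ r ∈ pairs ps, sh μ δ η r.1 + sh μ δ η r.2 = s := by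
    intro s h; rw [sms_mp] at h; simpa using h
  have hnewub : ∀ s ∈ sms nw, s ≤ μ + 2*δ + η := by
    intro s h
    obtain ⟨r, hr, rfl⟩ := hsmem s h
    rcases mode with ⟨_, hm⟩ | hm
    · exact (hm r hr).1
    · have := (hm r hr).1; omega
  have holdlb : ∀ s ∈ sms (ps.map (mp (sh μ δ η))), μ + 2*δ < s ∧ (J μ ps → μ + 2*δ+η < s) := by
    intro s h
    obtain ⟨r, hr, rfl⟩ := hold s h
    have := S.smu _ (hpsmem' r hr)
    have b1 := hshb r.1
    have b2 := hshb r.2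
    refine ⟨by omega, fun hJ => ?_⟩
    have := hJ r hr
    rcases this with h | h
    · have := b1.2.2.1 h; omega
    · have := b2.2.2.1 h; omega
  refine ⟨⟨?_, ?_, ?_, ?_, ?_, ?_, ?_, ?_, ?_, ?_, ?_, ?_⟩, ?_, hsum, hcnt⟩
  · rw [labs_append, labs_mp, S.lab, hlab, add_comm, sh_R _ _ _ _ S.mu]
  · have := S.mu; omega
  · rw [sms_append, Multiset.nodup_add]
    refine ⟨hnd, ?_, ?_⟩
    · rw [sms_mp]
      refine nodup_of_lt _ (fun r : ℕ × ℕ => r.1 + r.2) _ S.nd ?_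
      intro x hx y hy hxy
      have hx' := hX x hx
      have hy' := hX y hy
      simp only [sh]
      split_ifs <;> omega
    · rw [Multiset.disjoint_left]
      intro s hs1 hs2
      have h1 := holdlb s hs2
      obtain ⟨r, hr, rfl⟩ := hsmem s hs1
      rcases mode with ⟨hJ, hm⟩ | hm
      · have := (hm r hr).1; have := h1.2 hJ; omega
      · have := (hm r hr).1; omega
  · intro x hx
    rw [lfs_append, lfs_mp, List.mem_append] at hx
    rcases hx with hx | hx
    · exact hlf x hx
    · obtain ⟨y, hy, rfl⟩ := List.mem_map.1 hx
      have := S.leaf y hy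
      have := (hshb y).2.2.2 this
      omega
  · intro s hs'
    rw [sms_append, Multiset.mem_add] at hs'
    rcases hs' with h | h
    · exact hs s h
    · have := (holdlb s h).1; omega
  · intro v
    have := hmulti v
    have := S.vmu v
    rw [hsum]; omega
  · intro v s hs'
    have a1 := hmulti v
    have a2 := S.vmu v
    rw [hsum]
    rw [sms_append, Multiset.mem_add] at hs'
    rcases hs' with h | h
    · have := hnewub s h; omega
    · obtain ⟨r, hr, rfl⟩ := hold s h
      have := S.smax v _ (hpsmem' r hr)
      have b1 := hshb r.1
      have b2 := hshb r.2
      omega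
  · rw [incs_append, incs_mp, List.length_append, List.length_map, ha, S.da]; omega
  · rw [incs_append, incs_mp, List.length_append, List.length_map, hb, S.db]; omega
  · intro v
    have := S.deg v
    rw [incs_append, incs_mp, List.length_append, List.length_map]; omega
  · intro v
    have := S.dn v
    rw [hcnt, incs_append, incs_mp, List.length_append, List.length_map]; omega
  · have key : ∀ r ∈ pairs (ps.map (mp (sh μ δ η))), ∃ t ∈ pairs ps, r.1 = sh μ δ η t.1 ∧ r.2 = sh μ δ η t.2 := by
      intro r hr
      rw [pairs_mp] at hr
      obtain ⟨t, ht, rfl⟩ := List.mem_map.1 hr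
      exact ⟨t, ht, rfl, rfl⟩
    rcases mode with ⟨hJ, hm⟩ | hm
    · refine ⟨μ'+1, max X2 (μ'+1-2*δ) + 2*δ+2*η, by omega, by omega, ?_⟩
      intro r hr
      rw [pairs_append, List.mem_append] at hr
      rcases hr with hr | hr
      · have := hm r hr
        have := hs (r.1+r.2) (by simp only [sms, Multiset.mem_coe, List.mem_map]; exact ⟨r, hr, rfl⟩)
        omega
      · obtain ⟨t, ht, e1, e2⟩ := key r hr
        have c1 := hX t ht
        have c2 := hJ t ht
        have c3 := S.smu _ (hpsmem' t ht)
        rw [e1, e2]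
        simp only [sh]
        split_ifs <;> omega
    · refine ⟨X1 + 2*δ+η, X2+2*δ+2*η, by omega, by omega, ?_⟩
      intro r hr
      rw [pairs_append, List.mem_append] at hr
      rcases hr with hr | hr
      · have := hm r hr
        omega
      · obtain ⟨t, ht, e1, e2⟩ := key r hr
        have c1 := hX t ht
        rw [e1, e2]
        simp only [sh]
        split_ifs <;> omega
  · intro hJ hn r hr
    rw [pairs_append, List.mem_append] at hr
    rcases hr with hr | hr
    · exact hn r hr
    · rw [pairs_mp] at hr
      obtain ⟨t, ht, rfl⟩ := List.mem_map.1 hr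
      have := hJ t ht
      simp only [sh]
      split_ifs <;> omega

end DS

namespace DS

/-- the four label counters used in the base constructions -/
structure Ctr where
  l : ℕ
  p : ℕ
  h : ℕ
  t : ℕ

/-- endings of a block -/
inductive En | plain | preT | postT | postTP

/-- A block: `blk tag lo od r e rev` alternates low and high labels (`lo`: low label first)
on `2 r + od` edges, with an optional ending, read backwards if `rev`;
`sp tag` is a single edge carrying a middle label. -/
inductive Blk
  | blk (tag : Option Bool) (lo od : Bool) (r : ℕ) (e : En) (rev : Bool)
  | sp (tag : Option Bool)

def nxt (c : Ctr) : Blk → Ctr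
  | .sp _ => ⟨c.l, c.p + 1, c.h, c.t⟩
  | .blk _ lo od r e _ =>
    ⟨c.l + r + cond (lo && od) 1 0, c.p + (match e with | .postTP => 1 | _ => 0),
      c.h + r + cond (!lo && od) 1 0, c.t + (match e with | .plain => 0 | _ => 1)⟩

def core (c : Ctr) (lo od : Bool) (r : ℕ) : List ℕ :=
  cond lo (alt c.l c.h (2*r + cond od 1 0)) (alt c.h c.l (2*r + cond od 1 0))

def full (c : Ctr) (lo od : Bool) (r : ℕ) : En → List ℕ
  | .plain => core c lo od r
  | .preT => c.t :: core c lo od r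
  | .postT => core c lo od r ++ [c.t]
  | .postTP => core c lo od r ++ [c.t, c.p]

def pth (c : Ctr) : Blk → Pth
  | .sp tag => (tag, [c.p])
  | .blk tag lo od r e rev => (tag, cond rev (full c lo od r e).reverse (full c lo od r e))

/-- first and last label of the alternating part -/
def cfst (c : Ctr) (lo : Bool) : ℕ := cond lo c.l c.h
def clst (c : Ctr) (lo od : Bool) (r : ℕ) : ℕ :=
  cond od (cond lo (c.l + r) (c.h + r)) (cond lo (c.h + r - 1) (c.l + r - 1))

def bfst (c : Ctr) : Blk → ℕ
  | .sp _ => c.p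
  | .blk _ _ _ _ .preT false => c.t
  | .blk _ lo _ _ _ false => cfst c lo
  | .blk _ lo od r .plain true => clst c lo od r
  | .blk _ lo od r .preT true => clst c lo od r
  | .blk _ _ _ _ .postT true => c.t
  | .blk _ _ _ _ .postTP true => c.p

def blst (c : Ctr) : Blk → ℕ
  | .sp _ => c.p
  | .blk _ _ _ _ .preT true => c.t
  | .blk _ lo _ _ _ true => cfst c lo
  | .blk _ lo od r .plain false => clst c lo od r
  | .blk _ lo od r .preT false => clst c lo od r
  | .blk _ _ _ _ .postT false => c.t
  | .blk _ _ _ _ .postTP false => c.p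

def btag : Blk → Option Bool
  | .sp t => t
  | .blk t _ _ _ _ _ => t

def blen : Blk → ℕ
  | .sp _ => 1
  | .blk _ _ od r e _ => 2*r + cond od 1 0 + (match e with | .plain => 0 | .postTP => 2 | _ => 1)

def binc (v : Bool) (c : Ctr) (b : Blk) : List ℕ :=
  match btag b with
  | none => cond v [blst c b] [bfst c b]
  | some u => cond (u == v) [bfst c b] []

def blf (c : Ctr) (b : Blk) : List ℕ :=
  match btag b with
  | none => []
  | some _ => [blst c b]

/-- the maximal sums of a block -/
def bmx (c : Ctr) : Blk → List ℕ
  | .sp _ => []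
  | .blk _ lo od r e _ => (c.l + c.h + 2*r + cond od 1 0 - 2) ::
    (match e with
      | .plain => []
      | .preT => [c.t + c.h]
      | .postT => [clst c lo od r + c.t]
      | .postTP => [clst c lo od r + c.t, c.t + c.p])

/-- admissibility of a block -/
def ok (Y : ℕ) (c : Ctr) : Blk → Prop
  | .sp _ => True
  | .blk _ lo od r e _ => 1 ≤ 2*r + cond od 1 0 ∧
    (match e with
      | .plain => True
      | .preT => lo = false
      | .postT => lo = !od
      | .postTP => lo = !od ∧ c.p + c.t < Y)

def build : Ctr → List Blk → List Pth
  | _, [] => []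
  | c, b :: bs => pth c b :: build (nxt c b) bs
def go (f : Ctr → Blk → List ℕ) : Ctr → List Blk → List ℕ
  | _, [] => []
  | c, b :: bs => f c b ++ go f (nxt c b) bs
def fin : Ctr → List Blk → Ctr
  | c, [] => c
  | c, b :: bs => fin (nxt c b) bs
def oks (Y : ℕ) : Ctr → List Blk → Prop
  | _, [] => True
  | c, b :: bs => ok Y c b ∧ oks Y (nxt c b) bs
def bspec (bs : List Blk) : Multiset (Option Bool × ℕ) := (bs.map (fun b => (btag b, blen b)) : List _)

lemma core_length (c lo od r) : (core c lo od r).length = 2*r + cond od 1 0 := by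
  cases lo <;> simp [core, alt_length]

lemma core_head (c : Ctr) (lo od : Bool) (r : ℕ) (h : 1 ≤ 2*r + cond od 1 0) :
    (core c lo od r).head? = some (cfst c lo) := by
  cases lo <;> simp [core, cfst] <;> exact alt_head _ _ _ (by omega)

lemma core_last (c : Ctr) (lo od : Bool) (r : ℕ) (h : 1 ≤ 2*r + cond od 1 0) :
    (core c lo od r).getLast? = some (clst c lo od r) := by
  cases od
  · have : 0 < r := by simp at h; omega
    cases lo <;> simp [core, clst] <;> rw [alt_last_even _ _ _ this]
  · cases lo <;> simp [core, clst] <;> rw [alt_last_odd]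

lemma full_head (c : Ctr) (lo od : Bool) (r : ℕ) (e : En) (h : 1 ≤ 2*r + cond od 1 0) :
    (full c lo od r e).head? = some (bfst c (.blk none lo od r e false)) := by
  cases e <;> simp [full, bfst, core_head c lo od r h]

lemma full_last (c : Ctr) (lo od : Bool) (r : ℕ) (e : En) (h : 1 ≤ 2*r + cond od 1 0) :
    (full c lo od r e).getLast? = some (blst c (.blk none lo od r e false)) := by
  cases e <;> simp [full, blst, core_last c lo od r h, List.getLast?_cons]

lemma pth_head {Y c b} (h : ok Y c b) : (pth c b).2.head? = some (bfst c b) := by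
  cases b with
  | sp => simp [pth, bfst]
  | blk tag lo od r e rev =>
    have h1 := h.1
    cases rev
    · simp only [pth, cond, full_head c lo od r e h1]; cases e <;> rfl
    · simp only [pth, cond, List.head?_reverse, full_last c lo od r e h1]; cases e <;> rfl

lemma pth_last {Y c b} (h : ok Y c b) : (pth c b).2.getLast? = some (blst c b) := by
  cases b with
  | sp => simp [pth, blst]
  | blk tag lo od r e rev =>
    have h1 := h.1
    cases rev
    · simp only [pth, cond, full_last c lo od r e h1]; cases e <;> rfl
    · simp only [pth, cond, List.getLast?_reverse, full_head c lo od r e h1]; cases e <;> rfl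

lemma pth_tag (c b) : (pth c b).1 = btag b := by cases b <;> rfl

lemma inc_pth {Y c b} (v) (h : ok Y c b) : inc v (pth c b) = binc v c b := by
  have h1 := pth_head h
  have h2 := pth_last h
  have h3 := pth_tag c b
  generalize pth c b = P at h1 h2 h3 ⊢
  obtain ⟨t, w⟩ := P
  change w.head? = _ at h1
  change w.getLast? = _ at h2
  change t = _ at h3
  subst h3
  rcases hb : btag b with _ | u
  · cases v <;> simp [inc, binc, hb, h1, h2]
  · cases v <;> cases u <;> simp [inc, binc, hb, h1]

lemma lf_pth {Y c b} (h : ok Y c b) : lf (pth c b) = blf c b := by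
  have h2 := pth_last h
  have h3 := pth_tag c b
  generalize pth c b = P at h2 h3 ⊢
  obtain ⟨t, w⟩ := P
  change w.getLast? = _ at h2
  change t = _ at h3
  subst h3
  rcases hb : btag b with _ | u <;> simp [lf, blf, hb, h2]

lemma len_pth (c b) : (pth c b).2.length = blen b := by
  rcases b with _ | ⟨tag⟩
  · rename_i tag lo od r e rev
    cases rev <;> cases e <;> simp [pth, full, blen, core_length]
  · rfl

lemma incs_build {Y c bs} (v) (h : oks Y c bs) : incs v (build c bs) = go (binc v) c bs := by
  induction bs generalizing c with
  | nil => rfl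
  | cons b bs ih =>
    have := ih h.2
    simp only [incs, build, List.flatMap_cons, go] at this ⊢
    rw [this, inc_pth v h.1]

lemma lfs_build {Y c bs} (h : oks Y c bs) : lfs (build c bs) = go blf c bs := by
  induction bs generalizing c with
  | nil => rfl
  | cons b bs ih =>
    have := ih h.2
    simp only [lfs, build, List.flatMap_cons, go] at this ⊢
    rw [this, lf_pth h.1]

lemma spec_build (c bs) : spec (build c bs) = bspec bs := by
  induction bs generalizing c with
  | nil => rfl
  | cons b bs ih =>
    have := ih (nxt c b)
    simp only [spec, build, bspec, List.map_cons, ← Multiset.cons_coe] at this ⊢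
    rw [this, len_pth, pth_tag]

def Le (c c' : Ctr) : Prop := c.l ≤ c'.l ∧ c.p ≤ c'.p ∧ c.h ≤ c'.h ∧ c.t ≤ c'.t

lemma nxt_le (c b) : Le c (nxt c b) := by
  cases b with
  | sp => simp [Le, nxt]
  | blk => simp only [Le, nxt]; omega

lemma fin_le (c bs) : Le c (fin c bs) := by
  induction bs generalizing c with
  | nil => simp [Le, fin]
  | cons b bs ih =>
    have h1 := ih (nxt c b)
    have h2 := nxt_le c b
    simp only [Le, fin] at *; omega

def RR (c c' : Ctr) : Multiset ℕ := R c.l c'.l + R c.p c'.p + R c.h c'.h + R c.t c'.t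

lemma RR_add {c d e : Ctr} (h1 : Le c d) (h2 : Le d e) : RR c d + RR d e = RR c e := by
  obtain ⟨a1,a2,a3,a4⟩ := h1
  obtain ⟨b1,b2,b3,b4⟩ := h2
  simp only [RR, ← R_add a1 b1, ← R_add a2 b2, ← R_add a3 b3, ← R_add a4 b4]
  abel

lemma core_labs (c : Ctr) (lo od r) : ((core c lo od r : List ℕ) : Multiset ℕ) =
    R c.l (c.l + r + cond (lo && od) 1 0) + R c.h (c.h + r + cond (!lo && od) 1 0) := by
  cases lo <;> cases od <;> simp only [core, cond, alt_labs, Bool.and_true, Bool.and_false, Bool.not_true, Bool.not_false]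
  · rw [add_comm]; congr 2 <;> omega
  · rw [add_comm]; congr 2 <;> omega
  · congr 2 <;> omega
  · congr 2 <;> omega

lemma pth_labs (c b) : (((pth c b).2 : List ℕ) : Multiset ℕ) = RR c (nxt c b) := by
  cases b with
  | sp => simp [pth, RR, nxt, R_self, R_succ]
  | blk tag lo od r e rev =>
    have : (((pth c (.blk tag lo od r e rev)).2 : List ℕ) : Multiset ℕ) = (full c lo od r e : List ℕ) := by
      cases rev <;> simp [pth]
    rw [this]
    simp only [RR, nxt]
    have h := core_labs c lo od r
    generalize R c.l (c.l + r + cond (lo && od) 1 0) = A at *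
    generalize R c.h (c.h + r + cond (!lo && od) 1 0) = B at *
    cases e <;> simp only [full, R_self, add_zero, R_succ, ← Multiset.cons_coe, ← Multiset.coe_add, ← Multiset.singleton_add, Multiset.coe_nil] <;> rw [h] <;> abel

lemma labs_build (c bs) : labs (build c bs) = RR c (fin c bs) := by
  induction bs generalizing c with
  | nil => simp [build, labs, fin, RR, R_self]
  | cons b bs ih =>
    have := ih (nxt c b)
    simp only [labs, build, List.flatMap_cons, fin, ← Multiset.coe_add] at this ⊢
    rw [this, pth_labs, RR_add (nxt_le _ _) (fin_le _ _)]

/-- facts about the degree-two sums of a block -/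
structure PF (Y : ℕ) (c c' : Ctr) (mx : List ℕ) (P : List (ℕ × ℕ)) : Prop where
  dec : ∃ C1 C2 C3 : Multiset ℕ, ((P.map (fun q => q.1 + q.2) : List ℕ) : Multiset ℕ) = C1 + C2 + C3 ∧
    C1.Nodup ∧ C2.Nodup ∧ C3.Nodup ∧ (∀ s ∈ C1, c.l + c.h ≤ s ∧ s + 2 ≤ c'.l + c'.h) ∧
    (∀ s ∈ C2, c.p + c.t ≤ s ∧ s + 2 ≤ c'.p + c'.t ∧ s < Y) ∧
    (∀ s ∈ C3, c.h + c.t ≤ s ∧ s + 2 ≤ c'.h + c'.t)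
  ub : ∀ X, (∀ s ∈ mx, s < X) → ∀ r ∈ P, r.1 + r.2 < X
  hi : ∀ r ∈ P, c.h ≤ r.1 ∨ c.h ≤ r.2 ∨ c.t ≤ r.1 ∨ c.t ≤ r.2
  thr : ∀ r ∈ P, ((r.1 < c'.l ∨ r.2 < c'.l) ∧ r.1 + r.2 + 2 ≤ c'.l + c'.h) ∨
    ((r.1 < c'.p ∨ r.2 < c'.p) ∧ r.1 + r.2 < Y) ∨
    (c.h ≤ r.1 ∧ c.t ≤ r.2) ∨ (c.h ≤ r.2 ∧ c.t ≤ r.1)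

lemma alt_prs_mem' (n x y : ℕ) : ∀ q ∈ prs (alt x y n), (x ≤ q.1 ∧ q.1 < x + (n+1)/2 ∧ y ≤ q.2 ∧ q.2 < y + n/2) ∨
    (x ≤ q.2 ∧ q.2 < x + (n+1)/2 ∧ y ≤ q.1 ∧ q.1 < y + n/2) := by
  induction n generalizing x y with
  | zero => simp [alt, prs]
  | succ n ih =>
    cases n with
    | zero => simp [alt, prs]
    | succ n =>
      have := ih y (x+1)
      intro q hq
      simp only [alt, prs, List.zip_cons_cons, List.tail_cons, List.mem_cons] at this hq
      rcases hq with rfl | hq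
      · simp
      · have := this q hq
        omega

lemma core_prs_mem (c : Ctr) (lo od r) (q) (h : q ∈ prs (core c lo od r)) :
    (c.h ≤ q.1 ∨ c.h ≤ q.2) ∧ (q.1 < c.l + r + cond (lo && od) 1 0 ∨ q.2 < c.l + r + cond (lo && od) 1 0) ∧
    c.l + c.h ≤ q.1 + q.2 ∧ q.1 + q.2 + 2 ≤ c.l + c.h + 2*r + cond od 1 0 := by
  have key : ∀ x y n, q ∈ prs (alt x y n) → x + y ≤ q.1 + q.2 ∧ q.1 + q.2 + 2 ≤ x + y + n := by
    intro x y n hq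
    have : q.1 + q.2 ∈ R (x+y) (x+y+(n-1)) := by
      rw [← alt_prs_sums, Multiset.mem_coe, List.mem_map]; exact ⟨q, hq, rfl⟩
    rw [mem_R] at this; omega
  cases lo <;> simp only [core, cond_true, cond_false] at h <;> have h1 := key _ _ _ h <;>
    have h2 := alt_prs_mem' _ _ _ q h <;> cases od <;> simp at * <;> omega

lemma core_sums (c : Ctr) (lo od r) : (((prs (core c lo od r)).map (fun q => q.1+q.2) : List ℕ) : Multiset ℕ)
    = R (c.l + c.h) (c.l + c.h + (2*r + cond od 1 0 - 1)) := by
  cases lo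
  · simp only [core, cond_false, alt_prs_sums]; rw [add_comm c.h]
  · simp only [core, cond_true, alt_prs_sums]

lemma clst_hi (c : Ctr) {lo od r} (h1 : 1 ≤ 2*r + cond od 1 0) (h : lo = !od) : clst c lo od r + 1 = c.h + r + cond (!lo && od) 1 0 := by
  subst h; cases od <;> simp [clst] at * ; omega

lemma full_PF {Y c lo od r e tag rev} (h : ok Y c (.blk tag lo od r e rev)) :
    PF Y c (nxt c (.blk tag lo od r e rev)) (bmx c (.blk tag lo od r e rev)) (prs (full c lo od r e)) := by
  obtain ⟨h1, h2⟩ := h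
  have A := core_sums c lo od r
  have B := core_prs_mem c lo od r
  have L := core_last c lo od r h1
  have H := core_head c lo od r h1
  have hl : (∀ s ∈ R (c.l + c.h) (c.l + c.h + (2*r + cond od 1 0 - 1)), c.l + c.h ≤ s ∧
      s + 2 ≤ c.l + r + cond (lo && od) 1 0 + (c.h + r + cond (!lo && od) 1 0)) := by
    intro s hs; rw [mem_R] at hs; cases lo <;> cases od <;> simp at * <;> omega
  have hl' : c.l + c.h + 2*r + cond od 1 0 = c.l + r + cond (lo && od) 1 0 + (c.h + r + cond (!lo && od) 1 0) := by
    cases lo <;> cases od <;> simp at * <;> omega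
  cases e with
  | plain =>
    simp only [full, nxt, bmx]
    refine ⟨⟨_, 0, 0, by rw [A, add_zero, add_zero], R_nodup _ _, by simp, by simp, hl, by simp, by simp⟩, ?_, ?_, ?_⟩
    · intro X hX q hq; simp at hX; have := B q hq; omega
    · intro q hq; have := B q hq; omega
    · intro q hq; have := B q hq; simp only; omega
  | preT =>
    have e : prs (c.t :: core c lo od r) = (c.t, c.h) :: prs (core c lo od r) := by
      have := prs_append [c.t] (core c lo od r) c.t _ rfl H
      rw [List.singleton_append] at this
      rw [this]; simp only at h2; subst h2; simp [prs, cfst]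
    simp only at h2
    subst h2
    simp only [full, nxt, bmx, e]
    refine ⟨⟨_, 0, {c.t + c.h}, by rw [List.map_cons, ← Multiset.cons_coe, A, ← Multiset.singleton_add, add_zero, add_comm], R_nodup _ _, by simp, by simp, hl, by simp, ?_⟩, ?_, ?_, ?_⟩
    · cases od <;> simp at * <;> omega
    · intro X hX q hq; simp at hX hq
      rcases hq with rfl | hq
      · simp only; omega
      · have := B q hq; omega
    · intro q hq; simp at hq
      rcases hq with rfl | hq
      · simp
      · have := B q hq; omega
    · intro q hq; simp at hq
      rcases hq with rfl | hq
      · simp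
      · have := B q hq; simp only; omega
  | postT =>
    have e : prs (core c lo od r ++ [c.t]) = prs (core c lo od r) ++ [(clst c lo od r, c.t)] := by
      rw [prs_append (core c lo od r) [c.t] _ c.t L rfl]; simp [prs]
    have hc := clst_hi c h1 h2
    have hc2 : c.h ≤ clst c lo od r := by simp only at h2; subst h2; cases od <;> simp at * <;> omega
    simp only [full, nxt, bmx, e]
    refine ⟨⟨_, 0, {clst c lo od r + c.t}, by rw [List.map_append, ← Multiset.coe_add, A, add_zero]; rfl, R_nodup _ _, by simp, by simp, hl, by simp, ?_⟩, ?_, ?_, ?_⟩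
    · simp; omega
    · intro X hX q hq; simp at hX hq
      rcases hq with hq | rfl
      · have := B q hq; omega
      · simp only; omega
    · intro q hq; simp at hq
      rcases hq with hq | rfl
      · have := B q hq; omega
      · simp
    · intro q hq; simp at hq
      rcases hq with hq | rfl
      · have := B q hq; simp only; omega
      · simp [hc2]
  | postTP =>
    have e : prs (core c lo od r ++ [c.t, c.p]) = prs (core c lo od r) ++ [(clst c lo od r, c.t), (c.t, c.p)] := by
      rw [prs_append (core c lo od r) [c.t, c.p] _ c.t L rfl]; simp [prs]
    have hc := clst_hi c h1 h2.1
    have hc2 : c.h ≤ clst c lo od r := by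
      have h3 := h2.1; subst h3; cases od <;> simp at * <;> omega
    have h3 := h2.2
    simp only [full, nxt, bmx, e]
    refine ⟨⟨R (c.l + c.h) (c.l + c.h + (2*r + cond od 1 0 - 1)), {c.t + c.p}, {clst c lo od r + c.t}, by rw [List.map_append, ← Multiset.coe_add, A, add_assoc (R _ _) {_}, add_comm ({_} : Multiset ℕ)]; rfl, R_nodup _ _, by simp, by simp, hl, ?_, ?_⟩, ?_, ?_, ?_⟩
    · simp; omega
    · simp; omega
    · intro X hX q hq; simp at hX hq
      rcases hq with hq | rfl | rfl
      · have := B q hq; omega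
      · simp only; omega
      · simp only; omega
    · intro q hq; simp at hq
      rcases hq with hq | rfl | rfl
      · have := B q hq; omega
      · simp
      · simp
    · intro q hq; simp at hq
      rcases hq with hq | rfl | rfl
      · have := B q hq; simp only; omega
      · simp [hc2]
      · simp; omega

lemma PF.perm {Y c c' mx P} (Q : List (ℕ × ℕ)) (h : PF Y c c' mx P) (hp : Q.Perm (P.map Prod.swap)) : PF Y c c' mx Q := by
  have hm : ∀ r ∈ Q, (r.2, r.1) ∈ P := by
    intro r hr
    have := hp.subset hr
    simp at this
    obtain ⟨a, b, h, rfl⟩ := this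
    exact h
  refine ⟨?_, ?_, ?_, ?_⟩
  · obtain ⟨C1, C2, C3, e, rest⟩ := h.dec
    refine ⟨C1, C2, C3, ?_, rest⟩
    rw [← e]
    have := hp.map (fun q : ℕ × ℕ => q.1 + q.2)
    rw [Multiset.coe_eq_coe.2 this, List.map_map]
    congr 2
    funext q; simp [add_comm]
  · intro X hX r hr; have := h.ub X hX _ (hm r hr); simp only at this; omega
  · intro r hr; have := h.hi _ (hm r hr); simp only at this; omega
  · intro r hr; have := h.thr _ (hm r hr); simp only at this; omega

lemma pth_PF {Y c b} (h : ok Y c b) : PF Y c (nxt c b) (bmx c b) (prs (pth c b).2) := by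
  cases b with
  | sp => refine ⟨⟨0, 0, 0, ?_⟩, ?_, ?_, ?_⟩ <;> simp [pth, prs]
  | blk tag lo od r e rev =>
    cases rev
    · exact full_PF h
    · exact (full_PF h).perm _ (prs_reverse _)

lemma build_PF {Y c bs} (h : oks Y c bs) : PF Y c (fin c bs) (go bmx c bs) (pairs (build c bs)) := by
  induction bs generalizing c with
  | nil => refine ⟨⟨0, 0, 0, ?_⟩, ?_, ?_, ?_⟩ <;> simp [build, pairs]
  | cons b bs ih =>
    have h1 := pth_PF h.1
    have h2 := ih h.2
    have l1 := nxt_le c b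
    have l2 := fin_le (nxt c b) bs
    simp only [build, pairs, List.flatMap_cons, go, fin] at h2 ⊢
    obtain ⟨⟨C1, C2, C3, e, n1, n2, n3, b1, b2, b3⟩, u, hi, th⟩ := h1
    obtain ⟨⟨D1, D2, D3, e', n1', n2', n3', b1', b2', b3'⟩, u', hi', th'⟩ := h2
    simp only [Le] at l1 l2
    refine ⟨⟨C1 + D1, C2 + D2, C3 + D3, ?_, ?_, ?_, ?_, ?_, ?_, ?_⟩, ?_, ?_, ?_⟩
    · rw [List.map_append, ← Multiset.coe_add, e, e']; abel
    · rw [Multiset.nodup_add]; refine ⟨n1, n1', Multiset.disjoint_left.2 ?_⟩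
      intro s hs hs'; have := b1 s hs; have := b1' s hs'; omega
    · rw [Multiset.nodup_add]; refine ⟨n2, n2', Multiset.disjoint_left.2 ?_⟩
      intro s hs hs'; have := b2 s hs; have := b2' s hs'; omega
    · rw [Multiset.nodup_add]; refine ⟨n3, n3', Multiset.disjoint_left.2 ?_⟩
      intro s hs hs'; have := b3 s hs; have := b3' s hs'; omega
    · intro s hs; rw [Multiset.mem_add] at hs
      rcases hs with hs | hs
      · have := b1 s hs; omega
      · have := b1' s hs; omega
    · intro s hs; rw [Multiset.mem_add] at hs
      rcases hs with hs | hs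
      · have := b2 s hs; omega
      · have := b2' s hs; omega
    · intro s hs; rw [Multiset.mem_add] at hs
      rcases hs with hs | hs
      · have := b3 s hs; omega
      · have := b3' s hs; omega
    · intro X hX r hr
      simp only [List.mem_append] at hX hr
      rcases hr with hr | hr
      · exact u X (fun s hs => hX s (Or.inl hs)) r hr
      · exact u' X (fun s hs => hX s (Or.inr hs)) r hr
    · intro r hr
      rcases List.mem_append.1 hr with hr | hr
      · exact hi r hr
      · have := hi' r hr; omega
    · intro r hr
      rcases List.mem_append.1 hr with hr | hr
      · have := th r hr; omega
      · have := th' r hr; omega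
end DS

namespace DS

structure Fnl (ps : List Pth) : Prop where
  lab : ∃ m, labs ps = R 1 (m+1)
  nd : (sms ps).Nodup
  ls : ∀ x ∈ lfs ps, ∀ s ∈ sms ps, x < s
  lv : ∀ v, ∀ x ∈ lfs ps, x < (incs v ps).sum
  sv : ∀ v, ∀ s ∈ sms ps, s < (incs v ps).sum

lemma St.fnl {m μ p q ps} (S : St m μ p q ps) : Fnl ps :=
  ⟨⟨m, S.lab⟩, S.nd, fun x hx s hs => lt_of_le_of_lt (S.leaf x hx) (S.smu s hs),
    fun v x hx => lt_of_le_of_lt (S.leaf x hx) (S.vmu v), S.smax⟩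

def cadd (c d : Ctr) : Ctr := ⟨c.l + d.l, c.p + d.p, c.h + d.h, c.t + d.t⟩
def tot (bs : List Blk) : Ctr := fin ⟨0,0,0,0⟩ bs
def c0 (bs : List Blk) : Ctr :=
  ⟨1, 1 + (tot bs).l, 1 + (tot bs).l + (tot bs).p, 1 + (tot bs).l + (tot bs).p + (tot bs).h⟩

lemma nxt_add (c d b) : nxt (cadd c d) b = cadd c (nxt d b) := by
  cases b with
  | sp => simp [nxt, cadd]; omega
  | blk => simp only [nxt, cadd, Ctr.mk.injEq]; omega

lemma fin_add (c d bs) : fin (cadd c d) bs = cadd c (fin d bs) := by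
  induction bs generalizing d with
  | nil => rfl
  | cons b bs ih => simp only [fin, nxt_add, ih]

lemma fin_tot (c bs) : fin c bs = cadd c (tot bs) := by
  rw [tot, ← fin_add]; rfl

def bfH : Blk → Bool
  | .sp _ => false
  | .blk _ _ _ _ .preT false => true
  | .blk _ lo _ _ _ false => !lo
  | .blk _ lo od _ .plain true => xor lo od
  | .blk _ lo od _ .preT true => xor lo od
  | .blk _ _ _ _ .postT true => true
  | .blk _ _ _ _ .postTP true => false

def blH : Blk → Bool
  | .sp _ => false
  | .blk _ _ _ _ .preT true => true
  | .blk _ lo _ _ _ true => !lo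
  | .blk _ lo od _ .plain false => xor lo od
  | .blk _ lo od _ .preT false => xor lo od
  | .blk _ _ _ _ .postT false => true
  | .blk _ _ _ _ .postTP false => false

def bH (v : Bool) (b : Blk) : ℕ :=
  match btag b with
  | none => cond v (cond (blH b) 1 0) (cond (bfH b) 1 0)
  | some u => cond (u == v) (cond (bfH b) 1 0) 0

def hct (v : Bool) (bs : List Blk) : ℕ := (bs.map (bH v)).sum

lemma bfst_H {Y μ c b} (h : ok Y c b) (h1 : (nxt c b).l ≤ μ + 1) (h2 : (nxt c b).p ≤ μ + 1) (h3 : μ < c.h) (h4 : μ < c.t) :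
    (μ < bfst c b ↔ bfH b = true) ∧ (μ < blst c b ↔ blH b = true) := by
  cases b with
  | sp => simp [bfst, blst, bfH, blH, nxt] at *; omega
  | blk tag lo od r e rev =>
    have := h.1
    cases e <;> cases lo <;> cases od <;> cases rev <;> simp [bfst, blst, bfH, blH, nxt, cfst, clst] at * <;> omega

lemma cnt_go {Y μ c bs} (v) (h : oks Y c bs) (h1 : (fin c bs).l ≤ μ + 1) (h2 : (fin c bs).p ≤ μ + 1) (h3 : μ < c.h) (h4 : μ < c.t) :
    cnt μ (go (binc v) c bs) = hct v bs := by
  induction bs generalizing c with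
  | nil => rfl
  | cons b bs ih =>
    have l1 := nxt_le c b
    have l2 := fin_le (nxt c b) bs
    simp only [Le, fin] at *
    have := ih h.2 h1 h2 (by omega) (by omega)
    obtain ⟨k1, k2⟩ := bfst_H h.1 (by omega) (by omega) h3 h4
    simp only [go, cnt_append, this, hct, List.map_cons, List.sum_cons]
    congr 1
    simp only [binc, bH]
    rcases btag b with _ | u
    · cases v
      · simp only [cnt, cond_false, List.countP_cons, List.countP_nil, k1]; cases bfH b <;> simp
      · simp only [cnt, cond_true, List.countP_cons, List.countP_nil, k2]; cases blH b <;> simp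
    · cases u <;> cases v <;> simp only [cnt, BEq.rfl, beq_iff_eq, Bool.true_beq, Bool.false_beq, Bool.not_true, Bool.not_false, cond_true, cond_false, List.countP_cons, List.countP_nil, k1] <;> cases bfH b <;> simp

/-- conditions on a list of blocks -/
structure Gd (μ : ℕ) (bs : List Blk) : Prop where
  ok : oks ((c0 bs).h + (c0 bs).t) (c0 bs) bs
  hl : ∀ x ∈ go blf (c0 bs) bs, x ≤ μ
  hv : ∀ v, μ < (go (binc v) (c0 bs) bs).sum
  hx : ∀ v, ∀ s ∈ go bmx (c0 bs) bs, s < (go (binc v) (c0 bs) bs).sum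

lemma Gd.labs {μ bs} (_ : Gd μ bs) : labs (build (c0 bs) bs) =
    R 1 ((tot bs).l + (tot bs).p + (tot bs).h + (tot bs).t + 1) := by
  rw [labs_build, fin_tot]
  simp only [RR, c0, cadd]
  rw [R_add (by omega) (by omega), R_add (by omega) (by omega), R_add (by omega) (by omega)]
  congr 1; omega

lemma Gd.nd {μ bs} (g : Gd μ bs) : (sms (build (c0 bs) bs)).Nodup := by
  obtain ⟨⟨C1, C2, C3, e, n1, n2, n3, b1, b2, b3⟩, -, -, -⟩ := build_PF g.ok
  simp only [sms, e]
  rw [fin_tot] at b1 b2 b3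
  simp only [c0, cadd] at b1 b2 b3
  rw [Multiset.nodup_add, Multiset.nodup_add]
  refine ⟨⟨n1, n2, Multiset.disjoint_left.2 ?_⟩, n3, Multiset.disjoint_left.2 ?_⟩
  · intro s hs hs'; have := b1 s hs; have := b2 s hs'; omega
  · intro s hs hs'
    have := b3 s hs'
    rcases Multiset.mem_add.1 hs with h | h
    · have := b1 s h; omega
    · have := b2 s h; omega

lemma Gd.smu {μ bs} (g : Gd μ bs) (hμ : μ ≤ (c0 bs).h) : ∀ s ∈ sms (build (c0 bs) bs), μ < s := by
  obtain ⟨⟨C1, C2, C3, e, n1, n2, n3, b1, b2, b3⟩, -, -, -⟩ := build_PF g.ok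
  simp only [sms, e]
  simp only [c0] at *
  intro s hs
  rcases Multiset.mem_add.1 hs with h | h
  · rcases Multiset.mem_add.1 h with h | h
    · have := b1 s h; omega
    · have := b2 s h; omega
  · have := b3 s h; omega

lemma Gd.fnl {μ bs} (g : Gd μ bs) (hμ : μ ≤ (c0 bs).h) : Fnl (build (c0 bs) bs) := by
  refine ⟨⟨_, g.labs⟩, g.nd, ?_, ?_, ?_⟩
  · intro x hx s hs
    rw [lfs_build g.ok] at hx
    exact lt_of_le_of_lt (g.hl x hx) (g.smu hμ s hs)
  · intro v x hx
    rw [lfs_build g.ok] at hx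
    rw [incs_build v g.ok]
    exact lt_of_le_of_lt (g.hl x hx) (g.hv v)
  · intro v s hs
    simp only [sms, Multiset.mem_coe, List.mem_map] at hs
    obtain ⟨r, hr, rfl⟩ := hs
    rw [incs_build v g.ok]
    exact (build_PF g.ok).ub _ (g.hx v) r hr

lemma Gd.st {μ bs p q} (g : Gd μ bs) (hμ : μ ≤ (c0 bs).h)
    (hm : μ ≤ (tot bs).l + (tot bs).p + (tot bs).h + (tot bs).t)
    (da : (go (binc false) (c0 bs) bs).length = p + 1)
    (db : (go (binc true) (c0 bs) bs).length = q + 1) (hp : 2 ≤ p) (hq : 2 ≤ q)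
    (dn : ∀ v, 4 ≤ (go (binc v) (c0 bs) bs).length + cnt μ (go (binc v) (c0 bs) bs))
    (mono : ∃ X1 X2, μ < X1 ∧ μ < X2 ∧ ∀ r ∈ pairs (build (c0 bs) bs),
    ((μ < r.1 ∨ μ < r.2) ↔ X1 ≤ r.1 + r.2) ∧ ((μ < r.1 ∧ μ < r.2) ↔ X2 ≤ r.1 + r.2)) :
    St ((tot bs).l + (tot bs).p + (tot bs).h + (tot bs).t) μ p q (build (c0 bs) bs) := by
  have f := g.fnl hμ
  have hb := fun v => incs_build v g.ok
  refine ⟨g.labs, ?_, f.nd, ?_, g.smu hμ, ?_, f.sv, ?_, ?_, ?_, ?_, mono⟩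
  · exact hm
  · intro x hx; rw [lfs_build g.ok] at hx; exact g.hl x hx
  · intro v; rw [hb]; exact g.hv v
  · rw [hb, da]
  · rw [hb, db]
  · intro v; rw [hb]; cases v
    · rw [da]; omega
    · rw [db]; omega
  · intro v; rw [hb]; exact dn v

/-- conditions for a strong state -/
structure Gs (bs : List Blk) (p q : ℕ) : Prop where
  g : Gd ((c0 bs).h - 1) bs
  da : (go (binc false) (c0 bs) bs).length = p + 1
  db : (go (binc true) (c0 bs) bs).length = q + 1
  hp : 2 ≤ p
  hq : 2 ≤ q
  dna : 3 ≤ p + hct false bs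
  dnb : 3 ≤ q + hct true bs
  n : p + hct false bs ≤ q + hct true bs
  lt : (go (binc false) (c0 bs) bs).sum < (go (binc true) (c0 bs) bs).sum

def SP (la lb : Multiset ℕ) (k : ℕ) : Multiset (Option Bool × ℕ) :=
  (none, k) ::ₘ (la.map (fun n => (some false, n)) + lb.map (fun n => (some true, n)))

def Weak (la lb : Multiset ℕ) (k : ℕ) : Prop := ∃ m μ ps, spec ps = SP la lb k ∧
  St m μ la.card lb.card ps ∧ (incs false ps).sum < (incs true ps).sum ∧
  la.card + cnt μ (incs false ps) ≤ lb.card + cnt μ (incs true ps)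

def Strong (la lb : Multiset ℕ) (k : ℕ) : Prop := ∃ m μ ps, spec ps = SP la lb k ∧
  (St m μ la.card lb.card ps ∧ (incs false ps).sum < (incs true ps).sum ∧
  la.card + cnt μ (incs false ps) ≤ lb.card + cnt μ (incs true ps)) ∧ J μ ps

lemma Strong.weak {la lb k} (h : Strong la lb k) : Weak la lb k := by
  obtain ⟨m, μ, ps, h1, h2, -⟩ := h
  exact ⟨m, μ, ps, h1, h2⟩

lemma Gs.strong {bs p q} (s : Gs bs p q) {la lb : Multiset ℕ} {k : ℕ} (hs : bspec bs = SP la lb k)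
    (hp : la.card = p) (hq : lb.card = q) : Strong la lb k := by
  have hm : (c0 bs).h - 1 + 1 = (c0 bs).h := by simp only [c0]; omega
  have hJ : J ((c0 bs).h - 1) (build (c0 bs) bs) := by
    intro r hr
    have := (build_PF s.g.ok).hi r hr
    simp only [c0] at *
    omega
  have hcnt : ∀ v, cnt ((c0 bs).h - 1) (go (binc v) (c0 bs) bs) = hct v bs := by
    intro v
    apply cnt_go v s.g.ok <;> simp only [fin_tot, cadd, c0] <;> omega
  have hb := fun v => incs_build v s.g.ok
  have S : St ((tot bs).l + (tot bs).p + (tot bs).h + (tot bs).t) ((c0 bs).h - 1) p q (build (c0 bs) bs) := by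
    refine s.g.st (by omega) (by simp only [c0]; omega) s.da s.db s.hp s.hq ?_ ?_
    · intro v; rw [hcnt]; have := s.dna; have := s.dnb; cases v
      · rw [s.da]; omega
      · rw [s.db]; omega
    · refine ⟨(c0 bs).h, (c0 bs).h + (c0 bs).t, by omega, by simp only [c0]; omega, ?_⟩
      intro r hr
      have h1 := hJ r hr
      have h2 := (build_PF s.g.ok).thr r hr
      rw [fin_tot] at h2
      simp only [c0, cadd] at *
      omega
  refine ⟨_, _, _, by rw [spec_build, hs], ⟨by rw [hp, hq]; exact S, ?_, ?_⟩, hJ⟩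
  · rw [hb, hb]; exact s.lt
  · rw [hb, hb, hcnt, hcnt, hp, hq]; exact s.n
end DS

namespace DS
open Blk En

abbrev Ein (v : Bool) (r : ℕ) : Blk := blk (some v) true false r plain true
abbrev Eout (v : Bool) (r : ℕ) : Blk := blk (some v) false false r plain false
abbrev Oin (v : Bool) (r : ℕ) : Blk := blk (some v) true true r plain true
abbrev Oout (v : Bool) (r : ℕ) : Blk := blk (some v) true true r plain false
abbrev OT (v : Bool) (r : ℕ) : Blk := blk (some v) true false r postT true
abbrev TP (v : Bool) (r : ℕ) : Blk := blk (some v) true false r postTP true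
/-- cores: odd with high ends -/
abbrev KHH (rev : Bool) (c : ℕ) : Blk := blk none false true c plain rev
/-- cores: even, with an extra top label at the first end -/
abbrev KT (rev : Bool) (c : ℕ) : Blk := blk none false true c preT rev
abbrev KT' (rev : Bool) (c : ℕ) : Blk := blk none false true c postT rev
abbrev KLH (rev : Bool) (c : ℕ) : Blk := blk none true false c plain rev
abbrev KHL (rev : Bool) (c : ℕ) : Blk := blk none false false c plain rev



attribute [simp] oks ok go blf blst bfst btag blen cfst clst binc bmx nxt c0 tot fin hct bH bfH blH

lemma tab {la lb : Multiset ℕ} {k p q : ℕ} (bs : List Blk) (L : List (Option Bool × ℕ))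
    (hL : bs.map (fun b => (btag b, blen b)) = L)
    (hs : (L : Multiset (Option Bool × ℕ)) = SP la lb k)
    (hp : la.card = p) (hq : lb.card = q)
    (h1 : (go (binc false) (c0 bs) bs).length = p + 1 ∧ (go (binc true) (c0 bs) bs).length = q + 1 ∧
      2 ≤ p ∧ 2 ≤ q ∧ 3 ≤ p + hct false bs ∧ 3 ≤ q + hct true bs ∧ p + hct false bs ≤ q + hct true bs)
    (h2 : oks ((c0 bs).h + (c0 bs).t) (c0 bs) bs ∧ (∀ x ∈ go blf (c0 bs) bs, x ≤ (c0 bs).h - 1) ∧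
      (c0 bs).h - 1 < (go (binc false) (c0 bs) bs).sum ∧
      (∀ s ∈ go bmx (c0 bs) bs, s < (go (binc false) (c0 bs) bs).sum) ∧
      (go (binc false) (c0 bs) bs).sum < (go (binc true) (c0 bs) bs).sum) : Strong la lb k := by
  obtain ⟨a1, a2, a3, a4, a5, a6, a7⟩ := h1
  obtain ⟨b1, b2, b3, b4, b5⟩ := h2
  exact Gs.strong (bs := bs) ⟨⟨b1, b2, Bool.forall_bool.2 ⟨b3, b3.trans b5⟩, Bool.forall_bool.2 ⟨b4, fun s hs => (b4 s hs).trans b5⟩⟩, a1, a2, a3, a4, a5, a6, a7, b5⟩ (by rw [← hs, ← hL]; rfl) hp hq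

/-- final labelings with different sums at the two branch vertices -/
def NE (la lb : Multiset ℕ) (k : ℕ) : Prop := ∃ ps, spec ps = SP la lb k ∧ Fnl ps ∧
  (incs false ps).sum ≠ (incs true ps).sum

lemma tab0 {la lb : Multiset ℕ} {k : ℕ} (bs : List Blk) (L : List (Option Bool × ℕ))
    (hL : bs.map (fun b => (btag b, blen b)) = L)
    (hs : (L : Multiset (Option Bool × ℕ)) = SP la lb k) (μ : ℕ) (v : Bool)
    (h2 : oks ((c0 bs).h + (c0 bs).t) (c0 bs) bs ∧ μ ≤ (c0 bs).h ∧ (∀ x ∈ go blf (c0 bs) bs, x ≤ μ) ∧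
      μ < (go (binc v) (c0 bs) bs).sum ∧
      (∀ s ∈ go bmx (c0 bs) bs, s < (go (binc v) (c0 bs) bs).sum) ∧
      (go (binc v) (c0 bs) bs).sum < (go (binc (!v)) (c0 bs) bs).sum) : NE la lb k := by
  obtain ⟨b1, b0, b2, b3, b4, b5⟩ := h2
  have b4' : ∀ s ∈ go bmx (c0 bs) bs, s < (go (binc (!v)) (c0 bs) bs).sum := fun s hs => (b4 s hs).trans b5
  have g : Gd μ bs := by
    cases v
    · exact ⟨b1, b2, Bool.forall_bool.2 ⟨b3, b3.trans b5⟩, Bool.forall_bool.2 ⟨b4, b4'⟩⟩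
    · exact ⟨b1, b2, Bool.forall_bool.2 ⟨b3.trans b5, b3⟩, Bool.forall_bool.2 ⟨b4', b4⟩⟩
  refine ⟨_, ?_, g.fnl b0, ?_⟩
  · rw [spec_build, ← hs, ← hL]; rfl
  · rw [incs_build _ b1, incs_build _ b1]; cases v
    · exact b5.ne
    · exact b5.ne'

lemma B1_SS_UUU (z w u c : ℕ) (h0 : z ≤ w) (h1 : w ≤ u) :
    Strong {1, 1} {2*z+1, 2*w+1, 2*u+1} (2*c+1) :=
  tab (p := 2) (q := 3) [Oin true w, Oin true u, KHH false c, Oin false 0, Oin false 0, Oin true z]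
    [(some true, 2*w+1), (some true, 2*u+1), (none, 2*c+1), (some false, 1), (some false, 1), (some true, 2*z+1)] (by simp <;> omega)
    (by simp [SP, ← Multiset.cons_coe, ← Multiset.singleton_add]; try abel) rfl rfl (by simp) (by simp; omega)

lemma B1_SO_UUU (y z w u c : ℕ) (h0 : 1 ≤ y) (h1 : z ≤ w) (h2 : w ≤ u) :
    Strong {1, 2*y+1} {2*z+1, 2*w+1, 2*u+1} (2*c+1) :=
  tab (p := 2) (q := 3) [Oin false 0, OT false y, Oin true w, Oin true u, KHH false c, Oin true z]
    [(some false, 1), (some false, 2*y+1), (some true, 2*w+1), (some true, 2*u+1), (none, 2*c+1), (some true, 2*z+1)] (by simp <;> omega)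
    (by simp [SP, ← Multiset.cons_coe, ← Multiset.singleton_add]; try abel) rfl rfl (by simp) (by simp; omega)

lemma B1_OO_UUU (x y z w u c : ℕ) (h0 : 1 ≤ x) (h1 : 1 ≤ y) (h2 : x ≤ y) (h3 : z ≤ w) (h4 : w ≤ u) :
    Strong {2*x+1, 2*y+1} {2*z+1, 2*w+1, 2*u+1} (2*c+1) :=
  tab (p := 2) (q := 3) [OT false x, Oin false y, Oin true w, Oin true u, KHH false c, Oin true z]
    [(some false, 2*x+1), (some false, 2*y+1), (some true, 2*w+1), (some true, 2*u+1), (none, 2*c+1), (some true, 2*z+1)] (by simp <;> omega)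
    (by simp [SP, ← Multiset.cons_coe, ← Multiset.singleton_add]; try abel) rfl rfl (by simp) (by simp; omega)

lemma B1_UU_UUE (x y z w u c : ℕ) (h0 : x ≤ y) (h1 : z ≤ w) (h2 : 1 ≤ u) :
    Strong {2*x+1, 2*y+1} {2*z+1, 2*w+1, 2*u} (2*c+1) :=
  tab (p := 2) (q := 3) [Oin true w, Oin false y, Ein true u, KHH true c, Oin true z, Oin false x]
    [(some true, 2*w+1), (some false, 2*y+1), (some true, 2*u), (none, 2*c+1), (some true, 2*z+1), (some false, 2*x+1)] (by simp <;> omega)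
    (by simp [SP, ← Multiset.cons_coe, ← Multiset.singleton_add]; try abel) rfl rfl (by simp) (by simp; omega)

lemma B1_UU_UEE (x y z w u c : ℕ) (h0 : x ≤ y) (h1 : 1 ≤ w) (h2 : 1 ≤ u) (h3 : w ≤ u) :
    Strong {2*x+1, 2*y+1} {2*z+1, 2*w, 2*u} (2*c+1) :=
  tab (p := 2) (q := 3) [Oin false y, Oin true z, Ein true w, Ein true u, KHH true c, Oin false x]
    [(some false, 2*y+1), (some true, 2*z+1), (some true, 2*w), (some true, 2*u), (none, 2*c+1), (some false, 2*x+1)] (by simp <;> omega)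
    (by simp [SP, ← Multiset.cons_coe, ← Multiset.singleton_add]; try abel) rfl rfl (by simp) (by simp; omega)

lemma B1_UU_EEE (x y z w u c : ℕ) (h0 : x ≤ y) (h1 : 1 ≤ z) (h2 : 1 ≤ w) (h3 : z ≤ w) (h4 : 1 ≤ u) (h5 : w ≤ u) :
    Strong {2*x+1, 2*y+1} {2*z, 2*w, 2*u} (2*c+1) :=
  tab (p := 2) (q := 3) [Oin false y, Ein true z, Ein true w, Ein true u, KHH true c, Oin false x]
    [(some false, 2*y+1), (some true, 2*z), (some true, 2*w), (some true, 2*u), (none, 2*c+1), (some false, 2*x+1)] (by simp <;> omega)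
    (by simp [SP, ← Multiset.cons_coe, ← Multiset.singleton_add]; try abel) rfl rfl (by simp) (by simp; omega)

lemma B1_UE_UUU (x y z w u c : ℕ) (h0 : 1 ≤ y) (h1 : z ≤ w) (h2 : w ≤ u) :
    Strong {2*x+1, 2*y} {2*z+1, 2*w+1, 2*u+1} (2*c+1) :=
  tab (p := 2) (q := 3) [Oin true u, Oout false x, Ein false y, KHH true c, Oin true z, Oin true w]
    [(some true, 2*u+1), (some false, 2*x+1), (some false, 2*y), (none, 2*c+1), (some true, 2*z+1), (some true, 2*w+1)] (by simp <;> omega)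
    (by simp [SP, ← Multiset.cons_coe, ← Multiset.singleton_add]; try abel) rfl rfl (by simp) (by simp; omega)

lemma B1_UE_UUE (x y z w u c : ℕ) (h0 : 1 ≤ y) (h1 : z ≤ w) (h2 : 1 ≤ u) :
    Strong {2*x+1, 2*y} {2*z+1, 2*w+1, 2*u} (2*c+1) :=
  tab (p := 2) (q := 3) [Oin false x, Oin true w, Ein false y, Ein true u, KHH true c, Oin true z]
    [(some false, 2*x+1), (some true, 2*w+1), (some false, 2*y), (some true, 2*u), (none, 2*c+1), (some true, 2*z+1)] (by simp <;> omega)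
    (by simp [SP, ← Multiset.cons_coe, ← Multiset.singleton_add]; try abel) rfl rfl (by simp) (by simp; omega)

lemma B1_UE_UEE (x y z w u c : ℕ) (h0 : 1 ≤ y) (h1 : 1 ≤ w) (h2 : 1 ≤ u) (h3 : w ≤ u) :
    Strong {2*x+1, 2*y} {2*z+1, 2*w, 2*u} (2*c+1) :=
  tab (p := 2) (q := 3) [Oin false x, Ein false y, Oin true z, Ein true w, Ein true u, KHH true c]
    [(some false, 2*x+1), (some false, 2*y), (some true, 2*z+1), (some true, 2*w), (some true, 2*u), (none, 2*c+1)] (by simp <;> omega)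
    (by simp [SP, ← Multiset.cons_coe, ← Multiset.singleton_add]; try abel) rfl rfl (by simp) (by simp; omega)

lemma B1_UE_EEE (x y z w u c : ℕ) (h0 : 1 ≤ y) (h1 : 1 ≤ z) (h2 : 1 ≤ w) (h3 : z ≤ w) (h4 : 1 ≤ u) (h5 : w ≤ u) :
    Strong {2*x+1, 2*y} {2*z, 2*w, 2*u} (2*c+1) :=
  tab (p := 2) (q := 3) [Oin false x, Ein false y, Ein true z, Ein true w, Ein true u, KHH true c]
    [(some false, 2*x+1), (some false, 2*y), (some true, 2*z), (some true, 2*w), (some true, 2*u), (none, 2*c+1)] (by simp <;> omega)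
    (by simp [SP, ← Multiset.cons_coe, ← Multiset.singleton_add]; try abel) rfl rfl (by simp) (by simp; omega)

lemma B1_EE_UUE (x y z w u c : ℕ) (h0 : 1 ≤ x) (h1 : 1 ≤ y) (h2 : x ≤ y) (h3 : z ≤ w) (h4 : 1 ≤ u) :
    Strong {2*x, 2*y} {2*z+1, 2*w+1, 2*u} (2*c+1) :=
  tab (p := 2) (q := 3) [Ein false x, Ein false y, Oin true z, Oin true w, Ein true u, KHH false c]
    [(some false, 2*x), (some false, 2*y), (some true, 2*z+1), (some true, 2*w+1), (some true, 2*u), (none, 2*c+1)] (by simp <;> omega)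
    (by simp [SP, ← Multiset.cons_coe, ← Multiset.singleton_add]; try abel) rfl rfl (by simp) (by simp; omega)

lemma B1_EE_UEE (x y z w u c : ℕ) (h0 : 1 ≤ x) (h1 : 1 ≤ y) (h2 : x ≤ y) (h3 : 1 ≤ w) (h4 : 1 ≤ u) (h5 : w ≤ u) :
    Strong {2*x, 2*y} {2*z+1, 2*w, 2*u} (2*c+1) :=
  tab (p := 2) (q := 3) [Ein false x, Ein false y, Oin true z, Ein true w, Ein true u, KHH false c]
    [(some false, 2*x), (some false, 2*y), (some true, 2*z+1), (some true, 2*w), (some true, 2*u), (none, 2*c+1)] (by simp <;> omega)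
    (by simp [SP, ← Multiset.cons_coe, ← Multiset.singleton_add]; try abel) rfl rfl (by simp) (by simp; omega)

lemma B1_EE_EEE (x y z w u c : ℕ) (h0 : 1 ≤ x) (h1 : 1 ≤ y) (h2 : x ≤ y) (h3 : 1 ≤ z) (h4 : 1 ≤ w) (h5 : z ≤ w) (h6 : 1 ≤ u) (h7 : w ≤ u) :
    Strong {2*x, 2*y} {2*z, 2*w, 2*u} (2*c+1) :=
  tab (p := 2) (q := 3) [Ein false x, Ein false y, Ein true z, Ein true w, Ein true u, KHH false c]
    [(some false, 2*x), (some false, 2*y), (some true, 2*z), (some true, 2*w), (some true, 2*u), (none, 2*c+1)] (by simp <;> omega)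
    (by simp [SP, ← Multiset.cons_coe, ← Multiset.singleton_add]; try abel) rfl rfl (by simp) (by simp; omega)

lemma B1_EE_OUU (x y z w u c : ℕ) (h0 : 1 ≤ x) (h1 : 1 ≤ y) (h2 : x ≤ y) (h3 : 1 ≤ z) (h4 : w ≤ u) :
    Strong {2*x, 2*y} {2*z+1, 2*w+1, 2*u+1} (2*c+1) :=
  tab (p := 2) (q := 3) [Ein false x, Ein false y, OT true z, Oin true w, Oin true u, KHH false c]
    [(some false, 2*x), (some false, 2*y), (some true, 2*z+1), (some true, 2*w+1), (some true, 2*u+1), (none, 2*c+1)] (by simp <;> omega)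
    (by simp [SP, ← Multiset.cons_coe, ← Multiset.singleton_add]; try abel) rfl rfl (by simp) (by simp; omega)

lemma B1_EF_SSS (x y c : ℕ) (h0 : 1 ≤ x) (h1 : 2 ≤ y) (h2 : x ≤ y) :
    Strong {2*x, 2*y} {1, 1, 1} (2*c+1) :=
  tab (p := 2) (q := 3) [Ein false x, TP false (y-1), KHH false c, sp (some true), sp (some true), sp (some true)]
    [(some false, 2*x), (some false, 2*y), (none, 2*c+1), (some true, 1), (some true, 1), (some true, 1)] (by simp <;> omega)
    (by simp [SP, ← Multiset.cons_coe, ← Multiset.singleton_add]; try abel) rfl rfl (by simp) (by simp; omega)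

lemma B0_SS_SSS (c : ℕ)  :
    Strong {1, 1} {1, 1, 1} (2*c+2) :=
  tab (p := 2) (q := 3) [Oin false 0, KLH true (c+1), sp (some false), sp (some true), sp (some true), sp (some true)]
    [(some false, 1), (none, 2*c+2), (some false, 1), (some true, 1), (some true, 1), (some true, 1)] (by simp <;> omega)
    (by simp [SP, ← Multiset.cons_coe, ← Multiset.singleton_add]; try abel) rfl rfl (by simp) (by simp; omega)

lemma B0_SS_SSO (u c : ℕ) (h0 : 1 ≤ u) :
    Strong {1, 1} {1, 1, 2*u+1} (2*c+2) :=
  tab (p := 2) (q := 3) [Oin true 0, OT true u, Oin false 0, Oin true 0, KT false c, Oin false 0]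
    [(some true, 1), (some true, 2*u+1), (some false, 1), (some true, 1), (none, 2*c+2), (some false, 1)] (by simp <;> omega)
    (by simp [SP, ← Multiset.cons_coe, ← Multiset.singleton_add]; try abel) rfl rfl (by simp) (by simp; omega)

lemma B0_SS_SOO (w u c : ℕ) (h0 : 1 ≤ w) (h1 : 1 ≤ u) (h2 : w ≤ u) :
    Strong {1, 1} {1, 2*w+1, 2*u+1} (2*c+2) :=
  tab (p := 2) (q := 3) [Oin true 0, OT true w, Oin false 0, KT false c, Oin true u, Oin false 0]
    [(some true, 1), (some true, 2*w+1), (some false, 1), (none, 2*c+2), (some true, 2*u+1), (some false, 1)] (by simp <;> omega)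
    (by simp [SP, ← Multiset.cons_coe, ← Multiset.singleton_add]; try abel) rfl rfl (by simp) (by simp; omega)

lemma B0_SS_OOO (z w u c : ℕ) (h0 : 1 ≤ z) (h1 : 1 ≤ w) (h2 : z ≤ w) (h3 : 1 ≤ u) (h4 : w ≤ u) :
    Strong {1, 1} {2*z+1, 2*w+1, 2*u+1} (2*c+2) :=
  tab (p := 2) (q := 3) [OT true z, Oin true w, Oin false 0, KT false c, Oin true u, Oin false 0]
    [(some true, 2*z+1), (some true, 2*w+1), (some false, 1), (none, 2*c+2), (some true, 2*u+1), (some false, 1)] (by simp <;> omega)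
    (by simp [SP, ← Multiset.cons_coe, ← Multiset.singleton_add]; try abel) rfl rfl (by simp) (by simp; omega)

lemma B0_SO_UUU (y z w u c : ℕ) (h0 : 1 ≤ y) (h1 : z ≤ w) (h2 : w ≤ u) :
    Strong {1, 2*y+1} {2*z+1, 2*w+1, 2*u+1} (2*c+2) :=
  tab (p := 2) (q := 3) [OT false y, Oin false 0, Oin true z, KT true c, Oin true w, Oin true u]
    [(some false, 2*y+1), (some false, 1), (some true, 2*z+1), (none, 2*c+2), (some true, 2*w+1), (some true, 2*u+1)] (by simp <;> omega)
    (by simp [SP, ← Multiset.cons_coe, ← Multiset.singleton_add]; try abel) rfl rfl (by simp) (by simp; omega)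

lemma B0_OO_SSS (x y c : ℕ) (h0 : 1 ≤ x) (h1 : 1 ≤ y) (h2 : x ≤ y) :
    Strong {2*x+1, 2*y+1} {1, 1, 1} (2*c+2) :=
  tab (p := 2) (q := 3) [OT false x, Oout false y, Oin true 0, KT false c, Oin true 0, Oin true 0]
    [(some false, 2*x+1), (some false, 2*y+1), (some true, 1), (none, 2*c+2), (some true, 1), (some true, 1)] (by simp <;> omega)
    (by simp [SP, ← Multiset.cons_coe, ← Multiset.singleton_add]; try abel) rfl rfl (by simp) (by simp; omega)

lemma B0_OO_SSO (x y u c : ℕ) (h0 : 1 ≤ x) (h1 : 1 ≤ y) (h2 : x ≤ y) (h3 : 1 ≤ u) :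
    Strong {2*x+1, 2*y+1} {1, 1, 2*u+1} (2*c+2) :=
  tab (p := 2) (q := 3) [OT false x, Oin false y, Oin true 0, Oin true 0, OT true u, KT false c]
    [(some false, 2*x+1), (some false, 2*y+1), (some true, 1), (some true, 1), (some true, 2*u+1), (none, 2*c+2)] (by simp <;> omega)
    (by simp [SP, ← Multiset.cons_coe, ← Multiset.singleton_add]; try abel) rfl rfl (by simp) (by simp; omega)

lemma B0_OO_SOO (x y w u c : ℕ) (h0 : 1 ≤ x) (h1 : 1 ≤ y) (h2 : x ≤ y) (h3 : 1 ≤ w) (h4 : 1 ≤ u) (h5 : w ≤ u) :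
    Strong {2*x+1, 2*y+1} {1, 2*w+1, 2*u+1} (2*c+2) :=
  tab (p := 2) (q := 3) [OT false x, OT false y, Oin true 0, OT true w, Oin true u, KLH false (c+1)]
    [(some false, 2*x+1), (some false, 2*y+1), (some true, 1), (some true, 2*w+1), (some true, 2*u+1), (none, 2*c+2)] (by simp <;> omega)
    (by simp [SP, ← Multiset.cons_coe, ← Multiset.singleton_add]; try abel) rfl rfl (by simp) (by simp; omega)

lemma B0_OO_OOO (x y z w u c : ℕ) (h0 : 1 ≤ x) (h1 : 1 ≤ y) (h2 : x ≤ y) (h3 : 1 ≤ z) (h4 : 1 ≤ w) (h5 : z ≤ w) (h6 : 1 ≤ u) (h7 : w ≤ u) :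
    Strong {2*x+1, 2*y+1} {2*z+1, 2*w+1, 2*u+1} (2*c+2) :=
  tab (p := 2) (q := 3) [OT false x, OT false y, OT true z, Oin true w, Oin true u, KLH false (c+1)]
    [(some false, 2*x+1), (some false, 2*y+1), (some true, 2*z+1), (some true, 2*w+1), (some true, 2*u+1), (none, 2*c+2)] (by simp <;> omega)
    (by simp [SP, ← Multiset.cons_coe, ← Multiset.singleton_add]; try abel) rfl rfl (by simp) (by simp; omega)

lemma B0_UU_UUE (x y z w u c : ℕ) (h0 : x ≤ y) (h1 : z ≤ w) (h2 : 1 ≤ u) :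
    Strong {2*x+1, 2*y+1} {2*z+1, 2*w+1, 2*u} (2*c+2) :=
  tab (p := 2) (q := 3) [Oin true z, Oin false y, KT false c, Oin true w, Ein true u, Oin false x]
    [(some true, 2*z+1), (some false, 2*y+1), (none, 2*c+2), (some true, 2*w+1), (some true, 2*u), (some false, 2*x+1)] (by simp <;> omega)
    (by simp [SP, ← Multiset.cons_coe, ← Multiset.singleton_add]; try abel) rfl rfl (by simp) (by simp; omega)

lemma B0_UU_UEE (x y z w u c : ℕ) (h0 : x ≤ y) (h1 : 1 ≤ w) (h2 : 1 ≤ u) (h3 : w ≤ u) :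
    Strong {2*x+1, 2*y+1} {2*z+1, 2*w, 2*u} (2*c+2) :=
  tab (p := 2) (q := 3) [Oin true z, Oin false x, KT false c, Ein true w, Ein true u, Oin false y]
    [(some true, 2*z+1), (some false, 2*x+1), (none, 2*c+2), (some true, 2*w), (some true, 2*u), (some false, 2*y+1)] (by simp <;> omega)
    (by simp [SP, ← Multiset.cons_coe, ← Multiset.singleton_add]; try abel) rfl rfl (by simp) (by simp; omega)

lemma B0_UU_EEE (x y z w u c : ℕ) (h0 : x ≤ y) (h1 : 1 ≤ z) (h2 : 1 ≤ w) (h3 : z ≤ w) (h4 : 1 ≤ u) (h5 : w ≤ u) :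
    Strong {2*x+1, 2*y+1} {2*z, 2*w, 2*u} (2*c+2) :=
  tab (p := 2) (q := 3) [Oin false y, Ein true z, Ein true w, Ein true u, KLH true (c+1), Oin false x]
    [(some false, 2*y+1), (some true, 2*z), (some true, 2*w), (some true, 2*u), (none, 2*c+2), (some false, 2*x+1)] (by simp <;> omega)
    (by simp [SP, ← Multiset.cons_coe, ← Multiset.singleton_add]; try abel) rfl rfl (by simp) (by simp; omega)

lemma B0_UE_UUU (x y z w u c : ℕ) (h0 : 1 ≤ y) (h1 : z ≤ w) (h2 : w ≤ u) :
    Strong {2*x+1, 2*y} {2*z+1, 2*w+1, 2*u+1} (2*c+2) :=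
  tab (p := 2) (q := 3) [Oin false x, Oin true w, KT false c, Eout false y, Oin true u, Oin true z]
    [(some false, 2*x+1), (some true, 2*w+1), (none, 2*c+2), (some false, 2*y), (some true, 2*u+1), (some true, 2*z+1)] (by simp <;> omega)
    (by simp [SP, ← Multiset.cons_coe, ← Multiset.singleton_add]; try abel) rfl rfl (by simp) (by simp; omega)

lemma B0_UE_UUE (x y z w u c : ℕ) (h0 : 1 ≤ y) (h1 : z ≤ w) (h2 : 1 ≤ u) :
    Strong {2*x+1, 2*y} {2*z+1, 2*w+1, 2*u} (2*c+2) :=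
  tab (p := 2) (q := 3) [Oin false x, Oin true z, Oin true w, KT false c, Eout false y, Ein true u]
    [(some false, 2*x+1), (some true, 2*z+1), (some true, 2*w+1), (none, 2*c+2), (some false, 2*y), (some true, 2*u)] (by simp <;> omega)
    (by simp [SP, ← Multiset.cons_coe, ← Multiset.singleton_add]; try abel) rfl rfl (by simp) (by simp; omega)

lemma B0_UE_UEE (x y z w u c : ℕ) (h0 : 1 ≤ y) (h1 : 1 ≤ w) (h2 : 1 ≤ u) (h3 : w ≤ u) :
    Strong {2*x+1, 2*y} {2*z+1, 2*w, 2*u} (2*c+2) :=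
  tab (p := 2) (q := 3) [Oin false x, Oin true z, Ein true w, Ein true u, KT false c, Eout false y]
    [(some false, 2*x+1), (some true, 2*z+1), (some true, 2*w), (some true, 2*u), (none, 2*c+2), (some false, 2*y)] (by simp <;> omega)
    (by simp [SP, ← Multiset.cons_coe, ← Multiset.singleton_add]; try abel) rfl rfl (by simp) (by simp; omega)

lemma B0_UE_EEE (x y z w u c : ℕ) (h0 : 1 ≤ y) (h1 : 1 ≤ z) (h2 : 1 ≤ w) (h3 : z ≤ w) (h4 : 1 ≤ u) (h5 : w ≤ u) :
    Strong {2*x+1, 2*y} {2*z, 2*w, 2*u} (2*c+2) :=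
  tab (p := 2) (q := 3) [Oin false x, Ein false y, Ein true z, Ein true w, Ein true u, KLH true (c+1)]
    [(some false, 2*x+1), (some false, 2*y), (some true, 2*z), (some true, 2*w), (some true, 2*u), (none, 2*c+2)] (by simp <;> omega)
    (by simp [SP, ← Multiset.cons_coe, ← Multiset.singleton_add]; try abel) rfl rfl (by simp) (by simp; omega)

lemma B0_EE_UUU (x y z w u c : ℕ) (h0 : 1 ≤ x) (h1 : 1 ≤ y) (h2 : x ≤ y) (h3 : z ≤ w) (h4 : w ≤ u) :
    Strong {2*x, 2*y} {2*z+1, 2*w+1, 2*u+1} (2*c+2) :=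
  tab (p := 2) (q := 3) [Ein false y, Oin true w, KLH false (c+1), Oin true u, Eout false x, Oin true z]
    [(some false, 2*y), (some true, 2*w+1), (none, 2*c+2), (some true, 2*u+1), (some false, 2*x), (some true, 2*z+1)] (by simp <;> omega)
    (by simp [SP, ← Multiset.cons_coe, ← Multiset.singleton_add]; try abel) rfl rfl (by simp) (by simp; omega)

lemma B0_EE_UUE (x y z w u c : ℕ) (h0 : 1 ≤ x) (h1 : 1 ≤ y) (h2 : x ≤ y) (h3 : z ≤ w) (h4 : 1 ≤ u) :
    Strong {2*x, 2*y} {2*z+1, 2*w+1, 2*u} (2*c+2) :=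
  tab (p := 2) (q := 3) [Ein false x, Ein false y, Oin true z, Oin true w, KT true c, Ein true u]
    [(some false, 2*x), (some false, 2*y), (some true, 2*z+1), (some true, 2*w+1), (none, 2*c+2), (some true, 2*u)] (by simp <;> omega)
    (by simp [SP, ← Multiset.cons_coe, ← Multiset.singleton_add]; try abel) rfl rfl (by simp) (by simp; omega)

lemma B0_EE_UEE (x y z w u c : ℕ) (h0 : 1 ≤ x) (h1 : 1 ≤ y) (h2 : x ≤ y) (h3 : 1 ≤ w) (h4 : 1 ≤ u) (h5 : w ≤ u) :
    Strong {2*x, 2*y} {2*z+1, 2*w, 2*u} (2*c+2) :=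
  tab (p := 2) (q := 3) [Ein false x, Ein false y, Oin true z, Ein true w, Ein true u, KHL false (c+1)]
    [(some false, 2*x), (some false, 2*y), (some true, 2*z+1), (some true, 2*w), (some true, 2*u), (none, 2*c+2)] (by simp <;> omega)
    (by simp [SP, ← Multiset.cons_coe, ← Multiset.singleton_add]; try abel) rfl rfl (by simp) (by simp; omega)

lemma B0_EE_EEE (x y z w u c : ℕ) (h0 : 1 ≤ x) (h1 : 1 ≤ y) (h2 : x ≤ y) (h3 : 1 ≤ z) (h4 : 1 ≤ w) (h5 : z ≤ w) (h6 : 1 ≤ u) (h7 : w ≤ u) :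
    Strong {2*x, 2*y} {2*z, 2*w, 2*u} (2*c+2) :=
  tab (p := 2) (q := 3) [Ein false x, Ein false y, Ein true z, Ein true w, Ein true u, KHL false (c+1)]
    [(some false, 2*x), (some false, 2*y), (some true, 2*z), (some true, 2*w), (some true, 2*u), (none, 2*c+2)] (by simp <;> omega)
    (by simp [SP, ← Multiset.cons_coe, ← Multiset.singleton_add]; try abel) rfl rfl (by simp) (by simp; omega)

lemma C1_EE_EE (x y z w c : ℕ) (h0 : 1 ≤ x) (h1 : 1 ≤ y) (h2 : x ≤ y) (h3 : 1 ≤ z) (h4 : 1 ≤ w) (h5 : z ≤ w) :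
    Strong {2*x, 2*y} {2*z, 2*w} (2*c+1) :=
  tab (p := 2) (q := 2) [Ein false x, Ein false y, Ein true z, Ein true w, KHH false c]
    [(some false, 2*x), (some false, 2*y), (some true, 2*z), (some true, 2*w), (none, 2*c+1)] (by simp <;> omega)
    (by simp [SP, ← Multiset.cons_coe, ← Multiset.singleton_add]; try abel) rfl rfl (by simp) (by simp; omega)

lemma C0_EE_EE (x y z w c : ℕ) (h0 : 1 ≤ x) (h1 : 1 ≤ y) (h2 : x ≤ y) (h3 : 1 ≤ z) (h4 : 1 ≤ w) (h5 : z ≤ w) :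
    Strong {2*x, 2*y} {2*z, 2*w} (2*c+2) :=
  tab (p := 2) (q := 2) [Ein true z, Ein true w, Eout false x, Ein false y, KHL true (c+1)]
    [(some true, 2*z), (some true, 2*w), (some false, 2*x), (some false, 2*y), (none, 2*c+2)] (by simp <;> omega)
    (by simp [SP, ← Multiset.cons_coe, ← Multiset.singleton_add]; try abel) rfl rfl (by simp) (by simp; omega)

lemma A1_UU_SS (x y c : ℕ) (h0 : x ≤ y) :
    NE {2*x+1, 2*y+1} {1, 1} (2*c+1) :=
  tab0 [Oin false y, KHH true c, Oin false x, sp (some true), sp (some true)]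
    (v := false)
    [(some false, 2*y+1), (none, 2*c+1), (some false, 2*x+1), (some true, 1), (some true, 1)] (by simp <;> omega)
    (by simp [SP, ← Multiset.cons_coe, ← Multiset.singleton_add]; try abel) ((c0 [Oin false y, KHH true c, Oin false x, sp (some true), sp (some true)]).h - 1) (by simp; omega)

lemma A1_UU_SO (x y w c : ℕ) (h0 : x ≤ y) (h1 : 1 ≤ w) :
    NE {2*x+1, 2*y+1} {1, 2*w+1} (2*c+1) :=
  tab0 [Oin true 0, OT true w, Oin false y, KHH true c, Oin false x]
    (v := false)
    [(some true, 1), (some true, 2*w+1), (some false, 2*y+1), (none, 2*c+1), (some false, 2*x+1)] (by simp <;> omega)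
    (by simp [SP, ← Multiset.cons_coe, ← Multiset.singleton_add]; try abel) ((c0 [Oin true 0, OT true w, Oin false y, KHH true c, Oin false x]).h - 1) (by simp; omega)

lemma A1_UU_OO (x y z w c : ℕ) (h0 : x ≤ y) (h1 : 1 ≤ z) (h2 : 1 ≤ w) (h3 : z ≤ w) :
    NE {2*x+1, 2*y+1} {2*z+1, 2*w+1} (2*c+1) :=
  tab0 [OT true z, Oin true w, Oin false y, KHH true c, Oin false x]
    (v := false)
    [(some true, 2*z+1), (some true, 2*w+1), (some false, 2*y+1), (none, 2*c+1), (some false, 2*x+1)] (by simp <;> omega)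
    (by simp [SP, ← Multiset.cons_coe, ← Multiset.singleton_add]; try abel) ((c0 [OT true z, Oin true w, Oin false y, KHH true c, Oin false x]).h - 1) (by simp; omega)

lemma A1_UU_SE (x y w c : ℕ) (h0 : x ≤ y) (h1 : 1 ≤ w) :
    NE {2*x+1, 2*y+1} {1, 2*w} (2*c+1) :=
  tab0 [Oin false y, Ein true w, KHH true c, Oin false x, sp (some true)]
    (v := false)
    [(some false, 2*y+1), (some true, 2*w), (none, 2*c+1), (some false, 2*x+1), (some true, 1)] (by simp <;> omega)
    (by simp [SP, ← Multiset.cons_coe, ← Multiset.singleton_add]; try abel) ((c0 [Oin false y, Ein true w, KHH true c, Oin false x, sp (some true)]).h - 1) (by simp; omega)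

lemma A1_UU_OE (x y z w c : ℕ) (h0 : x ≤ y) (h1 : 1 ≤ z) (h2 : 1 ≤ w) :
    NE {2*x+1, 2*y+1} {2*z+1, 2*w} (2*c+1) :=
  tab0 [OT true z, Ein true w, Oin false y, KHH true c, Oin false x]
    (v := false)
    [(some true, 2*z+1), (some true, 2*w), (some false, 2*y+1), (none, 2*c+1), (some false, 2*x+1)] (by simp <;> omega)
    (by simp [SP, ← Multiset.cons_coe, ← Multiset.singleton_add]; try abel) ((c0 [OT true z, Ein true w, Oin false y, KHH true c, Oin false x]).h - 1) (by simp; omega)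

lemma A1_UU_EE (x y z w c : ℕ) (h0 : x ≤ y) (h1 : 1 ≤ z) (h2 : 1 ≤ w) (h3 : z ≤ w) :
    NE {2*x+1, 2*y+1} {2*z, 2*w} (2*c+1) :=
  tab0 [Oin false y, Ein true z, Ein true w, KHH true c, Oin false x]
    (v := false)
    [(some false, 2*y+1), (some true, 2*z), (some true, 2*w), (none, 2*c+1), (some false, 2*x+1)] (by simp <;> omega)
    (by simp [SP, ← Multiset.cons_coe, ← Multiset.singleton_add]; try abel) ((c0 [Oin false y, Ein true z, Ein true w, KHH true c, Oin false x]).h - 1) (by simp; omega)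

lemma A1_UE_SE (x y w c : ℕ) (h0 : 1 ≤ y) (h1 : 1 ≤ w) :
    NE {2*x+1, 2*y} {1, 2*w} (2*c+1) :=
  tab0 [Oin false x, Ein false y, Ein true w, KHH true c, Oin true 0]
    (v := false)
    [(some false, 2*x+1), (some false, 2*y), (some true, 2*w), (none, 2*c+1), (some true, 1)] (by simp <;> omega)
    (by simp [SP, ← Multiset.cons_coe, ← Multiset.singleton_add]; try abel) ((c0 [Oin false x, Ein false y, Ein true w, KHH true c, Oin true 0]).h - 1) (by simp; omega)

lemma A1_UE_OE (x y z w c : ℕ) (h0 : 1 ≤ y) (h1 : 1 ≤ z) (h2 : 1 ≤ w) :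
    NE {2*x+1, 2*y} {2*z+1, 2*w} (2*c+1) :=
  tab0 [Oin false x, OT true z, Ein false y, Ein true w, KHH true c]
    (v := false)
    [(some false, 2*x+1), (some true, 2*z+1), (some false, 2*y), (some true, 2*w), (none, 2*c+1)] (by simp <;> omega)
    (by simp [SP, ← Multiset.cons_coe, ← Multiset.singleton_add]; try abel) ((c0 [Oin false x, OT true z, Ein false y, Ein true w, KHH true c]).h - 1) (by simp; omega)

lemma A1_UE_EE (x y z w c : ℕ) (h0 : 1 ≤ y) (h1 : 1 ≤ z) (h2 : 1 ≤ w) (h3 : z ≤ w) :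
    NE {2*x+1, 2*y} {2*z, 2*w} (2*c+1) :=
  tab0 [Oin false x, Ein false y, Ein true z, Ein true w, KHH true c]
    (v := false)
    [(some false, 2*x+1), (some false, 2*y), (some true, 2*z), (some true, 2*w), (none, 2*c+1)] (by simp <;> omega)
    (by simp [SP, ← Multiset.cons_coe, ← Multiset.singleton_add]; try abel) ((c0 [Oin false x, Ein false y, Ein true z, Ein true w, KHH true c]).h - 1) (by simp; omega)

lemma A1_EE_EE (x y z w c : ℕ) (h0 : 1 ≤ x) (h1 : 1 ≤ y) (h2 : x ≤ y) (h3 : 1 ≤ z) (h4 : 1 ≤ w) (h5 : z ≤ w) :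
    NE {2*x, 2*y} {2*z, 2*w} (2*c+1) :=
  tab0 [Ein false x, Ein false y, Ein true z, Ein true w, KHH false c]
    (v := false)
    [(some false, 2*x), (some false, 2*y), (some true, 2*z), (some true, 2*w), (none, 2*c+1)] (by simp <;> omega)
    (by simp [SP, ← Multiset.cons_coe, ← Multiset.singleton_add]; try abel) ((c0 [Ein false x, Ein false y, Ein true z, Ein true w, KHH false c]).h - 1) (by simp; omega)

lemma A0_SS_SS (c : ℕ)  :
    NE {1, 1} {1, 1} (2*c+2) :=
  tab0 [KHL false (c+1), sp (some false), sp (some false), sp (some true), sp (some true)]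
    (v := true)
    [(none, 2*c+2), (some false, 1), (some false, 1), (some true, 1), (some true, 1)] (by simp <;> omega)
    (by simp [SP, ← Multiset.cons_coe, ← Multiset.singleton_add]; try abel) ((c0 [KHL false (c+1), sp (some false), sp (some false), sp (some true), sp (some true)]).h - 1) (by simp; omega)

lemma A0_SS_SO (w c : ℕ) (h0 : 1 ≤ w) :
    NE {1, 1} {1, 2*w+1} (2*c+2) :=
  tab0 [blk (some true) false true w plain true, KHL false (c+1), Oin false 0, Oin false 0, Oin true 0]
    (v := true)
    [(some true, 2*w+1), (none, 2*c+2), (some false, 1), (some false, 1), (some true, 1)] (by simp <;> omega)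
    (by simp [SP, ← Multiset.cons_coe, ← Multiset.singleton_add]; try abel) (c0 [blk (some true) false true w plain true, KHL false (c+1), Oin false 0, Oin false 0, Oin true 0]).h (by simp; omega)

lemma A0_SS_OO (z w c : ℕ) (h0 : 1 ≤ z) (h1 : 1 ≤ w) (h2 : z ≤ w) :
    NE {1, 1} {2*z+1, 2*w+1} (2*c+2) :=
  tab0 [OT true z, Oin true w, Oin false 0, KT false c, Oin false 0]
    (v := false)
    [(some true, 2*z+1), (some true, 2*w+1), (some false, 1), (none, 2*c+2), (some false, 1)] (by simp <;> omega)
    (by simp [SP, ← Multiset.cons_coe, ← Multiset.singleton_add]; try abel) ((c0 [OT true z, Oin true w, Oin false 0, KT false c, Oin false 0]).h - 1) (by simp; omega)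

lemma A0_SO_SO (y w c : ℕ) (h0 : 1 ≤ y) (h1 : 1 ≤ w) :
    NE {1, 2*y+1} {1, 2*w+1} (2*c+2) :=
  tab0 [Oin false 0, OT false y, OT true w, Oin true 0, KHL false (c+1)]
    (v := false)
    [(some false, 1), (some false, 2*y+1), (some true, 2*w+1), (some true, 1), (none, 2*c+2)] (by simp <;> omega)
    (by simp [SP, ← Multiset.cons_coe, ← Multiset.singleton_add]; try abel) ((c0 [Oin false 0, OT false y, OT true w, Oin true 0, KHL false (c+1)]).h - 1) (by simp; omega)

lemma A0_SO_OO (y z w c : ℕ) (h0 : 1 ≤ y) (h1 : 1 ≤ z) (h2 : 1 ≤ w) (h3 : z ≤ w) :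
    NE {1, 2*y+1} {2*z+1, 2*w+1} (2*c+2) :=
  tab0 [Oin false 0, OT false y, OT true z, Oin true w, KHL false (c+1)]
    (v := false)
    [(some false, 1), (some false, 2*y+1), (some true, 2*z+1), (some true, 2*w+1), (none, 2*c+2)] (by simp <;> omega)
    (by simp [SP, ← Multiset.cons_coe, ← Multiset.singleton_add]; try abel) ((c0 [Oin false 0, OT false y, OT true z, Oin true w, KHL false (c+1)]).h - 1) (by simp; omega)

lemma A0_OO_OO (x y z w c : ℕ) (h0 : 1 ≤ x) (h1 : 1 ≤ y) (h2 : x ≤ y) (h3 : 1 ≤ z) (h4 : 1 ≤ w) (h5 : z ≤ w) :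
    NE {2*x+1, 2*y+1} {2*z+1, 2*w+1} (2*c+2) :=
  tab0 [OT false x, OT false y, OT true z, Oin true w, KLH false (c+1)]
    (v := true)
    [(some false, 2*x+1), (some false, 2*y+1), (some true, 2*z+1), (some true, 2*w+1), (none, 2*c+2)] (by simp <;> omega)
    (by simp [SP, ← Multiset.cons_coe, ← Multiset.singleton_add]; try abel) ((c0 [OT false x, OT false y, OT true z, Oin true w, KLH false (c+1)]).h - 1) (by simp; omega)

lemma A0_SS_UE (z w c : ℕ) (h0 : 1 ≤ w) :
    NE {1, 1} {2*z+1, 2*w} (2*c+2) :=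
  tab0 [KT false c, Ein true w, Oin false 0, Oin true z, Oin false 0]
    (v := false)
    [(none, 2*c+2), (some true, 2*w), (some false, 1), (some true, 2*z+1), (some false, 1)] (by simp <;> omega)
    (by simp [SP, ← Multiset.cons_coe, ← Multiset.singleton_add]; try abel) ((c0 [KT false c, Ein true w, Oin false 0, Oin true z, Oin false 0]).h - 1) (by simp; omega)

lemma A0_SO_UE (y z w c : ℕ) (h0 : 1 ≤ y) (h1 : 1 ≤ w) :
    NE {1, 2*y+1} {2*z+1, 2*w} (2*c+2) :=
  tab0 [Oin false 0, KT' true c, OT false y, Ein true w, Oin true z]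
    (v := true)
    [(some false, 1), (none, 2*c+2), (some false, 2*y+1), (some true, 2*w), (some true, 2*z+1)] (by simp <;> omega)
    (by simp [SP, ← Multiset.cons_coe, ← Multiset.singleton_add]; try abel) ((c0 [Oin false 0, KT' true c, OT false y, Ein true w, Oin true z]).h - 1) (by simp; omega)

lemma A0_OO_UE (x y z w c : ℕ) (h0 : 1 ≤ x) (h1 : 1 ≤ y) (h2 : x ≤ y) (h3 : 1 ≤ w) :
    NE {2*x+1, 2*y+1} {2*z+1, 2*w} (2*c+2) :=
  tab0 [OT false x, OT false y, Oin true z, Ein true w, KLH false (c+1)]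
    (v := true)
    [(some false, 2*x+1), (some false, 2*y+1), (some true, 2*z+1), (some true, 2*w), (none, 2*c+2)] (by simp <;> omega)
    (by simp [SP, ← Multiset.cons_coe, ← Multiset.singleton_add]; try abel) ((c0 [OT false x, OT false y, Oin true z, Ein true w, KLH false (c+1)]).h - 1) (by simp; omega)

lemma A0_UU_EE (x y z w c : ℕ) (h0 : x ≤ y) (h1 : 1 ≤ z) (h2 : 1 ≤ w) (h3 : z ≤ w) :
    NE {2*x+1, 2*y+1} {2*z, 2*w} (2*c+2) :=
  tab0 [Ein true z, KT false c, Ein true w, Oout false x, Oin false y]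
    (v := false)
    [(some true, 2*z), (none, 2*c+2), (some true, 2*w), (some false, 2*x+1), (some false, 2*y+1)] (by simp <;> omega)
    (by simp [SP, ← Multiset.cons_coe, ← Multiset.singleton_add]; try abel) ((c0 [Ein true z, KT false c, Ein true w, Oout false x, Oin false y]).h - 1) (by simp; omega)

lemma A0_UE_UE (x y z w c : ℕ) (h0 : 1 ≤ y) (h1 : 1 ≤ w) :
    NE {2*x+1, 2*y} {2*z+1, 2*w} (2*c+2) :=
  tab0 [Oin false x, Oout true z, KT false c, Ein false y, Ein true w]
    (v := true)
    [(some false, 2*x+1), (some true, 2*z+1), (none, 2*c+2), (some false, 2*y), (some true, 2*w)] (by simp <;> omega)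
    (by simp [SP, ← Multiset.cons_coe, ← Multiset.singleton_add]; try abel) ((c0 [Oin false x, Oout true z, KT false c, Ein false y, Ein true w]).h - 1) (by simp; omega)

lemma A0_UE_EE (x y z w c : ℕ) (h0 : 1 ≤ y) (h1 : 1 ≤ z) (h2 : 1 ≤ w) (h3 : z ≤ w) :
    NE {2*x+1, 2*y} {2*z, 2*w} (2*c+2) :=
  tab0 [Oin false x, Ein true z, KT false c, Ein false y, Ein true w]
    (v := false)
    [(some false, 2*x+1), (some true, 2*z), (none, 2*c+2), (some false, 2*y), (some true, 2*w)] (by simp <;> omega)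
    (by simp [SP, ← Multiset.cons_coe, ← Multiset.singleton_add]; try abel) ((c0 [Oin false x, Ein true z, KT false c, Ein false y, Ein true w]).h - 1) (by simp; omega)

lemma A0_EE_EE (x y z w c : ℕ) (h0 : 1 ≤ x) (h1 : 1 ≤ y) (h2 : x ≤ y) (h3 : 1 ≤ z) (h4 : 1 ≤ w) (h5 : z ≤ w) :
    NE {2*x, 2*y} {2*z, 2*w} (2*c+2) :=
  tab0 [Ein false x, Ein false y, Eout true z, Ein true w, KHL false (c+1)]
    (v := true)
    [(some false, 2*x), (some false, 2*y), (some true, 2*z), (some true, 2*w), (none, 2*c+2)] (by simp <;> omega)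
    (by simp [SP, ← Multiset.cons_coe, ← Multiset.singleton_add]; try abel) ((c0 [Ein false x, Ein false y, Eout true z, Ein true w, KHL false (c+1)]).h - 1) (by simp; omega)

end DS

namespace DS

/-- a state with explicit numerical data; `j` records whether `J` holds -/
def Q (j : Bool) (la lb : Multiset ℕ) (k m μ na nb sa sb : ℕ) : Prop := ∃ ps, spec ps = SP la lb k ∧
  St m μ la.card lb.card ps ∧ (incs false ps).sum = sa ∧ (incs true ps).sum = sb ∧
  cnt μ (incs false ps) = na ∧ cnt μ (incs true ps) = nb ∧ (j = true → J μ ps)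

lemma Strong.q {la lb k} (h : Strong la lb k) : ∃ m μ na nb sa sb, Q true la lb k m μ na nb sa sb ∧ sa < sb ∧
    la.card + na ≤ lb.card + nb := by
  obtain ⟨m, μ, ps, h1, ⟨h2, h3, h4⟩, h5⟩ := h
  exact ⟨m, μ, _, _, _, _, ⟨ps, h1, h2, rfl, rfl, rfl, rfl, fun _ => h5⟩, h3, h4⟩

lemma Weak.q {la lb k} (h : Weak la lb k) : ∃ m μ na nb sa sb, Q false la lb k m μ na nb sa sb ∧ sa < sb ∧
    la.card + na ≤ lb.card + nb := by
  obtain ⟨m, μ, ps, h1, h2, h3, h4⟩ := h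
  exact ⟨m, μ, _, _, _, _, ⟨ps, h1, h2, rfl, rfl, rfl, rfl, by simp⟩, h3, h4⟩

lemma Q.strong {la lb k m μ na nb sa sb} (h : Q true la lb k m μ na nb sa sb) (h1 : sa < sb)
    (h2 : la.card + na ≤ lb.card + nb) : Strong la lb k := by
  obtain ⟨ps, a1, a2, rfl, rfl, rfl, rfl, a3⟩ := h
  exact ⟨m, μ, ps, a1, ⟨a2, h1, h2⟩, a3 rfl⟩

lemma Q.weak {j la lb k m μ na nb sa sb} (h : Q j la lb k m μ na nb sa sb) (h1 : sa < sb)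
    (h2 : la.card + na ≤ lb.card + nb) : Weak la lb k := by
  obtain ⟨ps, a1, a2, rfl, rfl, rfl, rfl, a3⟩ := h
  exact ⟨m, μ, ps, a1, a2, h1, h2⟩

/-- the new leg -/
def nleg (μ n : ℕ) : List ℕ := if n % 2 = 1 then alt 1 (μ+(n+1)/2+1) n else alt (μ+(n+1)/2+1) 1 n

def ninner (μ n : ℕ) : ℕ := if n % 2 = 1 then 1 else μ+(n+1)/2+1

lemma nleg_length (μ n : ℕ) : (nleg μ n).length = n := by
  unfold nleg; split_ifs <;> exact alt_length _ _ _

lemma nleg_head (μ n : ℕ) (h : 1 ≤ n) : (nleg μ n).head? = some (ninner μ n) := by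
  unfold nleg ninner; split_ifs <;> exact alt_head _ _ _ h

lemma nleg_labs (μ n : ℕ) : ((nleg μ n : List ℕ) : Multiset ℕ) = R 1 ((n+1)/2+1) + R (μ+(n+1)/2+1) (μ+(n+1)/2+n/2+1) := by
  unfold nleg
  split_ifs with h
  · rw [alt_labs]; congr 2 <;> omega
  · rw [alt_labs, add_comm]; congr 2 <;> omega

lemma nleg_last (μ n x : ℕ) (h : 1 ≤ n) (hx : (nleg μ n).getLast? = some x) : x ≤ μ + (n+1)/2 := by
  unfold nleg at hx
  split_ifs at hx with h2
  · obtain ⟨r, rfl⟩ : ∃ r, n = 2*r+1 := ⟨n/2, by omega⟩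
    rw [alt_last_odd] at hx; simp at hx; omega
  · obtain ⟨r, rfl⟩ : ∃ r, n = 2*r := ⟨n/2, by omega⟩
    rw [alt_last_even _ _ _ (by omega)] at hx; simp at hx; omega

lemma nleg_sums (μ n : ℕ) : (((prs (nleg μ n)).map (fun q => q.1+q.2) : List ℕ) : Multiset ℕ) =
    R (μ+(n+1)/2+2) (μ+(n+1)/2+2+(n-1)) := by
  unfold nleg
  split_ifs with h <;> rw [alt_prs_sums] <;> congr 1 <;> omega

lemma alt_prs_mem2 (n x y : ℕ) : ∀ q ∈ prs (alt x y n), (q.1 < x + (n+1)/2 ∧ y ≤ q.2) ∨ (q.2 < x + (n+1)/2 ∧ y ≤ q.1) := by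
  induction n using Nat.strong_induction_on generalizing x y with
  | _ n ih =>
    match n with
    | 0 => simp [alt, prs]
    | 1 => simp [alt, prs]
    | 2 => simp [alt, prs]
    | n+3 =>
      intro q hq
      have := ih (n+1) (by omega) (x+1) (y+1)
      simp only [alt, prs, List.zip_cons_cons, List.tail_cons, List.mem_cons] at this hq
      rcases hq with rfl | rfl | hq
      · left; simp; try omega
      · right; simp; try omega
      · have := this q hq
        omega

lemma alt_prs_mem3 (n x y : ℕ) : ∀ q ∈ prs (alt x y n), (q.1 < y + n/2 ∧ x ≤ q.2) ∨ (q.2 < y + n/2 ∧ x ≤ q.1) := by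
  cases n with
  | zero => simp [alt, prs]
  | succ n =>
    cases n with
    | zero => simp [alt, prs]
    | succ n =>
      intro q hq
      have := alt_prs_mem2 (n+1) y (x+1)
      simp only [alt, prs, List.zip_cons_cons, List.tail_cons, List.mem_cons] at this hq
      rcases hq with rfl | hq
      · right; simp; try omega
      · have := this q hq
        omega

lemma prs_sub (w : List ℕ) : ∀ r ∈ prs w, r.1 ∈ w ∧ r.2 ∈ w := by
  rintro ⟨x, y⟩ h
  have := List.of_mem_zip h
  exact ⟨this.1, List.mem_of_mem_tail this.2⟩

lemma Q.ins {j la lb k m μ na nb sa sb} (h : Q j la lb k m μ na nb sa sb) (n : ℕ) (hn : 1 ≤ n) (hj : j = true ∨ n = 1)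
    (v : Bool) :
    Q j (cond v la (n ::ₘ la)) (cond v (n ::ₘ lb) lb) k (m + (n+1)/2 + n/2) (μ + (n+1)/2)
      (na + cond v 0 ((n+1)%2)) (nb + cond v ((n+1)%2) 0)
      (cond v 0 (ninner μ n) + sa + (n+1)/2 * (la.card+1) + n/2 * na)
      (cond v (ninner μ n) 0 + sb + (n+1)/2 * (lb.card+1) + n/2 * nb) := by
  obtain ⟨ps, a1, S, rfl, rfl, rfl, rfl, a3⟩ := h
  have hh := nleg_head μ n hn
  have i1 : inc v (some v, nleg μ n) = [ninner μ n] := by simp [inc, hh]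
  have i2 : inc (!v) (some v, nleg μ n) = [] := by cases v <;> simp [inc]
  have hpm : ∀ r ∈ pairs [(some v, nleg μ n)], r.1 + r.2 ≤ μ + 2*((n+1)/2) + n/2 ∧
      (μ + (n+1)/2 < r.1 ∨ μ + (n+1)/2 < r.2) ∧ ¬ (μ + (n+1)/2 < r.1 ∧ μ + (n+1)/2 < r.2) := by
    intro r hr
    simp only [pairs, List.flatMap_cons, List.flatMap_nil, List.append_nil] at hr
    have hs : r.1 + r.2 ∈ R (μ+(n+1)/2+2) (μ+(n+1)/2+2+(n-1)) := by
      rw [← nleg_sums]; simp only [Multiset.mem_coe, List.mem_map]; exact ⟨r, hr, rfl⟩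
    rw [mem_R] at hs
    have hm : ∀ x ∈ nleg μ n, (1 ≤ x ∧ x < (n+1)/2+1) ∨ (μ+(n+1)/2+1 ≤ x ∧ x < μ+(n+1)/2+n/2+1) := by
      intro x hx
      have : x ∈ ((nleg μ n : List ℕ) : Multiset ℕ) := hx
      rw [nleg_labs, Multiset.mem_add, mem_R, mem_R] at this
      exact this
    have h1 := prs_sub _ r hr
    have h2 := hm _ h1.1
    have h3 := hm _ h1.2
    have h4 : (μ+(n+1)/2+1 ≤ r.1 ∧ r.2 < (n+1)/2+1) ∨ (μ+(n+1)/2+1 ≤ r.2 ∧ r.1 < (n+1)/2+1) := by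
      unfold nleg at hr
      split_ifs at hr with h2
      · have := alt_prs_mem2 _ _ _ r hr; omega
      · have := alt_prs_mem3 _ _ _ r hr; omega
    omega
  obtain ⟨c1, c2, c3, c4⟩ := S.extend ((n+1)/2) (n/2) (μ + (n+1)/2) (cond v 0 1) (cond v 1 0) [(some v, nleg μ n)]
    (by omega) (by omega) (by omega)
    (by simp only [labs, List.flatMap_cons, List.flatMap_nil, List.append_nil]; exact nleg_labs μ n)
    (by simp only [sms, pairs, List.flatMap_cons, List.flatMap_nil, List.append_nil]; rw [nleg_sums]; exact R_nodup _ _)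
    (by
      intro x hx
      simp only [lfs, List.flatMap_cons, List.flatMap_nil, List.append_nil, lf, Option.mem_toList] at hx
      exact nleg_last μ n x hn hx)
    (by
      intro s hs
      simp only [sms, pairs, List.flatMap_cons, List.flatMap_nil, List.append_nil] at hs
      rw [nleg_sums, mem_R] at hs; omega)
    (by cases v <;> simp_all [incs])
    (by cases v <;> simp_all [incs])
    (by
      rcases hj with hj | hj
      · exact Or.inl ⟨a3 hj, hpm⟩
      · right; subst hj; simp [pairs, nleg, alt, prs])
  have hc : cnt (μ + (n+1)/2) [ninner μ n] = (n+1)%2 := by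
    simp only [cnt, ninner, List.countP_cons, List.countP_nil]
    split_ifs with h1 h2 h2 <;> simp at h2 <;> omega
  refine ⟨[(some v, nleg μ n)] ++ ps.map (mp (sh μ ((n+1)/2) (n/2))), ?_, ?_, ?_, ?_, ?_, ?_, ?_⟩
  rotate_left
  · have e1 : (cond v la (n ::ₘ la)).card = la.card + cond v 0 1 := by cases v <;> simp
    have e2 : (cond v (n ::ₘ lb) lb).card = lb.card + cond v 1 0 := by cases v <;> simp
    rw [e1, e2]; exact c1
  · rw [c3, S.da]; cases v <;> simp_all [incs]
  · rw [c3, S.db]; cases v <;> simp_all [incs]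
  · rw [c4]; cases v <;> simp_all [incs, cnt, add_comm]
  · rw [c4]; cases v <;> simp_all [incs, cnt, add_comm]
  · intro hj'; exact c2 (a3 hj') (fun r hr => (hpm r hr).2.1)
  · have : spec ([(some v, nleg μ n)] ++ ps.map (mp (sh μ ((n+1)/2) (n/2)))) = (some v, n) ::ₘ spec ps := by
      simp [spec, nleg_length, mp, Function.comp_def]
    rw [this, a1]
    cases v <;> simp only [SP, cond_true, cond_false, ← Multiset.singleton_add, Multiset.map_add, Multiset.map_singleton] <;> abel

/-- the special insertion -/
lemma Q.spc {j la lb k m μ na nb sa sb} (h : Q j la lb k m μ na nb sa sb) :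
    Q false (2 ::ₘ la) (1 ::ₘ lb) k (m + 2 + 1) (μ + 3) na nb
      (1 + sa + 2 * (la.card+1) + 1 * na) (2 + sb + 2 * (lb.card+1) + 1 * nb) := by
  obtain ⟨ps, a1, S, rfl, rfl, rfl, rfl, a3⟩ := h
  obtain ⟨c1, c2, c3, c4⟩ := S.extend 2 1 (μ + 3) 1 1 [(some false, [1, μ+3]), (some true, [2])]
    (by omega) (by omega) (by omega)
    (by
      have e1 : R 1 3 = {1, 2} := by decide
      have e2 := R_succ (μ+3)
      show _ = R 1 3 + R (μ+3) (μ+3+1)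
      rw [e1, e2]
      simp [labs, ← Multiset.cons_coe, ← Multiset.singleton_add]; abel)
    (by simp [sms, pairs, prs])
    (by simp [lfs, lf])
    (by simp [sms, pairs, prs])
    (by simp [incs, inc]) (by simp [incs, inc])
    (by right; simp [pairs, prs]; omega)
  refine ⟨[(some false, [1, μ+3]), (some true, [2])] ++ ps.map (mp (sh μ 2 1)), ?_, ?_, ?_, ?_, ?_, ?_, fun h => by simp at h⟩
  rotate_left
  · simpa using c1
  · rw [c3, S.da]; simp [incs, inc]
  · rw [c3, S.db]; simp [incs, inc]
  · rw [c4]; simp [incs, inc, cnt]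
  · rw [c4]; simp [incs, inc, cnt]
  · have : spec ([(some false, [1, μ+3]), (some true, [2])] ++ ps.map (mp (sh μ 2 1))) = (some false, 2) ::ₘ (some true, 1) ::ₘ spec ps := by
      simp [spec, mp, Function.comp_def]
    rw [this, a1]
    simp only [SP, ← Multiset.singleton_add, Multiset.map_add, Multiset.map_singleton]; abel

/-- a final labeling with smaller sum at `a` -/
def Lt (la lb : Multiset ℕ) (k : ℕ) : Prop := ∃ ps, spec ps = SP la lb k ∧ Fnl ps ∧
  (incs false ps).sum < (incs true ps).sum

lemma Q.lt {j la lb k m μ na nb sa sb} (h : Q j la lb k m μ na nb sa sb) (h1 : sa < sb) : Lt la lb k := by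
  obtain ⟨ps, a1, a2, rfl, rfl, rfl, rfl, a3⟩ := h
  exact ⟨ps, a1, a2.fnl, h1⟩

lemma Weak.lt {la lb k} (h : Weak la lb k) : Lt la lb k := by
  obtain ⟨m, μ, na, nb, sa, sb, h, h1, h2⟩ := h.q
  exact h.lt h1

lemma ar1 {δ η p q na nb : ℕ} (h : η ≤ δ) (h1 : p ≤ q) (h2 : p + na ≤ q + nb) :
    δ * (p+1) + η * na ≤ δ * (q+1) + η * nb := by
  obtain ⟨d, rfl⟩ := Nat.exists_eq_add_of_le h1
  obtain ⟨e, rfl⟩ := Nat.exists_eq_add_of_le h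
  have : na ≤ d + nb := by omega
  nlinarith [Nat.mul_le_mul_left η this]

lemma ar2 {η p q na nb : ℕ} (h1 : p < q) (h2 : p + na ≤ q + nb) :
    (η+1) * (p+1) + η * na + 1 ≤ (η+1) * (q+1) + η * nb := by
  obtain ⟨d, rfl⟩ := Nat.exists_eq_add_of_le h1
  have : na ≤ 1 + d + nb := by omega
  nlinarith [Nat.mul_le_mul_left η this]

lemma Strong.insB {la lb k} (h : Strong la lb k) (n : ℕ) (hn : 1 ≤ n) (hc : la.card ≤ lb.card) :
    Strong la (n ::ₘ lb) k := by
  obtain ⟨m, μ, na, nb, sa, sb, h, h1, h2⟩ := h.q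
  have g := h.ins n hn (Or.inl rfl) true
  have := ar1 (show n/2 ≤ (n+1)/2 by omega) hc h2
  refine g.strong ?_ ?_
  · simp only [cond_true]; omega
  · simp only [cond_true, Multiset.card_cons]; omega

lemma Weak.insB {la lb k} (h : Weak la lb k) (hc : la.card ≤ lb.card) :
    Weak la (1 ::ₘ lb) k := by
  obtain ⟨m, μ, na, nb, sa, sb, h, h1, h2⟩ := h.q
  have g := h.ins 1 le_rfl (Or.inr rfl) true
  refine g.weak ?_ ?_
  · simp only [cond_true]; omega
  · simp only [cond_true, Multiset.card_cons]; omega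

lemma Weak.spc {la lb k} (h : Weak la lb k) (hc : la.card ≤ lb.card) :
    Weak (2 ::ₘ la) (1 ::ₘ lb) k := by
  obtain ⟨m, μ, na, nb, sa, sb, h, h1, h2⟩ := h.q
  refine h.spc.weak ?_ ?_
  · omega
  · simp only [Multiset.card_cons]; omega

lemma Weak.insA {la lb k} (h : Weak la lb k) (hc : la.card < lb.card) :
    Lt (1 ::ₘ la) lb k := by
  obtain ⟨m, μ, na, nb, sa, sb, h, h1, h2⟩ := h.q
  have g := h.ins 1 le_rfl (Or.inr rfl) false
  refine g.lt ?_
  simp [ninner]; omega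

lemma Strong.insO {la lb k} (h : Strong la lb k) (x : ℕ) (hc : la.card < lb.card) :
    Lt ((2*x+1) ::ₘ la) lb k := by
  obtain ⟨m, μ, na, nb, sa, sb, h, h1, h2⟩ := h.q
  have g := h.ins (2*x+1) (by omega) (Or.inl rfl) false
  have := ar2 (η := x) hc h2
  refine g.lt ?_
  have e1 : (2*x+1+1)/2 = x+1 := by omega
  have e2 : (2*x+1)/2 = x := by omega
  simp only [cond_false, e1, e2, ninner, show (2*x+1)%2 = 1 by omega, if_true]; omega

lemma Strong.insOB {la lb k} (h : Strong la lb k) (x y : ℕ) (hy : 1 ≤ y) (hc : la.card ≤ lb.card) :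
    Strong ((2*x+1) ::ₘ la) (y ::ₘ lb) k := by
  obtain ⟨m, μ, na, nb, sa, sb, h, h1, h2⟩ := h.q
  have g := h.ins y hy (Or.inl rfl) true
  have := ar1 (show y/2 ≤ (y+1)/2 by omega) hc h2
  have g' := g.ins (2*x+1) (by omega) (Or.inl rfl) false
  have e1 : (2*x+1+1)/2 = x+1 := by omega
  have e2 : (2*x+1)/2 = x := by omega
  simp only [cond_false, cond_true, e1, e2, ninner, show (2*x+1)%2 = 1 by omega, if_true, Multiset.card_cons] at g'
  refine g'.strong ?_ ?_
  · have := ar2 (η := x) (p := la.card) (q := lb.card+1) (na := na+0) (nb := nb + (y+1)%2) (by omega) (by omega)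
    omega
  · simp only [Multiset.card_cons]; omega

lemma Strong.insEE {la lb k} (h : Strong la lb k) (x y : ℕ) (hx : 1 ≤ x) (hy : 1 ≤ y) (hc : la.card ≤ lb.card) :
    Strong ((2*x) ::ₘ la) ((2*y) ::ₘ lb) k := by
  obtain ⟨m, μ, na, nb, sa, sb, h, h1, h2⟩ := h.q
  have g := h.ins (2*y) (by omega) (Or.inl rfl) true
  have := ar1 (le_refl y) hc h2
  have g' := g.ins (2*x) (by omega) (Or.inl rfl) false
  have e1 : (2*x+1)/2 = x := by omega
  have e2 : (2*x)/2 = x := by omega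
  have e3 : (2*y+1)/2 = y := by omega
  have e4 : (2*y)/2 = y := by omega
  simp only [cond_false, cond_true, e1, e2, e3, e4, ninner, show ¬ (2*x)%2 = 1 by omega, show ¬ (2*y)%2 = 1 by omega,
    show (2*x+1)%2 = 1 by omega, show (2*y+1)%2 = 1 by omega, if_false, Multiset.card_cons] at g'
  refine g'.strong ?_ ?_
  · have h3 : x * (la.card + 1) + x * (na+0) + 2 * x ≤ x * (lb.card+1+1) + x * (nb+1) := by
      rw [mul_comm 2 x, ← mul_add, ← mul_add, ← mul_add]
      exact Nat.mul_le_mul_left _ (by omega)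
    omega
  · simp only [Multiset.card_cons]; omega
end DS

namespace DS

lemma weak_22_111 (c : ℕ) : Weak {2, 2} {1, 1, 1} (2*c+1) := by
  set w := (alt (c+8) 3 (2*c+1)).reverse with hw
  have hwl : w.length = 2*c+1 := by rw [hw, List.length_reverse, alt_length]
  have hh : w.head? = some (2*c+8) := by
    rw [hw, List.head?_reverse, alt_last_odd]; congr 1; omega
  have hl : w.getLast? = some (c+8) := by
    rw [hw, List.getLast?_reverse]; exact alt_head _ _ _ (by omega)
  have hlab : ((w : List ℕ) : Multiset ℕ) = R (c+8) (2*c+9) + R 3 (c+3) := by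
    rw [hw, Multiset.coe_reverse, alt_labs]; congr 2 <;> omega
  have hpr : ∀ r ∈ prs w, (r.1 < c + 3 ∧ c+8 ≤ r.2) ∨ (r.2 < c+3 ∧ c+8 ≤ r.1) := by
    intro r hr
    have := (prs_reverse (alt (c+8) 3 (2*c+1))).mem_iff.1 hr
    obtain ⟨t, ht, rfl⟩ := List.mem_map.1 this
    have := alt_prs_mem3 _ _ _ t ht
    simp only [Prod.fst_swap, Prod.snd_swap]
    omega
  have hsm : (((prs w).map (fun q => q.1+q.2) : List ℕ) : Multiset ℕ) = R (c+11) (3*c+11) := by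
    have e := ((prs_reverse (alt (c+8) 3 (2*c+1))).map (fun q : ℕ × ℕ => q.1+q.2))
    rw [← Multiset.coe_eq_coe] at e
    rw [hw, e, List.map_map]
    have : ((fun q : ℕ × ℕ => q.1 + q.2) ∘ Prod.swap) = (fun q : ℕ × ℕ => q.1+q.2) := by
      funext q; simp [add_comm]
    rw [this, alt_prs_sums]
    congr 1; omega
  have hpr2 : ∀ r ∈ prs w, c+11 ≤ r.1 + r.2 ∧ r.1 + r.2 < 3*c+11 := by
    intro r hr
    have : r.1 + r.2 ∈ R (c+11) (3*c+11) := by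
      rw [← hsm]; simp only [Multiset.mem_coe, List.mem_map]; exact ⟨r, hr, rfl⟩
    exact mem_R.1 this
  set ps : List Pth := [(some false, [1, c+6]), (some false, [c+7, 2]), (none, w), (some true, [c+3]),
    (some true, [c+4]), (some true, [c+5])] with hps
  have ia : incs false ps = [1, c+7, 2*c+8] := by simp [hps, incs, inc, hh]
  have ib : incs true ps = [c+8, c+3, c+4, c+5] := by simp [hps, incs, inc, hl]
  have hp : pairs ps = (1, c+6) :: (c+7, 2) :: prs w := by
    have z1 : prs [1, c+6] = [(1, c+6)] := rfl
    have z2 : prs [c+7, 2] = [(c+7, 2)] := rfl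
    have z3 : ∀ x, prs [x] = [] := fun x => rfl
    simp [hps, pairs, z1, z2, z3]
  have hsms : sms ps = (c+7) ::ₘ (c+9) ::ₘ R (c+11) (3*c+11) := by
    rw [sms, hp, ← hsm]
    simp only [List.map_cons, ← Multiset.cons_coe]
    congr 1; omega
  have hmem : ∀ s ∈ sms ps, s = c+7 ∨ s = c+9 ∨ (c+11 ≤ s ∧ s < 3*c+11) := by
    intro s hs; rw [hsms] at hs; simpa [mem_R] using hs
  refine ⟨2*c+8, c+6, ps, ?_, ⟨?_, by omega, ?_, ?_, ?_, ?_, ?_, ?_, ?_, ?_, ?_, ?_⟩, ?_, ?_⟩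
  · simp [hps, spec, SP, hwl, ← Multiset.cons_coe, ← Multiset.singleton_add]; abel
  · have e : labs ps = {1} + {2} + {c+6} + {c+7} + (w : Multiset ℕ) + {c+3} + {c+4} + {c+5} := by
      simp [hps, labs, ← Multiset.cons_coe, ← Multiset.singleton_add, ← Multiset.coe_add]; abel
    rw [e, hlab]
    have r1 := R_succ 1
    have r2 := R_succ 2
    have r3 := R_succ (c+3)
    have r4 := R_succ (c+4)
    have r5 := R_succ (c+5)
    have r6 := R_succ (c+6)
    have r7 := R_succ (c+7)
    rw [← r1, ← r2, ← r3, ← r4, ← r5, ← r6, ← r7]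
    show _ = R 1 (2*c+9)
    rw [← R_add (show 1 ≤ 2 by omega) (show 2 ≤ 2*c+9 by omega), ← R_add (show 2 ≤ 3 by omega) (show 3 ≤ 2*c+9 by omega),
      ← R_add (show 3 ≤ c+3 by omega) (show c+3 ≤ 2*c+9 by omega), ← R_add (show c+3 ≤ c+4 by omega) (show c+4 ≤ 2*c+9 by omega),
      ← R_add (show c+4 ≤ c+5 by omega) (show c+5 ≤ 2*c+9 by omega), ← R_add (show c+5 ≤ c+6 by omega) (show c+6 ≤ 2*c+9 by omega),
      ← R_add (show c+6 ≤ c+7 by omega) (show c+7 ≤ 2*c+9 by omega), ← R_add (show c+7 ≤ c+8 by omega) (show c+8 ≤ 2*c+9 by omega)]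
    abel
  · rw [hsms]
    simp [mem_R, R_nodup]
  · intro x hx; simp [hps, lfs, lf] at hx; omega
  · intro s hs; have := hmem s hs; omega
  · intro v; cases v
    · rw [ia]; simp; omega
    · rw [ib]; simp; omega
  · intro v s hs; have := hmem s hs; cases v
    · rw [ia]; simp; omega
    · rw [ib]; simp; omega
  · rw [ia]; rfl
  · rw [ib]; rfl
  · intro v; cases v
    · rw [ia]; simp
    · rw [ib]; simp
  · intro v; cases v
    · rw [ia]; simp [cnt]; split_ifs <;> omega
    · rw [ib]; simp
  · refine ⟨c+8, 3*c+16, by omega, by omega, ?_⟩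
    intro r hr
    rw [hp] at hr
    simp only [List.mem_cons] at hr
    rcases hr with rfl | rfl | hr
    · simp; omega
    · simp; omega
    · have := hpr r hr; have := hpr2 r hr; omega
  · rw [ia, ib]; simp; omega
  · rw [ia, ib]
    have e1 : ¬ c + 6 < 1 := by omega
    have e2 : c + 6 < 2*c+8 := by omega
    simp [cnt, List.countP_cons, e1, e2]
end DS

namespace DS

lemma par (x : ℕ) : (∃ r, x = 2*r+1) ∨ (∃ r, x = 2*r) := by
  rcases Nat.even_or_odd' x with ⟨r, h | h⟩
  · exact Or.inr ⟨r, h⟩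
  · exact Or.inl ⟨r, h⟩

lemma pair_comm' (x y : ℕ) : ({x, y} : Multiset ℕ) = {y, x} := Multiset.cons_swap x y 0

lemma cls2 (l : Multiset ℕ) (h : l.card = 2) (hp : ∀ x ∈ l, 1 ≤ x) :
    (∃ x y, x ≤ y ∧ l = {2*x+1, 2*y+1}) ∨ (∃ x y, 1 ≤ y ∧ l = {2*x+1, 2*y}) ∨
    (∃ x y, 1 ≤ x ∧ 1 ≤ y ∧ x ≤ y ∧ l = {2*x, 2*y}) := by
  obtain ⟨a, b, rfl⟩ := Multiset.card_eq_two.1 h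
  have ha := hp a (by simp)
  have hb := hp b (by simp)
  rcases par a with ⟨x, rfl⟩ | ⟨x, rfl⟩ <;> rcases par b with ⟨y, rfl⟩ | ⟨y, rfl⟩
  · rcases le_total x y with h | h
    · exact Or.inl ⟨x, y, h, rfl⟩
    · exact Or.inl ⟨y, x, h, pair_comm' _ _⟩
  · exact Or.inr (Or.inl ⟨x, y, by omega, rfl⟩)
  · exact Or.inr (Or.inl ⟨y, x, by omega, pair_comm' _ _⟩)
  · rcases le_total x y with h | h
    · exact Or.inr (Or.inr ⟨x, y, by omega, by omega, h, rfl⟩)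
    · exact Or.inr (Or.inr ⟨y, x, by omega, by omega, h, pair_comm' _ _⟩)

lemma cls3 (l : Multiset ℕ) (h : l.card = 3) (hp : ∀ x ∈ l, 1 ≤ x) :
    (∃ x y z, x ≤ y ∧ y ≤ z ∧ l = {2*x+1, 2*y+1, 2*z+1}) ∨ (∃ x y z, x ≤ y ∧ 1 ≤ z ∧ l = {2*x+1, 2*y+1, 2*z}) ∨
    (∃ x y z, 1 ≤ y ∧ 1 ≤ z ∧ y ≤ z ∧ l = {2*x+1, 2*y, 2*z}) ∨
    (∃ x y z, 1 ≤ x ∧ 1 ≤ y ∧ x ≤ y ∧ 1 ≤ z ∧ y ≤ z ∧ l = {2*x, 2*y, 2*z}) := by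
  obtain ⟨d, l2, rfl, h2⟩ : ∃ d l2, l = d ::ₘ l2 ∧ l2.card = 2 := by
    obtain ⟨a, b, c, rfl⟩ := Multiset.card_eq_three.1 h
    exact ⟨a, {b, c}, rfl, rfl⟩
  have sw : ∀ a b c : ℕ, (a ::ₘ {b, c} : Multiset ℕ) = {b, a, c} := fun a b c => Multiset.cons_swap _ _ _
  have sw2 : ∀ a b c : ℕ, (a ::ₘ {b, c} : Multiset ℕ) = {b, c, a} := by
    intro a b c; rw [sw a b c]; show b ::ₘ {a, c} = b ::ₘ {c, a}; rw [pair_comm']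
  clear h
  have hd := hp d (by simp)
  rcases par d with ⟨u, rfl⟩ | ⟨u, rfl⟩ <;>
    rcases cls2 l2 h2 (fun x hx => hp x (by simp [hx])) with ⟨x, y, h, rfl⟩ | ⟨x, y, h, rfl⟩ | ⟨x, y, h, h', h'', rfl⟩
  · left
    rcases le_total u x with h1 | h1
    · exact ⟨u, x, y, h1, h, rfl⟩
    · rcases le_total u y with h2 | h2
      · exact ⟨x, u, y, h1, h2, sw _ _ _⟩
      · exact ⟨x, y, u, h, h2, sw2 _ _ _⟩
  · right; left
    rcases le_total u x with h1 | h1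
    · exact ⟨u, x, y, h1, h, rfl⟩
    · exact ⟨x, u, y, h1, h, sw _ _ _⟩
  · right; right; left
    exact ⟨u, x, y, h, h', h'', rfl⟩
  · right; left
    exact ⟨x, y, u, h, by omega, sw2 _ _ _⟩
  · right; right; left
    rcases le_total u y with h1 | h1
    · exact ⟨x, u, y, by omega, h, h1, sw _ _ _⟩
    · exact ⟨x, y, u, by omega, by omega, h1, sw2 _ _ _⟩
  · right; right; right
    rcases le_total u x with h1 | h1
    · exact ⟨u, x, y, by omega, by omega, h1, by omega, h'', rfl⟩
    · rcases le_total u y with h2 | h2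
      · exact ⟨x, u, y, by omega, by omega, h1, by omega, h2, sw _ _ _⟩
      · exact ⟨x, y, u, by omega, by omega, h'', by omega, h2, sw2 _ _ _⟩

lemma b34 {la lb : Multiset ℕ} {k : ℕ} (hk : 1 ≤ k) (ha : la.card = 2) (hb : lb.card = 3)
    (pa : ∀ x ∈ la, 1 ≤ x) (pb : ∀ x ∈ lb, 1 ≤ x)
    (nb : ¬ (la = {2, 2} ∧ (∀ x ∈ lb, x = 1) ∧ k % 2 = 1)) : Strong la lb k := by
  have r3 : ∀ a b c : ℕ, ({a, b, c} : Multiset ℕ) = {c, a, b} := by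
    intro a b c; show a ::ₘ {b, c} = c ::ₘ {a, b}
    rw [pair_comm' b c]; exact Multiset.cons_swap _ _ _
  rcases par k with ⟨c, rfl⟩ | ⟨c, rfl⟩
  · rcases cls2 la ha pa with ⟨x, y, h, rfl⟩ | ⟨x, y, h, rfl⟩ | ⟨x, y, h, h', h'', rfl⟩ <;>
    rcases cls3 lb hb pb with ⟨z, w, u, e1, e2, rfl⟩ | ⟨z, w, u, e1, e2, rfl⟩ | ⟨z, w, u, e1, e2, e3, rfl⟩ | ⟨z, w, u, e1, e2, e3, e4, e5, rfl⟩
    · rcases Nat.eq_zero_or_pos x with rfl | hx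
      · rcases Nat.eq_zero_or_pos y with rfl | hy
        · exact B1_SS_UUU z w u c e1 e2
        · exact B1_SO_UUU y z w u c hy e1 e2
      · exact B1_OO_UUU x y z w u c hx (by omega) h e1 e2
    · exact B1_UU_UUE x y z w u c h e1 e2
    · exact B1_UU_UEE x y z w u c h e1 e2 e3
    · exact B1_UU_EEE x y z w u c h e1 e2 e3 e4 e5
    · exact B1_UE_UUU x y z w u c h e1 e2
    · exact B1_UE_UUE x y z w u c h e1 e2
    · exact B1_UE_UEE x y z w u c h e1 e2 e3
    · exact B1_UE_EEE x y z w u c h e1 e2 e3 e4 e5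
    · rcases Nat.eq_zero_or_pos u with rfl | hu
      · obtain rfl : w = 0 := by omega
        obtain rfl : z = 0 := by omega
        by_cases hy : 2 ≤ y
        · exact B1_EF_SSS x y c h hy h''
        · exfalso
          obtain rfl : y = 1 := by omega
          obtain rfl : x = 1 := by omega
          apply nb
          simp
      · rw [r3]; exact B1_EE_OUU x y u z w c h h' h'' hu e1
    · exact B1_EE_UUE x y z w u c h h' h'' e1 e2
    · exact B1_EE_UEE x y z w u c h h' h'' e1 e2 e3
    · exact B1_EE_EEE x y z w u c h h' h'' e1 e2 e3 e4 e5
  · obtain ⟨c, rfl⟩ : ∃ d, c = d+1 := ⟨c-1, by omega⟩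
    show Strong la lb (2*c+2)
    clear nb
    rcases cls2 la ha pa with ⟨x, y, h, rfl⟩ | ⟨x, y, h, rfl⟩ | ⟨x, y, h, h', h'', rfl⟩ <;>
    rcases cls3 lb hb pb with ⟨z, w, u, e1, e2, rfl⟩ | ⟨z, w, u, e1, e2, rfl⟩ | ⟨z, w, u, e1, e2, e3, rfl⟩ | ⟨z, w, u, e1, e2, e3, e4, e5, rfl⟩
    · rcases Nat.eq_zero_or_pos x with rfl | hx
      · rcases Nat.eq_zero_or_pos y with rfl | hy
        · rcases Nat.eq_zero_or_pos z with rfl | hz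
          · rcases Nat.eq_zero_or_pos w with rfl | hw
            · rcases Nat.eq_zero_or_pos u with rfl | hu
              · exact B0_SS_SSS c
              · exact B0_SS_SSO u c hu
            · exact B0_SS_SOO w u c hw (by omega) e2
          · exact B0_SS_OOO z w u c hz (by omega) e1 (by omega) e2
        · exact B0_SO_UUU y z w u c hy e1 e2
      · rcases Nat.eq_zero_or_pos z with rfl | hz
        · rcases Nat.eq_zero_or_pos w with rfl | hw
          · rcases Nat.eq_zero_or_pos u with rfl | hu
            · exact B0_OO_SSS x y c hx (by omega) h
            · exact B0_OO_SSO x y u c hx (by omega) h hu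
          · exact B0_OO_SOO x y w u c hx (by omega) h hw (by omega) e2
        · exact B0_OO_OOO x y z w u c hx (by omega) h hz (by omega) e1 (by omega) e2
    · exact B0_UU_UUE x y z w u c h e1 e2
    · exact B0_UU_UEE x y z w u c h e1 e2 e3
    · exact B0_UU_EEE x y z w u c h e1 e2 e3 e4 e5
    · exact B0_UE_UUU x y z w u c h e1 e2
    · exact B0_UE_UUE x y z w u c h e1 e2
    · exact B0_UE_UEE x y z w u c h e1 e2 e3
    · exact B0_UE_EEE x y z w u c h e1 e2 e3 e4 e5
    · exact B0_EE_UUU x y z w u c h h' h'' e1 e2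
    · exact B0_EE_UUE x y z w u c h h' h'' e1 e2
    · exact B0_EE_UEE x y z w u c h h' h'' e1 e2 e3
    · exact B0_EE_EEE x y z w u c h h' h'' e1 e2 e3 e4 e5

lemma b33 {la lb : Multiset ℕ} {k : ℕ} (hk : 1 ≤ k) (ha : la.card = 2) (hb : lb.card = 2)
    (pa : ∀ x ∈ la, 1 ≤ x) (pb : ∀ x ∈ lb, 1 ≤ x) : NE la lb k ∨ NE lb la k := by
  rcases par k with ⟨c, rfl⟩ | ⟨c, rfl⟩
  · rcases cls2 la ha pa with ⟨x, y, h, rfl⟩ | ⟨x, y, h, rfl⟩ | ⟨x, y, h, h', h'', rfl⟩ <;>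
    rcases cls2 lb hb pb with ⟨z, w, e, rfl⟩ | ⟨z, w, e, rfl⟩ | ⟨z, w, e, e', e'', rfl⟩
    · left
      rcases Nat.eq_zero_or_pos z with rfl | hz
      · rcases Nat.eq_zero_or_pos w with rfl | hw
        · exact A1_UU_SS x y c h
        · exact A1_UU_SO x y w c h hw
      · exact A1_UU_OO x y z w c h hz (by omega) e
    · left
      rcases Nat.eq_zero_or_pos z with rfl | hz
      · exact A1_UU_SE x y w c h e
      · exact A1_UU_OE x y z w c h hz e
    · left; exact A1_UU_EE x y z w c h e e' e''
    · right
      rcases Nat.eq_zero_or_pos x with rfl | hx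
      · exact A1_UU_SE z w y c e h
      · exact A1_UU_OE z w x y c e hx h
    · left
      rcases Nat.eq_zero_or_pos z with rfl | hz
      · exact A1_UE_SE x y w c h e
      · exact A1_UE_OE x y z w c h hz e
    · left; exact A1_UE_EE x y z w c h e e' e''
    · right; exact A1_UU_EE z w x y c e h h' h''
    · right; exact A1_UE_EE z w x y c e h h' h''
    · left; exact A1_EE_EE x y z w c h h' h'' e e' e''
  · obtain ⟨c, rfl⟩ : ∃ d, c = d+1 := ⟨c-1, by omega⟩
    show NE la lb (2*c+2) ∨ NE lb la (2*c+2)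
    have ue : ∀ x y z w, x ≤ y → 1 ≤ w → NE {2*x+1, 2*y+1} {2*z+1, 2*w} (2*c+2) := by
      intro x y z w h e
      rcases Nat.eq_zero_or_pos x with rfl | hx
      · rcases Nat.eq_zero_or_pos y with rfl | hy
        · exact A0_SS_UE z w c e
        · exact A0_SO_UE y z w c hy e
      · exact A0_OO_UE x y z w c hx (by omega) h e
    rcases cls2 la ha pa with ⟨x, y, h, rfl⟩ | ⟨x, y, h, rfl⟩ | ⟨x, y, h, h', h'', rfl⟩ <;>
    rcases cls2 lb hb pb with ⟨z, w, e, rfl⟩ | ⟨z, w, e, rfl⟩ | ⟨z, w, e, e', e'', rfl⟩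
    · rcases Nat.eq_zero_or_pos x with rfl | hx
      · rcases Nat.eq_zero_or_pos y with rfl | hy
        · left
          rcases Nat.eq_zero_or_pos z with rfl | hz
          · rcases Nat.eq_zero_or_pos w with rfl | hw
            · exact A0_SS_SS c
            · exact A0_SS_SO w c hw
          · exact A0_SS_OO z w c hz (by omega) e
        · rcases Nat.eq_zero_or_pos z with rfl | hz
          · rcases Nat.eq_zero_or_pos w with rfl | hw
            · right; exact A0_SS_SO y c hy
            · left; exact A0_SO_SO y w c hy hw
          · left; exact A0_SO_OO y z w c hy hz (by omega) e
      · rcases Nat.eq_zero_or_pos z with rfl | hz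
        · right
          rcases Nat.eq_zero_or_pos w with rfl | hw
          · exact A0_SS_OO x y c hx (by omega) h
          · exact A0_SO_OO w x y c hw hx (by omega) h
        · left; exact A0_OO_OO x y z w c hx (by omega) h hz (by omega) e
    · left; exact ue x y z w h e
    · left; exact A0_UU_EE x y z w c h e e' e''
    · right; exact ue z w x y e h
    · left; exact A0_UE_UE x y z w c h e
    · left; exact A0_UE_EE x y z w c h e e' e''
    · right; exact A0_UU_EE z w x y c e h h' h''
    · right; exact A0_UE_EE z w x y c e h h' h''
    · left; exact A0_EE_EE x y z w c h h' h'' e e' e''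

lemma c33 {la lb : Multiset ℕ} {k : ℕ} (hk : 1 ≤ k) (ha : la.card = 2) (hb : lb.card = 2)
    (pa : ∀ x ∈ la, 1 ≤ x ∧ x % 2 = 0) (pb : ∀ x ∈ lb, 1 ≤ x ∧ x % 2 = 0) : Strong la lb k := by
  rcases cls2 la ha (fun x hx => (pa x hx).1) with ⟨x, y, h, rfl⟩ | ⟨x, y, h, rfl⟩ | ⟨x, y, h, h', h'', rfl⟩
  · have := (pa (2*x+1) (by simp)).2; omega
  · have := (pa (2*x+1) (by simp)).2; omega
  rcases cls2 lb hb (fun x hx => (pb x hx).1) with ⟨z, w, e, rfl⟩ | ⟨z, w, e, rfl⟩ | ⟨z, w, e, e', e'', rfl⟩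
  · have := (pb (2*z+1) (by simp)).2; omega
  · have := (pb (2*z+1) (by simp)).2; omega
  rcases par k with ⟨c, rfl⟩ | ⟨c, rfl⟩
  · exact C1_EE_EE x y z w c h h' h'' e e' e''
  · obtain ⟨c, rfl⟩ : ∃ d, c = d+1 := ⟨c-1, by omega⟩
    exact C0_EE_EE x y z w c h h' h'' e e' e''
end DS

namespace DS

lemma go_append (f c A B) : go f c (A ++ B) = go f c A ++ go f (fin c A) B := by
  induction A generalizing c with
  | nil => rfl
  | cons a A ih => simp [go, fin, ih]
lemma fin_append (c A B) : fin c (A ++ B) = fin (fin c A) B := by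
  induction A generalizing c with
  | nil => rfl
  | cons a A ih => simp [fin, ih]
lemma oks_append (Y c A B) : oks Y c (A ++ B) ↔ oks Y c A ∧ oks Y (fin c A) B := by
  induction A generalizing c with
  | nil => simp [oks, fin]
  | cons a A ih => simp only [List.cons_append, oks, fin, ih, and_assoc]
lemma hct_append (v A B) : hct v (A ++ B) = hct v A + hct v B := by simp [hct]

section TP
lemma TP_fin (l p h t) (X : List ℕ) : fin ⟨l,p,h,t⟩ (X.map (TP false)) =
    ⟨l + X.sum, p + X.length, h + X.sum, t + X.length⟩ := by
  induction X generalizing l p h t with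
  | nil => rfl
  | cons x X ih => simp [fin, nxt, ih]; omega
lemma TP_b (c) (X : List ℕ) : go (binc true) c (X.map (TP false)) = [] := by
  induction X generalizing c with
  | nil => rfl
  | cons x X ih => simp [go, ih, binc, btag]
lemma TP_a (l p h t) (X : List ℕ) : (go (binc false) ⟨l,p,h,t⟩ (X.map (TP false))).length = X.length ∧
    2 * (go (binc false) ⟨l,p,h,t⟩ (X.map (TP false))).sum + X.length = X.length * (2 * p + X.length) := by
  induction X generalizing l p h t with
  | nil => simp [go]
  | cons x X ih =>
    simp only [List.map_cons, go, binc, btag, nxt, BEq.rfl, cond_true, bfst, List.cons_append, List.nil_append,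
      List.length_cons, List.sum_cons]
    obtain ⟨h1, h2⟩ := ih (l + x + cond (true && false) 1 0) (p+1) (h + x + cond (!true && false) 1 0) (t+1)
    refine ⟨by rw [h1], ?_⟩
    nlinarith
lemma TP_lf (l p h t) (X : List ℕ) (hX : ∀ x ∈ X, 1 ≤ x) : ∀ s ∈ go blf ⟨l,p,h,t⟩ (X.map (TP false)), s + 1 ≤ l + X.sum := by
  induction X generalizing l p h t with
  | nil => simp [go]
  | cons x X ih =>
    have := ih (l + x) (p+1) (h+x) (t+1) (fun y hy => hX y (by simp [hy]))
    have h1 := hX x (by simp)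
    intro s hs
    simp [go, blf, btag, blst, cfst, nxt] at hs
    rcases hs with rfl | hs
    · simp; omega
    · have := this s hs; simp; omega
lemma TP_mx (l p h t) (X : List ℕ) (hX : ∀ x ∈ X, 1 ≤ x) : ∀ s ∈ go bmx ⟨l,p,h,t⟩ (X.map (TP false)), 1 ≤ X.length ∧
    (s + 2 ≤ l + X.sum + h + X.sum ∨ s + 2 ≤ h + X.sum + t + X.length ∨ s + 2 ≤ p + X.length + t + X.length) := by
  induction X generalizing l p h t with
  | nil => simp [go]
  | cons x X ih =>
    have := ih (l + x) (p+1) (h+x) (t+1) (fun y hy => hX y (by simp [hy]))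
    have h1 := hX x (by simp)
    intro s hs
    simp [go, bmx, clst, nxt] at hs
    simp only [List.sum_cons, List.length_cons]
    rcases hs with rfl | rfl | rfl | hs
    · omega
    · omega
    · omega
    · have := this s hs; omega
lemma TP_ok (Y l p h t) (X : List ℕ) (hX : ∀ x ∈ X, 1 ≤ x) (hY : X ≠ [] → p + t + 2 * X.length < Y + 2) : oks Y ⟨l,p,h,t⟩ (X.map (TP false)) := by
  induction X generalizing l p h t with
  | nil => simp [oks]
  | cons x X ih =>
    have := ih (l + x) (p+1) (h+x) (t+1) (fun y hy => hX y (by simp [hy])) (fun _ => by have := hY (by simp); simp at this; omega)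
    have h1 := hX x (by simp)
    have h2 := hY (by simp)
    simp only [List.map_cons, oks, ok, nxt]
    refine ⟨⟨by simp; omega, by simp at *; omega⟩, by simpa using this⟩
lemma TP_hct (v) (X : List ℕ) : hct v (X.map (TP false)) = 0 := by
  induction X with
  | nil => rfl
  | cons x X ih => simp [hct, bH, btag, bfH] at *; exact ih
end TP

section OT
lemma OT_fin (l p h t) (X : List ℕ) : fin ⟨l,p,h,t⟩ (X.map (OT true)) =
    ⟨l + X.sum, p, h + X.sum, t + X.length⟩ := by
  induction X generalizing l p h t with
  | nil => rfl
  | cons x X ih => simp [fin, nxt, ih]; omega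
lemma OT_a (c) (X : List ℕ) : go (binc false) c (X.map (OT true)) = [] := by
  induction X generalizing c with
  | nil => rfl
  | cons x X ih => simp [go, ih, binc, btag]
lemma OT_b (l p h t) (X : List ℕ) : (go (binc true) ⟨l,p,h,t⟩ (X.map (OT true))).length = X.length ∧
    X.length * t ≤ (go (binc true) ⟨l,p,h,t⟩ (X.map (OT true))).sum := by
  induction X generalizing l p h t with
  | nil => simp [go]
  | cons x X ih =>
    simp only [List.map_cons, go, binc, btag, nxt, BEq.rfl, cond_true, bfst, List.cons_append, List.nil_append,
      List.length_cons, List.sum_cons]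
    obtain ⟨h1, h2⟩ := ih (l + x + cond (true && false) 1 0) (p+0) (h + x + cond (!true && false) 1 0) (t+1)
    refine ⟨by rw [h1], ?_⟩
    nlinarith
lemma OT_lf (l p h t) (X : List ℕ) (hX : ∀ x ∈ X, 1 ≤ x) : ∀ s ∈ go blf ⟨l,p,h,t⟩ (X.map (OT true)), s + 1 ≤ l + X.sum := by
  induction X generalizing l p h t with
  | nil => simp [go]
  | cons x X ih =>
    have := ih (l + x) (p) (h+x) (t+1) (fun y hy => hX y (by simp [hy]))
    have h1 := hX x (by simp)
    intro s hs
    simp [go, blf, btag, blst, cfst, nxt] at hs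
    rcases hs with rfl | hs
    · simp; omega
    · have := this s hs; simp; omega
lemma OT_mx (l p h t) (X : List ℕ) (hX : ∀ x ∈ X, 1 ≤ x) : ∀ s ∈ go bmx ⟨l,p,h,t⟩ (X.map (OT true)), 1 ≤ X.length ∧
    (s + 2 ≤ l + X.sum + h + X.sum ∨ s + 2 ≤ h + X.sum + t + X.length) := by
  induction X generalizing l p h t with
  | nil => simp [go]
  | cons x X ih =>
    have := ih (l + x) (p) (h+x) (t+1) (fun y hy => hX y (by simp [hy]))
    have h1 := hX x (by simp)
    intro s hs
    simp [go, bmx, clst, nxt] at hs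
    simp only [List.sum_cons, List.length_cons]
    rcases hs with rfl | rfl | hs
    · omega
    · omega
    · have := this s hs; omega
lemma OT_ok (Y c) (X : List ℕ) (hX : ∀ x ∈ X, 1 ≤ x) : oks Y c (X.map (OT true)) := by
  induction X generalizing c with
  | nil => simp [oks]
  | cons x X ih =>
    have h1 := hX x (by simp)
    simp only [List.map_cons, oks, ok]
    exact ⟨⟨by simp; omega, by simp⟩, ih _ (fun y hy => hX y (by simp [hy]))⟩
lemma OT_hct (v) (X : List ℕ) : hct v (X.map (OT true)) = cond v X.length 0 := by
  induction X with
  | nil => cases v <;> rfl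
  | cons x X ih => cases v <;> simp [hct, bH, btag, bfH] at * <;> omega
end OT

section EI
lemma EI_fin (l p h t) (X : List ℕ) : fin ⟨l,p,h,t⟩ (X.map (Ein false)) =
    ⟨l + X.sum, p, h + X.sum, t⟩ := by
  induction X generalizing l p h t with
  | nil => rfl
  | cons x X ih => simp [fin, nxt, ih]; omega
lemma EI_b (c) (X : List ℕ) : go (binc true) c (X.map (Ein false)) = [] := by
  induction X generalizing c with
  | nil => rfl
  | cons x X ih => simp [go, ih, binc, btag]
lemma EI_a (l p h t) (X : List ℕ) (hX : ∀ x ∈ X, 1 ≤ x) : (go (binc false) ⟨l,p,h,t⟩ (X.map (Ein false))).length = X.length ∧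
    X.length * h ≤ (go (binc false) ⟨l,p,h,t⟩ (X.map (Ein false))).sum ∧
    (go (binc false) ⟨l,p,h,t⟩ (X.map (Ein false))).sum + X.length ≤ X.length * (h + X.sum) := by
  induction X generalizing l p h t with
  | nil => simp [go]
  | cons x X ih =>
    have h1 := hX x (by simp)
    simp only [List.map_cons, go, binc, btag, nxt, BEq.rfl, cond_true, bfst, List.cons_append, List.nil_append,
      List.length_cons, List.sum_cons, clst, cond_false]
    obtain ⟨h1, h2, h3⟩ := ih (l + x + cond (true && false) 1 0) (p+0) (h + x + cond (!true && false) 1 0) (t+0) (fun y hy => hX y (by simp [hy]))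
    generalize go (binc false) _ _ = G at *
    simp only [Bool.not_true, Bool.and_false, cond_false, add_zero] at h2 h3
    refine ⟨by rw [h1], ?_, ?_⟩
    · have : h ≤ h + x - 1 := by omega
      nlinarith
    · have : h + x - 1 + 1 = h + x := by omega
      have e1 : (X.length + 1) * (h + (x + X.sum)) = X.length * (h + x + X.sum) + (h + x + X.sum) := by ring
      rw [e1]
      linarith [Nat.zero_le X.sum]
lemma EI_lf (l p h t) (X : List ℕ) (hX : ∀ x ∈ X, 1 ≤ x) : ∀ s ∈ go blf ⟨l,p,h,t⟩ (X.map (Ein false)), s + 1 ≤ l + X.sum := by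
  induction X generalizing l p h t with
  | nil => simp [go]
  | cons x X ih =>
    have := ih (l + x) (p) (h+x) (t) (fun y hy => hX y (by simp [hy]))
    have h1 := hX x (by simp)
    intro s hs
    simp [go, blf, btag, blst, cfst, nxt] at hs
    rcases hs with rfl | hs
    · simp; omega
    · have := this s hs; simp; omega
lemma EI_mx (l p h t) (X : List ℕ) (hX : ∀ x ∈ X, 1 ≤ x) : ∀ s ∈ go bmx ⟨l,p,h,t⟩ (X.map (Ein false)), 
    (s + 2 ≤ l + X.sum + h + X.sum) := by
  induction X generalizing l p h t with
  | nil => simp [go]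
  | cons x X ih =>
    have := ih (l + x) (p) (h+x) (t) (fun y hy => hX y (by simp [hy]))
    have h1 := hX x (by simp)
    intro s hs
    simp [go, bmx, nxt] at hs
    simp only [List.sum_cons]
    rcases hs with rfl | hs
    · omega
    · have := this s hs; omega
lemma EI_ok (Y c) (X : List ℕ) (hX : ∀ x ∈ X, 1 ≤ x) : oks Y c (X.map (Ein false)) := by
  induction X generalizing c with
  | nil => simp [oks]
  | cons x X ih =>
    have h1 := hX x (by simp)
    simp only [List.map_cons, oks, ok]
    exact ⟨⟨by simp; omega, by simp⟩, ih _ (fun y hy => hX y (by simp [hy]))⟩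
lemma EI_hct (v) (X : List ℕ) : hct v (X.map (Ein false)) = cond v 0 X.length := by
  induction X with
  | nil => cases v <;> rfl
  | cons x X ih => cases v <;> simp [hct, bH, btag, bfH] at * <;> omega
end EI

section sps
/-- `n` single edges at `b` with middle labels -/
abbrev sps (n : ℕ) : List Blk := List.replicate n (Blk.sp (some true))
lemma sps_fin (l p h t n) : fin ⟨l,p,h,t⟩ (sps n) = ⟨l,p+n,h,t⟩ := by
  induction n generalizing p with
  | zero => rfl
  | succ n ih => simp [sps, List.replicate_succ, fin, nxt] at *; rw [ih]; simp; omega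
lemma sps_a (c n) : go (binc false) c (sps n) = [] := by
  induction n generalizing c with
  | zero => rfl
  | succ n ih => simp [sps, List.replicate_succ, go, binc, btag] at *; rw [ih]
lemma sps_b (l p h t n) : (go (binc true) ⟨l,p,h,t⟩ (sps n)).length = n ∧ n * p ≤ (go (binc true) ⟨l,p,h,t⟩ (sps n)).sum := by
  induction n generalizing p with
  | zero => simp [sps, go]
  | succ n ih =>
    obtain ⟨h1, h2⟩ := ih (p+1)
    simp only [sps, List.replicate_succ, go, binc, btag, nxt, BEq.rfl, cond_true, bfst, List.cons_append, List.nil_append,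
      List.length_cons, List.sum_cons] at *
    refine ⟨by rw [h1], by nlinarith⟩
lemma sps_lf (l p h t n) : ∀ s ∈ go blf ⟨l,p,h,t⟩ (sps n), s + 1 ≤ p + n := by
  induction n generalizing p with
  | zero => simp [sps, go]
  | succ n ih =>
    intro s hs
    simp [sps, List.replicate_succ, go, blf, btag, blst, nxt] at hs
    rcases hs with rfl | hs
    · omega
    · have := ih (p+1) s hs; omega
lemma sps_mx (c n) : go bmx c (sps n) = [] := by
  induction n generalizing c with
  | zero => rfl
  | succ n ih => simp [sps, List.replicate_succ, go, bmx] at *; rw [ih]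
lemma sps_ok (Y c n) : oks Y c (sps n) := by
  induction n generalizing c with
  | zero => simp [sps, oks]
  | succ n ih => simp [sps, List.replicate_succ, oks, ok] at *; apply ih
lemma sps_hct (v n) : hct v (sps n) = 0 := by
  induction n with
  | zero => rfl
  | succ n ih => cases v <;> simp [sps, hct, bH, btag, bfH] at *
end sps
end DS

namespace DS
open Blk En
section low
/-- `n` single edges at `b` with low labels -/
abbrev lows (n : ℕ) : List Blk := List.replicate n (Oin true 0)
lemma low_fin (l p h t n) : fin ⟨l,p,h,t⟩ (lows n) = ⟨l+n,p,h,t⟩ := by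
  induction n generalizing l with
  | zero => rfl
  | succ n ih => simp [lows, List.replicate_succ, fin, nxt] at *; rw [ih]; simp; omega
lemma low_a (c n) : go (binc false) c (lows n) = [] := by
  induction n generalizing c with
  | zero => rfl
  | succ n ih => simp [lows, List.replicate_succ, go, binc, btag] at *; rw [ih]
lemma low_b (l p h t n) : (go (binc true) ⟨l,p,h,t⟩ (lows n)).length = n ∧ n * l ≤ (go (binc true) ⟨l,p,h,t⟩ (lows n)).sum := by
  induction n generalizing l with
  | zero => simp [lows, go]
  | succ n ih =>
    obtain ⟨h1, h2⟩ := ih (l+1)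
    simp only [lows, List.replicate_succ, go, binc, btag, nxt, BEq.rfl, cond_true, bfst, List.cons_append, List.nil_append,
      List.length_cons, List.sum_cons, clst] at *
    simp only [Bool.and_true, Bool.not_true, cond_true, cond_false, add_zero] at *
    refine ⟨by rw [h1], by nlinarith⟩
lemma low_lf (l p h t n) : ∀ s ∈ go blf ⟨l,p,h,t⟩ (lows n), s + 1 ≤ l + n := by
  induction n generalizing l with
  | zero => simp [lows, go]
  | succ n ih =>
    intro s hs
    simp [lows, List.replicate_succ, go, blf, btag, blst, nxt] at hs
    rcases hs with rfl | hs
    · omega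
    · have := ih (l+1) s hs; omega
lemma low_mx (l p h t n) (hl : 1 ≤ l) : ∀ s ∈ go bmx ⟨l,p,h,t⟩ (lows n), s + 2 ≤ l + n + h := by
  induction n generalizing l with
  | zero => simp [lows, go]
  | succ n ih =>
    intro s hs
    simp [lows, List.replicate_succ, go, bmx, nxt] at hs
    rcases hs with rfl | hs
    · omega
    · have := ih (l+1) (by omega) s hs; omega
lemma low_ok (Y c n) : oks Y c (lows n) := by
  induction n generalizing c with
  | zero => simp [lows, oks]
  | succ n ih => simp [lows, List.replicate_succ, oks, ok] at *; apply ih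
lemma low_hct (v n) : hct v (lows n) = 0 := by
  induction n with
  | zero => rfl
  | succ n ih => cases v <;> simp [lows, hct, bH, btag, bfH] at *
end low

/-- the core block in the `b1` construction -/
abbrev KK (e : Bool) (c : ℕ) : Blk := cond e (KT true c) (KHH false c)

lemma KK_facts (e : Bool) (c l p h t : ℕ) (Y : ℕ) :
    nxt ⟨l,p,h,t⟩ (KK e c) = ⟨l + c, p, h + c + 1, t + cond e 1 0⟩ ∧
    binc false ⟨l,p,h,t⟩ (KK e c) = [h + cond e c 0] ∧
    binc true ⟨l,p,h,t⟩ (KK e c) = [cond e t (h+c)] ∧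
    blf ⟨l,p,h,t⟩ (KK e c) = [] ∧
    bmx ⟨l,p,h,t⟩ (KK e c) = (l + h + 2 * c + 1 - 2) :: (cond e [t+h] []) ∧
    ok Y ⟨l,p,h,t⟩ (KK e c) ∧ hct false [KK e c] = 1 ∧ hct true [KK e c] = 1 := by
  cases e <;> simp [KK, nxt, binc, btag, blf, bmx, ok, hct, bH, bfH, blH, bfst, blst, clst, cfst]

lemma four_mul_le (v : ℕ) : 4 * v ≤ v * v + 4 := by
  rcases Nat.lt_or_ge v 2 with h | h
  · interval_cases v <;> simp
  · obtain ⟨n, rfl⟩ : ∃ n, v = 2 + n := ⟨v - 2, by omega⟩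
    nlinarith
lemma num_lt {z ny nw x w y u v c p0 h0 t0 SX SY SW SS SL : ℕ} (e : Bool)
    (lX : z ≤ x) (lW : nw ≤ w) (lY : ny ≤ y) (hp : 3 ≤ z + ny) (hq : nw + u + v = z + ny + 1)
    (huv : (z = 0 ∧ u ≤ 1 ∧ v = 0) ∨ (1 ≤ z ∧ u = 2 ∧ v + 1 = z))
    (hp0 : p0 = 1 + (x + w + y + c + u)) (hh0 : h0 = p0 + (z + v)) (ht0 : t0 = h0 + (x + w + y + c + 1))
    (a2 : 2 * SX + z = z * (2 * p0 + z)) (a5 : SY + ny ≤ ny * (h0 + x + w + y))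
    (b2 : nw * (t0 + z) ≤ SW) (b4 : v * (p0 + z) ≤ SS) (b6 : u * (1 + x + w + y + c) ≤ SL) :
    SX + (SY + (h0 + x + w + y + cond e c 0)) < SW + (SS + (cond e (t0 + z + nw) (h0 + x + w + y + c) + SL)) := by
  have hA : SY ≤ ny * (t0 - 1) := by
    have : ny * (h0 + x + w + y) ≤ ny * (t0 - 1) := Nat.mul_le_mul_left _ (by omega)
    omega
  have hAB : h0 + x + w + y + cond e c 0 ≤ cond e (t0 + z + nw) (h0 + x + w + y + c) := by
    cases e <;> simp <;> omega
  rcases huv with ⟨rfl, hu, rfl⟩ | ⟨hz, rfl, rfl⟩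
  · have hw : ny * (t0 - 1) ≤ nw * t0 := Nat.mul_le_mul (by omega) (by omega)
    have : nw * t0 + nw * 0 ≤ SW := by rw [← mul_add]; simpa using b2
    have hny : ny * (t0 - 1) + ny ≤ nw * t0 := by
      have : ny * (t0 - 1) + ny = ny * t0 := by
        obtain ⟨t, ht⟩ : ∃ t, t0 = t + 1 := ⟨t0 - 1, by omega⟩
        rw [ht]; simp; ring
      rw [this]; exact Nat.mul_le_mul_right _ (by omega)
    omega
  · have hn : nw = ny := by omega
    subst hn
    have hw : nw * (t0 - 1) ≤ nw * (t0 + (v+1)) := Nat.mul_le_mul_left _ (by omega)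
    have e1 : (v + 1) * (2 * p0 + (v+1)) = 2 * (v * p0) + 2 * p0 + v * v + 2 * v + 1 := by ring
    have e2 : v * (p0 + (v + 1)) = v * p0 + v * v + v := by ring
    have e3 := Nat.zero_le (v * v)
    have e4 : v ≤ v * v := Nat.le_mul_self v
    omega
lemma num_mx {z ny nw x w y u v c p0 h0 t0 SX SY A : ℕ} (e : Bool)
    (lX : z ≤ x) (lW : nw ≤ w) (lY : ny ≤ y) (hp : 3 ≤ z + ny) (hq : nw + u + v = z + ny + 1)
    (huv : (z = 0 ∧ u ≤ 1 ∧ v = 0) ∨ (1 ≤ z ∧ u = 2 ∧ v + 1 = z))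
    (hp0 : p0 = 1 + (x + w + y + c + u)) (hh0 : h0 = p0 + (z + v)) (ht0 : t0 = h0 + (x + w + y + c + 1))
    (a2 : 2 * SX + z = z * (2 * p0 + z)) (a4 : ny * (h0 + x + w) ≤ SY) (hA : A = SX + (SY + (h0 + x + w + y + cond e c 0))) :
    p0 + t0 - 2 < A ∧
      (1 ≤ z → h0 + x + t0 + z < A + 2 ∧ p0 + z + t0 + z < A + 2) ∧
      (1 ≤ nw → h0 + x + w + t0 + z + nw < A + 2) ∧
      (e = true → t0 + z + nw + h0 + x + w + y < A) := by
  have hE : h0 + x + w + y + cond e c 0 + c + 1 ≥ t0 ∧ (e = true → h0 + x + w + y + cond e c 0 + 1 = t0) := by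
    cases e <;> simp <;> omega
  obtain ⟨hE1, hE2⟩ := hE
  generalize h0 + x + w + y + cond e c 0 = E at *
  rcases huv with ⟨rfl, hu, rfl⟩ | ⟨hz, rfl, rfl⟩
  · have : 3 * (h0 + x + w) + (ny - 3) * 1 ≤ ny * (h0 + x + w) := by
      obtain ⟨n, rfl⟩ : ∃ n, ny = 3 + n := ⟨ny - 3, by omega⟩
      rw [add_mul]; simp only [Nat.add_sub_cancel_left]
      gcongr; omega
    refine ⟨by omega, by omega, by omega, fun h => ?_⟩
    have := hE2 h; omega
  · have e1 : (v + 1) * (2 * p0 + (v+1)) = 2 * (v * p0) + 2 * p0 + v * v + 2 * v + 1 := by ring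
    have e4 : v ≤ v * v := Nat.le_mul_self v
    have hn : nw = ny := by omega
    subst hn
    rcases Nat.lt_or_ge 0 nw with hy | hy
    · rcases Nat.lt_or_ge 1 nw with hy2 | hy2
      · have : 2 * (h0 + x + w) ≤ nw * (h0 + x + w) := Nat.mul_le_mul_right _ hy2
        refine ⟨by omega, by omega, by omega, fun h => ?_⟩
        have := hE2 h; omega
      · have h1 : nw = 1 := by omega
        subst h1
        have : 1 * p0 ≤ v * p0 := Nat.mul_le_mul_right _ (by omega)
        refine ⟨by omega, by omega, by omega, fun h => ?_⟩
        have := hE2 h; omega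
    · have h1 : nw = 0 := by omega
      subst h1
      have : 2 * p0 ≤ v * p0 := Nat.mul_le_mul_right _ (by omega)
      have := four_mul_le v
      refine ⟨by omega, fun _ => ⟨by linarith, by linarith⟩, by omega, fun h => ?_⟩
      have := hE2 h; linarith

set_option maxHeartbeats 2000000 in
lemma b1_bs {la lb : Multiset ℕ} {k : ℕ} (X W Y : List ℕ) (u v c : ℕ) (e : Bool)
    (hX : ∀ x ∈ X, 1 ≤ x) (hW : ∀ x ∈ W, 1 ≤ x) (hY : ∀ x ∈ Y, 1 ≤ x)
    (hla : la = ((X.map (fun x => 2*x+2) ++ Y.map (fun x => 2*x) : List ℕ) : Multiset ℕ))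
    (hlb : lb = ((W.map (fun x => 2*x+1) ++ List.replicate (u+v) 1 : List ℕ) : Multiset ℕ))
    (hk : k = 2 * c + 1 + cond e 1 0) (hp : 3 ≤ X.length + Y.length)
    (hq : W.length + u + v = X.length + Y.length + 1)
    (huv : (X.length = 0 ∧ u ≤ 1 ∧ v = 0) ∨ (1 ≤ X.length ∧ u = 2 ∧ v + 1 = X.length)) : Strong la lb k := by
  obtain ⟨bs, hbs⟩ : ∃ bs, bs = X.map (TP false) ++ (W.map (OT true) ++ (Y.map (Ein false) ++ (sps v ++ (KK e c :: lows u)))) := ⟨_, rfl⟩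
  have htot : tot bs = ⟨X.sum + W.sum + Y.sum + c + u, X.length + v, X.sum + W.sum + Y.sum + c + 1, X.length + W.length + cond e 1 0⟩ := by
    simp only [tot, hbs, fin_append, TP_fin, OT_fin, EI_fin, sps_fin, fin, (KK_facts e c _ _ _ _ 0).1, low_fin]
    simp only [zero_add]
  have lX : X.length ≤ X.sum := by
    have := List.card_nsmul_le_sum X 1 hX; simpa using this
  have lW : W.length ≤ W.sum := by
    have := List.card_nsmul_le_sum W 1 hW; simpa using this
  have lY : Y.length ≤ Y.sum := by
    have := List.card_nsmul_le_sum Y 1 hY; simpa using this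
  obtain ⟨p0, hp0⟩ : ∃ p0, p0 = 1 + (X.sum + W.sum + Y.sum + c + u) := ⟨_, rfl⟩
  obtain ⟨h0, hh0⟩ : ∃ h0, h0 = p0 + (X.length + v) := ⟨_, rfl⟩
  obtain ⟨t0, ht0⟩ : ∃ t0, t0 = h0 + (X.sum + W.sum + Y.sum + c + 1) := ⟨_, rfl⟩
  have hc : c0 bs = ⟨1, p0, h0, t0⟩ := by
    rw [c0, htot, ht0, hh0, hp0]
  have hk5 := fun l p h t => (KK_facts e c l p h t (h0 + t0))
  have ea : go (binc false) (c0 bs) bs = go (binc false) ⟨1,p0,h0,t0⟩ (X.map (TP false)) ++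
      (go (binc false) ⟨1 + X.sum + W.sum, p0 + X.length, h0 + X.sum + W.sum, t0 + X.length + W.length⟩ (Y.map (Ein false))
      ++ [h0 + X.sum + W.sum + Y.sum + cond e c 0]) := by
    rw [hc, hbs]
    simp only [go_append, TP_fin, OT_fin, EI_fin, sps_fin, go, OT_a, sps_a, low_a, (hk5 _ _ _ _).2.1]
    simp
  have eb : go (binc true) (c0 bs) bs =
      go (binc true) ⟨1 + X.sum, p0 + X.length, h0 + X.sum, t0 + X.length⟩ (W.map (OT true)) ++
      (go (binc true) ⟨1 + X.sum + W.sum + Y.sum, p0 + X.length, h0 + X.sum + W.sum + Y.sum, t0 + X.length + W.length⟩ (sps v) ++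
      ([cond e (t0 + X.length + W.length) (h0 + X.sum + W.sum + Y.sum + c)] ++
      go (binc true) ⟨1 + X.sum + W.sum + Y.sum + c, p0 + X.length + v, h0 + X.sum + W.sum + Y.sum + c + 1, t0 + X.length + W.length + cond e 1 0⟩ (lows u))) := by
    rw [hc, hbs]
    simp only [go_append, TP_fin, OT_fin, EI_fin, sps_fin, go, TP_b, EI_b, (hk5 _ _ _ _).2.2.1, (hk5 _ _ _ _).1, List.nil_append]
  have hha : hct false bs = Y.length + 1 := by
    have := (hk5 0 0 0 0).2.2.2.2.2.2.1
    rw [hbs, ← List.singleton_append (l := lows u)]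
    simp only [hct_append, TP_hct, OT_hct, EI_hct, sps_hct, low_hct, this, cond]; omega
  have hhb : hct true bs = W.length + 1 := by
    have := (hk5 0 0 0 0).2.2.2.2.2.2.2
    rw [hbs, ← List.singleton_append (l := lows u)]
    simp only [hct_append, TP_hct, OT_hct, EI_hct, sps_hct, low_hct, this, cond]; omega
  obtain ⟨a1, a2⟩ := TP_a 1 p0 h0 t0 X
  obtain ⟨a3, a4, a5⟩ := EI_a (1 + X.sum + W.sum) (p0 + X.length) (h0 + X.sum + W.sum) (t0 + X.length + W.length) Y hY
  obtain ⟨b1, b2⟩ := OT_b (1 + X.sum) (p0 + X.length) (h0 + X.sum) (t0 + X.length) W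
  obtain ⟨b3, b4⟩ := sps_b (1 + X.sum + W.sum + Y.sum) (p0 + X.length) (h0 + X.sum + W.sum + Y.sum) (t0 + X.length + W.length) v
  obtain ⟨b5, b6⟩ := low_b (1 + X.sum + W.sum + Y.sum + c) (p0 + X.length + v) (h0 + X.sum + W.sum + Y.sum + c + 1) (t0 + X.length + W.length + cond e 1 0) u
  have hsa : (go (binc false) (c0 bs) bs).length = X.length + Y.length + 1 := by
    rw [ea]; simp only [List.length_append, a1, a3, List.length_singleton]; omega
  have hsb : (go (binc true) (c0 bs) bs).length = W.length + u + v + 1 := by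
    rw [eb]; simp only [List.length_append, b1, b3, b5, List.length_singleton]; omega
  have sa := congrArg List.sum ea
  have sb := congrArg List.sum eb
  simp only [List.sum_append, List.sum_singleton] at sa sb

  generalize (go (binc false) ⟨1,p0,h0,t0⟩ (X.map (TP false))).sum = SX at *
  generalize (go (binc false) ⟨1 + X.sum + W.sum, p0 + X.length, h0 + X.sum + W.sum, t0 + X.length + W.length⟩ (Y.map (Ein false))).sum = SY at *
  generalize (go (binc true) ⟨1 + X.sum, p0 + X.length, h0 + X.sum, t0 + X.length⟩ (W.map (OT true))).sum = SW at *
  generalize (go (binc true) ⟨1 + X.sum + W.sum + Y.sum, p0 + X.length, h0 + X.sum + W.sum + Y.sum, t0 + X.length + W.length⟩ (sps v)).sum = SS at *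
  generalize (go (binc true) ⟨1 + X.sum + W.sum + Y.sum + c, p0 + X.length + v, h0 + X.sum + W.sum + Y.sum + c + 1, t0 + X.length + W.length + cond e 1 0⟩ (lows u)).sum = SL at *
  have hlt : (go (binc false) (c0 bs) bs).sum < (go (binc true) (c0 bs) bs).sum := by
    rw [sa, sb]
    exact num_lt e lX lW lY hp hq huv hp0 hh0 ht0 a2 a5 b2 b4 b6
  have hmain : p0 + t0 - 2 < (go (binc false) (c0 bs) bs).sum ∧
      (1 ≤ X.length → h0 + X.sum + t0 + X.length < (go (binc false) (c0 bs) bs).sum + 2 ∧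
        p0 + X.length + t0 + X.length < (go (binc false) (c0 bs) bs).sum + 2) ∧
      (1 ≤ W.length → h0 + X.sum + W.sum + t0 + X.length + W.length < (go (binc false) (c0 bs) bs).sum + 2) ∧
      (e = true → t0 + X.length + W.length + h0 + X.sum + W.sum + Y.sum < (go (binc false) (c0 bs) bs).sum) := by
    exact num_mx e lX lW lY hp hq huv hp0 hh0 ht0 a2 a4 sa
  clear sa sb ea eb a2 a4 a5 b2 b4 b6
  obtain ⟨m1, m2, m3, m4⟩ := hmain
  have hz : 1 ≤ X.length → v + 1 = X.length := by
    clear m1 m2 m3 m4 hp0 hh0 ht0; omega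
  have hyw : Y.length ≤ W.length + 1 := by
    clear m1 m2 m3 m4 hp0 hh0 ht0; omega
  clear huv
  refine tab (p := X.length + Y.length) (q := W.length + u + v) bs _ rfl ?_ ?_ ?_ ⟨hsa, hsb, ?_, ?_, ?_, ?_, ?_⟩
    ⟨?_, ?_, ?_, ?_, hlt⟩
  rotate_left 3
  iterate 5 clear m1 m2 m3 m4 hz hp0 hh0 ht0; omega
  rotate_right 3
  · clear m1 m2 m3 m4 hz hp0 hh0 ht0 hlt hsa hsb hha hhb htot a1 a3 b1 b3 b5 hk5 hc
    subst hbs hla hlb hk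
    have e1 : (fun b => (btag b, blen b)) ∘ TP false = fun x => (some false, 2*x+2) := by funext x; simp
    have e2 : (fun b => (btag b, blen b)) ∘ OT true = fun x => (some true, 2*x+1) := by funext x; simp
    have e3 : (fun b => (btag b, blen b)) ∘ Ein false = fun x => (some false, 2*x) := by funext x; simp
    have e4 : (btag (KK e c), blen (KK e c)) = (none, 2 * c + 1 + cond e 1 0) := by cases e <;> simp
    simp only [List.map_append, List.map_map, e1, e2, e3, List.map_replicate, List.map_cons, SP, e4, Multiset.map_coe]
    simp only [← Multiset.coe_add, ← Multiset.cons_coe, Function.comp_def, btag, blen, List.replicate_add, List.map_append, List.map_replicate]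
    simp only [← Multiset.singleton_add, cond_true, mul_zero, zero_add, add_zero]
    abel
  · simp [hla]
  · clear m1 m2 m3 m4 hz hlt hsa hsb
    simp [hlb]; omega
  · rw [hc, hbs]
    simp only [oks_append, oks, TP_fin, OT_fin, EI_fin, sps_fin, OT_ok _ _ _ hW, EI_ok _ _ _ hY, sps_ok, low_ok, and_true, (hk5 _ _ _ _).2.2.2.2.2.1]
    refine TP_ok _ _ _ _ _ _ hX ?_
    intro h
    have := hz (List.length_pos_iff.2 h)
    clear m1 m2 m3 m4 hz
    omega
  · intro x hx
    rw [hc] at hx ⊢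
    rw [hbs] at hx
    simp only [go_append, go, TP_fin, OT_fin, EI_fin, sps_fin, (hk5 _ _ _ _).2.2.2.1, (hk5 _ _ _ _).1, List.mem_append, List.not_mem_nil, false_or] at hx
    show x ≤ h0 - 1
    clear m1 m2 m3 m4 hz hlt hsa hsb hha hhb htot a1 a3 b1 b3 b5 hla hlb hk hk5
    rcases hx with hx | hx | hx | hx | hx
    · have := TP_lf _ _ _ _ _ hX x hx; omega
    · have := OT_lf _ _ _ _ _ hW x hx; omega
    · have := EI_lf _ _ _ _ _ hY x hx; omega
    · have := sps_lf _ _ _ _ _ x hx; omega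
    · have := low_lf _ _ _ _ _ x hx; omega
  · refine lt_of_le_of_lt ?_ m1
    rw [hc]; show h0 - 1 ≤ _
    clear m1 m2 m3 m4 hz hlt hsa hsb
    omega
  · intro x hx
    clear hlt hsa hsb hha hhb htot a1 a3 b1 b3 b5 hla hlb hk
    generalize (go (binc false) (c0 bs) bs).sum = SA at *
    rw [hc] at hx
    clear hc
    subst hbs
    simp only [go_append, go, TP_fin, OT_fin, EI_fin, sps_fin, (hk5 _ _ _ _).2.2.2.2.1, (hk5 _ _ _ _).1, List.mem_append, sps_mx, List.not_mem_nil, false_or] at hx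
    clear hk5
    rcases hx with hx | hx | hx | hx | hx
    · obtain ⟨h1, h2⟩ := TP_mx _ _ _ _ _ hX x hx
      have := m2 h1
      clear m2 m3 m4 hz
      rcases h2 with h2 | h2 | h2 <;> omega
    · obtain ⟨h1, h2⟩ := OT_mx _ _ _ _ _ hW x hx
      have := m3 h1
      clear m2 m3 m4 hz
      rcases h2 with h2 | h2 <;> omega
    · have := EI_mx _ _ _ _ _ hY x hx
      clear m2 m3 m4 hz
      omega
    · rcases List.mem_cons.1 hx with hx | hx
      · clear m2 m3 m4 hz; omega
      · cases e
        · simp at hx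
        · simp only [cond_true, List.mem_singleton] at hx
          have := m4 rfl; clear m2 m3 m4 hz; omega
    · clear m2 m3 m4 hz; have := low_mx _ _ _ _ _ (by omega) x hx; omega
end DS

namespace DS

lemma b1 {la lb : Multiset ℕ} {k : ℕ} (hk : 1 ≤ k) (hp : 3 ≤ la.card) (hq : lb.card = la.card + 1)
    (pa : ∀ x ∈ la, 1 ≤ x ∧ x % 2 = 0) (pb : ∀ x ∈ lb, x % 2 = 1) (nb : ¬ (2 ∈ la ∧ 1 ∈ lb)) : Strong la lb k := by
  obtain ⟨L, rfl⟩ : ∃ L : List ℕ, (L : Multiset ℕ) = la := ⟨la.toList, la.coe_toList⟩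
  obtain ⟨M, rfl⟩ : ∃ L : List ℕ, (L : Multiset ℕ) = lb := ⟨lb.toList, lb.coe_toList⟩
  simp only [Multiset.coe_card, Multiset.mem_coe] at *
  set s := M.count 1 with hs
  have hM : (M : Multiset ℕ) = ((M.filter (· ≠ 1) ++ List.replicate s 1 : List ℕ) : Multiset ℕ) := by
    rw [← Multiset.coe_add, hs, ← List.filter_eq, add_comm]
    rw [Multiset.coe_add]
    apply Multiset.coe_eq_coe.2
    have := (List.filter_append_perm (fun x => decide (x = 1)) M).symm
    simpa using this
  have hlen : (M.filter (· ≠ 1)).length + s = M.length := by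
    have := congrArg Multiset.card hM
    simp only [Multiset.coe_card, List.length_append, List.length_replicate] at this
    omega
  have h2 : 1 ≤ s → ∀ x ∈ L, 3 ≤ x := by
    intro h x hx
    have h1 : 1 ∈ M := List.count_pos_iff.1 h
    have := pa x hx
    by_contra hlt
    have : x = 2 := by omega
    subst this
    exact nb ⟨hx, h1⟩
  have hW : (M.filter (· ≠ 1)).map (fun x => 2 * (x/2) + 1) = M.filter (· ≠ 1) := by
    conv_rhs => rw [← List.map_id (M.filter (· ≠ 1))]
    apply List.map_congr_left
    intro x hx
    have := pb x (List.mem_of_mem_filter hx)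
    simp only [id]; omega
  refine b1_bs (((L.take (s-1)).map (fun x => x/2-1))) ((M.filter (· ≠ 1)).map (fun x => x/2))
    ((L.drop (s-1)).map (fun x => x/2)) (if s ≤ 1 then s else 2) (if s ≤ 1 then 0 else s - 2) ((k-1)/2) (decide (k % 2 = 0)) ?_ ?_ ?_ ?_ ?_ ?_ ?_ ?_ ?_
  · intro x hx
    simp only [List.mem_map] at hx
    obtain ⟨y, hy, rfl⟩ := hx
    have hs1 : 1 ≤ s := by
      by_contra h
      have : s - 1 = 0 := by omega
      rw [this] at hy; simp at hy
    have := h2 hs1 y (List.mem_of_mem_take hy)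
    have := pa y (List.mem_of_mem_take hy)
    omega
  · intro x hx
    simp only [List.mem_map, List.mem_filter] at hx
    obtain ⟨y, ⟨hy, hy2⟩, rfl⟩ := hx
    have := pb y hy
    simp at hy2
    omega
  · intro x hx
    simp only [List.mem_map] at hx
    obtain ⟨y, hy, rfl⟩ := hx
    have := pa y (List.mem_of_mem_drop hy)
    omega
  · congr 1
    rw [List.map_map, List.map_map]
    conv_lhs => rw [← List.take_append_drop (s-1) L]
    congr 1
    · conv_lhs => rw [← List.map_id (L.take (s-1))]
      apply List.map_congr_left
      intro y hy
      have hs1 : 1 ≤ s := by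
        by_contra h
        have : s - 1 = 0 := by omega
        rw [this] at hy; simp at hy
      have := h2 hs1 y (List.mem_of_mem_take hy)
      have := pa y (List.mem_of_mem_take hy)
      simp only [id, Function.comp]; omega
    · conv_lhs => rw [← List.map_id (L.drop (s-1))]
      apply List.map_congr_left
      intro y hy
      have := pa y (List.mem_of_mem_drop hy)
      simp only [id, Function.comp]; omega
  · have : (if s ≤ 1 then s else 2) + (if s ≤ 1 then 0 else s - 2) = s := by split_ifs <;> omega
    rw [this, List.map_map]
    simp only [Function.comp_def]
    rw [hW]; exact hM
  · by_cases h : k % 2 = 0 <;> simp [h] <;> omega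
  · simp only [List.length_map, List.length_take, List.length_drop]; omega
  · simp only [List.length_map, List.length_take, List.length_drop]; split_ifs <;> omega
  · simp only [List.length_map, List.length_take]; split_ifs <;> omega
end DS

namespace DS

/-- the exceptional leg configurations -/
def Bad (la lb : Multiset ℕ) (k : ℕ) : Prop :=
  (2 ∈ la ∧ 1 ∈ lb ∧ 3 ≤ la.card) ∨ (la = {2,2} ∧ (∀ x ∈ lb, x = 1) ∧ k % 2 = 1)

lemma Bad.mem {la lb k} (h : Bad la lb k) (hb : 0 < lb.card) : 2 ∈ la ∧ 1 ∈ lb := by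
  rcases h with ⟨h1, h2, -⟩ | ⟨h1, h2, -⟩
  · exact ⟨h1, h2⟩
  · obtain ⟨x, hx⟩ := Multiset.card_pos_iff_exists_mem.1 hb
    exact ⟨by rw [h1]; simp, by rw [← h2 x hx]; exact hx⟩

lemma pick1 (lb : Multiset ℕ) (h : 0 < lb.card) : ∃ y l, lb = y ::ₘ l ∧ (1 ∈ l → y = 1) := by
  by_cases h1 : 1 ∈ lb
  · obtain ⟨l, rfl⟩ := Multiset.exists_cons_of_mem h1
    exact ⟨1, l, rfl, fun _ => rfl⟩
  · obtain ⟨x, hx⟩ := Multiset.card_pos_iff_exists_mem.1 h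
    obtain ⟨l, rfl⟩ := Multiset.exists_cons_of_mem hx
    exact ⟨x, l, rfl, fun h => absurd (Multiset.mem_cons_of_mem h) h1⟩

lemma main_strong {k : ℕ} (hk : 1 ≤ k) : ∀ (n : ℕ) (la lb : Multiset ℕ), la.card + lb.card = n → 2 ≤ la.card → la.card < lb.card →
    (∀ x ∈ la, 1 ≤ x) → (∀ x ∈ lb, 1 ≤ x) → ¬ Bad la lb k → Strong la lb k := by
  intro n
  induction n using Nat.strong_induction_on with
  | _ n ih =>
  intro la lb hn hp hpq pa pb nb
  by_cases hD : la.card + 2 ≤ lb.card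
  · obtain ⟨y, l, rfl, hy⟩ := pick1 lb (by omega)
    simp only [Multiset.card_cons] at *
    refine Strong.insB (ih (la.card + l.card) (by omega) la l rfl hp (by omega) pa (fun x hx => pb x (by simp [hx])) ?_) y (pb y (by simp)) (by omega)
    intro hb
    apply nb
    have hm := (hb.mem (by omega)).2
    have := hy hm
    subst this
    rcases hb with ⟨h1, h2, h3⟩ | ⟨h1, h2, h3⟩
    · exact Or.inl ⟨h1, by simp, h3⟩
    · exact Or.inr ⟨h1, by simpa using h2, h3⟩
  have hq : lb.card = la.card + 1 := by omega
  by_cases hp2 : la.card = 2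
  · exact b34 hk hp2 (by omega) pa pb (fun h => nb (Or.inr h))
  have hp3 : 3 ≤ la.card := by omega
  have nb' : ¬ (2 ∈ la ∧ 1 ∈ lb) := fun h => nb (Or.inl ⟨h.1, h.2, hp3⟩)
  by_cases ho : ∃ x ∈ la, x % 2 = 1
  · obtain ⟨x, hx, hx2⟩ := ho
    obtain ⟨l, rfl⟩ := Multiset.exists_cons_of_mem hx
    obtain ⟨y, hy⟩ := Multiset.card_pos_iff_exists_mem.1 (show 0 < lb.card by omega)
    obtain ⟨m, rfl⟩ := Multiset.exists_cons_of_mem hy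
    simp only [Multiset.card_cons] at *
    have e : x = 2 * (x/2) + 1 := by omega
    rw [e]
    refine Strong.insOB (ih (l.card + m.card) (by omega) l m rfl (by omega) (by omega) (fun x hx => pa x (by simp [hx])) (fun x hx => pb x (by simp [hx])) ?_) _ y (pb y hy) (by omega)
    intro hb
    have := hb.mem (by omega)
    exact nb' ⟨Multiset.mem_cons_of_mem this.1, Multiset.mem_cons_of_mem this.2⟩
  by_cases he : ∃ y ∈ lb, y % 2 = 0
  · obtain ⟨y, hy, hy2⟩ := he
    obtain ⟨m, rfl⟩ := Multiset.exists_cons_of_mem hy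
    obtain ⟨x, hx⟩ := Multiset.card_pos_iff_exists_mem.1 (show 0 < la.card by omega)
    obtain ⟨l, rfl⟩ := Multiset.exists_cons_of_mem hx
    have hx2 : x % 2 = 0 := by
      by_contra h; exact ho ⟨x, hx, by omega⟩
    have h1 := pa x hx
    have h2 := pb y hy
    simp only [Multiset.card_cons] at *
    have e : x = 2 * (x/2) := by omega
    have e' : y = 2 * (y/2) := by omega
    rw [e, e']
    refine Strong.insEE (ih (l.card + m.card) (by omega) l m rfl (by omega) (by omega) (fun x hx => pa x (by simp [hx])) (fun x hx => pb x (by simp [hx])) ?_) _ _ (by omega) (by omega) (by omega)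
    intro hb
    have := hb.mem (by omega)
    exact nb' ⟨Multiset.mem_cons_of_mem this.1, Multiset.mem_cons_of_mem this.2⟩
  · refine b1 hk hp3 hq (fun x hx => ⟨pa x hx, ?_⟩) (fun x hx => ?_) nb'
    · by_contra h; exact ho ⟨x, hx, by omega⟩
    · by_contra h; exact he ⟨x, hx, by omega⟩

lemma main_weak {k : ℕ} (hk : 1 ≤ k) : ∀ (n : ℕ) (la lb : Multiset ℕ), lb.card = n → 2 ≤ la.card → la.card < lb.card →
    (∀ x ∈ la, 1 ≤ x) → (∀ x ∈ lb, 1 ≤ x) → Weak la lb k := by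
  intro n
  induction n using Nat.strong_induction_on with
  | _ n ih =>
  intro la lb hn hp hpq pa pb
  by_cases nb : Bad la lb k
  · rcases nb with ⟨h1, h2, h3⟩ | ⟨rfl, h2, h3⟩
    · obtain ⟨l, rfl⟩ := Multiset.exists_cons_of_mem h1
      obtain ⟨m, rfl⟩ := Multiset.exists_cons_of_mem h2
      simp only [Multiset.card_cons] at *
      exact Weak.spc (ih m.card (by omega) l m rfl (by omega) (by omega) (fun x hx => pa x (by simp [hx])) (fun x hx => pb x (by simp [hx]))) (by omega)
    · have h4 : lb = Multiset.replicate lb.card 1 := Multiset.eq_replicate_card.2 h2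
      simp at hp hpq
      by_cases h5 : lb.card = 3
      · rw [h4, h5, show k = 2 * (k/2) + 1 by omega]
        exact weak_22_111 _
      · obtain ⟨m, hm⟩ : ∃ m, lb.card = m + 1 := ⟨lb.card - 1, by omega⟩
        rw [h4, hm, Multiset.replicate_succ]
        refine Weak.insB (ih m (by omega) _ _ (by simp) (by simp) (by simp; omega) pa ?_) (by simp; omega)
        intro x hx; rw [Multiset.eq_of_mem_replicate hx]
  · exact (main_strong hk _ la lb rfl hp hpq pa pb nb).weak

lemma main_even {k : ℕ} (hk : 1 ≤ k) : ∀ (n : ℕ) (la lb : Multiset ℕ), la.card = n + 2 → lb.card = n + 2 →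
    (∀ x ∈ la, 1 ≤ x ∧ x % 2 = 0) → (∀ x ∈ lb, 1 ≤ x ∧ x % 2 = 0) → Strong la lb k := by
  intro n
  induction n with
  | zero => intro la lb h1 h2 pa pb; exact c33 hk h1 h2 pa pb
  | succ n ih =>
    intro la lb h1 h2 pa pb
    obtain ⟨x, hx⟩ := Multiset.card_pos_iff_exists_mem.1 (show 0 < la.card by omega)
    obtain ⟨y, hy⟩ := Multiset.card_pos_iff_exists_mem.1 (show 0 < lb.card by omega)
    have q1 := pa x hx
    have q2 := pb y hy
    obtain ⟨l, rfl⟩ := Multiset.exists_cons_of_mem hx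
    obtain ⟨m, rfl⟩ := Multiset.exists_cons_of_mem hy
    simp only [Multiset.card_cons] at *
    have e : x = 2 * (x/2) := by omega
    have e' : y = 2 * (y/2) := by omega
    rw [e, e']
    exact Strong.insEE (ih l m (by omega) (by omega) (fun x hx => pa x (by simp [hx])) (fun x hx => pb x (by simp [hx]))) _ _ (by omega) (by omega) (by omega)

lemma main_eq1 {la lb : Multiset ℕ} {k : ℕ} (hk : 1 ≤ k) (ha : 3 ≤ la.card) (hb : lb.card = la.card) (pa : ∀ x ∈ la, 1 ≤ x) (pb : ∀ x ∈ lb, 1 ≤ x)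
    (h : 1 ∈ la) : Lt la lb k := by
  obtain ⟨l, rfl⟩ := Multiset.exists_cons_of_mem h
  simp only [Multiset.card_cons] at *
  exact Weak.insA (main_weak hk _ l lb rfl (by omega) (by omega) (fun x hx => pa x (by simp [hx])) pb) (by omega)

lemma main_eqo {la lb : Multiset ℕ} {k x : ℕ} (hk : 1 ≤ k) (ha : 3 ≤ la.card) (hb : lb.card = la.card) (pa : ∀ x ∈ la, 1 ≤ x) (pb : ∀ x ∈ lb, 1 ≤ x)
    (h1 : 1 ∉ lb) (h : x ∈ la) (hx : x % 2 = 1) : Lt la lb k := by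
  obtain ⟨l, rfl⟩ := Multiset.exists_cons_of_mem h
  simp only [Multiset.card_cons] at *
  rw [show x = 2 * (x/2) + 1 by omega]
  exact Strong.insO (main_strong hk _ l lb rfl (by omega) (by omega) (fun x hx => pa x (by simp [hx])) pb (fun hb' => h1 (hb'.mem (by omega)).2)) _ (by omega)

lemma Lt.ne {la lb k} (h : Lt la lb k) : NE la lb k := by
  obtain ⟨ps, h1, h2, h3⟩ := h
  exact ⟨ps, h1, h2, h3.ne⟩

theorem main_lt {la lb : Multiset ℕ} {k : ℕ} (hk : 1 ≤ k) (ha : 2 ≤ la.card) (hb : la.card < lb.card) (pa : ∀ x ∈ la, 1 ≤ x) (pb : ∀ x ∈ lb, 1 ≤ x) :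
    Lt la lb k := (main_weak hk _ la lb rfl ha hb pa pb).lt

theorem main_eq {la lb : Multiset ℕ} {k : ℕ} (hk : 1 ≤ k) (ha : 2 ≤ la.card) (hb : lb.card = la.card) (pa : ∀ x ∈ la, 1 ≤ x) (pb : ∀ x ∈ lb, 1 ≤ x) :
    NE la lb k ∨ NE lb la k := by
  by_cases h2 : la.card = 2
  · exact b33 hk h2 (by omega) pa pb
  by_cases h3 : 1 ∈ la
  · exact Or.inl (main_eq1 hk (by omega) hb pa pb h3).ne
  by_cases h4 : 1 ∈ lb
  · exact Or.inr (main_eq1 hk (by omega) hb.symm pb pa h4).ne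
  by_cases h5 : ∃ x ∈ la, x % 2 = 1
  · obtain ⟨x, hx, hx2⟩ := h5
    exact Or.inl (main_eqo hk (by omega) hb pa pb h4 hx hx2).ne
  by_cases h6 : ∃ x ∈ lb, x % 2 = 1
  · obtain ⟨x, hx, hx2⟩ := h6
    exact Or.inr (main_eqo hk (by omega) hb.symm pb pa h3 hx hx2).ne
  refine Or.inl (main_even hk (la.card - 2) la lb (by omega) (by omega) (fun x hx => ⟨pa x hx, ?_⟩) (fun x hx => ⟨pb x hx, ?_⟩)).weak.lt.ne
  · by_contra h; exact h5 ⟨x, hx, by omega⟩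
  · by_contra h; exact h6 ⟨x, hx, by omega⟩
end DS

namespace DS

/-- exchanging the roles of the two branch vertices -/
def flp : Pth → Pth
  | (none, w) => (none, w.reverse)
  | (some v, w) => (some (!v), w)

lemma inc_flp (v : Bool) (p : Pth) : inc v (flp p) = inc (!v) p := by
  obtain ⟨_ | u, w⟩ := p
  · cases v <;> simp [inc, flp]
  · cases v <;> cases u <;> simp [inc, flp]
lemma lf_flp (p : Pth) : lf (flp p) = lf p := by
  obtain ⟨_ | u, w⟩ := p <;> simp [lf, flp]
lemma incs_flp (v : Bool) (ps : List Pth) : incs v (ps.map flp) = incs (!v) ps := by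
  simp only [incs, List.flatMap_map, inc_flp]
lemma lfs_flp (ps : List Pth) : lfs (ps.map flp) = lfs ps := by
  simp only [lfs, List.flatMap_map, lf_flp]
lemma labs_cons (p : Pth) (ps : List Pth) : labs (p :: ps) = (p.2 : Multiset ℕ) + labs ps := by
  simp [labs]
lemma sms_cons (p : Pth) (ps : List Pth) : sms (p :: ps) = ((prs p.2).map (fun q => q.1 + q.2) : List ℕ) + sms ps := by
  simp [sms, pairs]
lemma labs_flp (ps : List Pth) : labs (ps.map flp) = labs ps := by
  induction ps with
  | nil => rfl
  | cons p ps ih =>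
    rw [List.map_cons, labs_cons, labs_cons, ih]
    congr 1
    obtain ⟨_ | u, w⟩ := p
    · exact Multiset.coe_eq_coe.2 (List.reverse_perm w)
    · rfl
lemma sms_flp (ps : List Pth) : sms (ps.map flp) = sms ps := by
  induction ps with
  | nil => rfl
  | cons p ps ih =>
    rw [List.map_cons, sms_cons, sms_cons, ih]
    congr 1
    obtain ⟨_ | u, w⟩ := p
    · exact Multiset.coe_eq_coe.2 (by have := (prs_reverse w).map (fun q => q.1+q.2); simpa [List.map_map, Function.comp_def, add_comm, flp] using this)
    · rfl
lemma spec_flp (ps : List Pth) (la lb k) (h : spec ps = SP la lb k) : spec (ps.map flp) = SP lb la k := by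
  have e : spec (ps.map flp) = (spec ps).map (fun r => (r.1.map not, r.2)) := by
    simp only [spec, List.map_map, Multiset.map_coe]
    congr 1
    apply List.map_congr_left
    rintro ⟨_ | u, w⟩ _ <;> simp [flp]
  rw [e, h]
  simp [SP, Function.comp_def, add_comm]
lemma Fnl.flp {ps} (h : Fnl ps) : Fnl (ps.map flp) := by
  refine ⟨by rw [labs_flp]; exact h.lab, by rw [sms_flp]; exact h.nd, by rw [lfs_flp, sms_flp]; exact h.ls, ?_, ?_⟩
  · intro v; rw [lfs_flp, incs_flp]; exact h.lv _
  · intro v; rw [sms_flp, incs_flp]; exact h.sv _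
lemma NE.symm {la lb k} (h : NE la lb k) : NE lb la k := by
  obtain ⟨ps, h1, h2, h3⟩ := h
  exact ⟨ps.map DS.flp, spec_flp ps _ _ _ h1, h2.flp, by rw [incs_flp, incs_flp]; exact h3.symm⟩

theorem main_le {la lb : Multiset ℕ} {k : ℕ} (hk : 1 ≤ k) (ha : 2 ≤ la.card) (hb : la.card ≤ lb.card) (pa : ∀ x ∈ la, 1 ≤ x) (pb : ∀ x ∈ lb, 1 ≤ x) :
    ∃ ps, spec ps = SP la lb k ∧ Fnl ps ∧ (incs false ps).sum ≠ (incs true ps).sum ∧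
      (la.card < lb.card → (incs false ps).sum < (incs true ps).sum) := by
  rcases hb.lt_or_eq with h | h
  · obtain ⟨ps, h1, h2, h3⟩ := main_lt hk ha h pa pb
    exact ⟨ps, h1, h2, h3.ne, fun _ => h3⟩
  · have : NE la lb k := by
      rcases main_eq hk ha h.symm pa pb with h | h
      · exact h
      · exact h.symm
    obtain ⟨ps, h1, h2, h3⟩ := this
    exact ⟨ps, h1, h2, h3, fun h' => absurd h' (by omega)⟩

lemma Fnl.perm {ps qs} (h : Fnl ps) (e : ps.Perm qs) : Fnl qs := by
  have e1 : labs qs = labs ps := Multiset.coe_eq_coe.2 (e.symm.flatMap_right _)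
  have e2 : sms qs = sms ps := Multiset.coe_eq_coe.2 ((e.symm.flatMap_right _).map _)
  have e3 : (lfs qs).Perm (lfs ps) := e.symm.flatMap_right _
  have e4 : ∀ v, (incs v qs).sum = (incs v ps).sum := fun v => (e.symm.flatMap_right _).sum_eq
  refine ⟨by rw [e1]; exact h.lab, by rw [e2]; exact h.nd, ?_, ?_, ?_⟩
  · intro x hx; rw [e2]; exact h.ls x (e3.mem_iff.1 hx)
  · intro v x hx; rw [e4]; exact h.lv v x (e3.mem_iff.1 hx)
  · intro v; rw [e2, e4]; exact h.sv v

lemma perm_lift {α β : Type*} (g : α → β) (l : List β) : ∀ ps : List α, (ps.map g).Perm l → ∃ qs, ps.Perm qs ∧ qs.map g = l := by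
  induction l with
  | nil => intro ps h; exact ⟨[], by simpa using h, rfl⟩
  | cons y l ih =>
    intro ps h
    have hy : y ∈ ps.map g := h.mem_iff.2 (by simp)
    obtain ⟨x, hx, rfl⟩ := List.mem_map.1 hy
    obtain ⟨s, t, rfl⟩ := List.append_of_mem hx
    have h2 : (s ++ x :: t).Perm (x :: (s ++ t)) := List.perm_middle
    obtain ⟨qs, h3, h4⟩ := ih (s ++ t) (by
      have := (h2.map g).symm.trans h
      simpa using this)
    exact ⟨x :: qs, h2.trans (h3.cons x), by simp [h4]⟩

lemma lookup {α : Type*} [DecidableEq α] (l : List α) (hl : l.Nodup) (m : List ℕ) (h : m.length = l.length) : ∃ f : α → ℕ, l.map f = m := by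
  refine ⟨fun x => m.getD (l.idxOf x) 0, ?_⟩
  apply List.ext_getElem
  · simp [h]
  · intro i h1 h2
    simp only [List.length_map] at h1
    simp [hl.idxOf_getElem, h2]

lemma lfs_le (ps : List Pth) : ((lfs ps : List ℕ) : Multiset ℕ) ≤ labs ps := by
  apply Multiset.coe_le.2
  apply List.Sublist.subperm
  induction ps with
  | nil => simp [lfs]
  | cons p ps ih =>
    simp only [lfs, List.flatMap_cons] at *
    refine List.Sublist.append ?_ ih
    obtain ⟨_ | u, w⟩ := p
    · simp [lf]
    · simp only [lf]
      rcases List.eq_nil_or_concat w with rfl | ⟨w, x, rfl⟩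
      · simp
      · simp
end DS

namespace DS

section graph
variable {V : Type*}

/-- all vertices occurring in a decomposition into core and legs -/
def cov (a b : V) (cs : List V) (L : List (Bool × List V)) : List V :=
  a :: b :: (cs ++ L.flatMap Prod.snd)

structure Dec (G : SimpleGraph V) (a b : V) (cs : List V) (L : List (Bool × List V)) : Prop where
  core : (a :: (cs ++ [b])).IsChain G.Adj
  leg : ∀ l ∈ L, l.2 ≠ [] ∧ (cond l.1 b a :: l.2).IsChain G.Adj
  nd : (cov a b cs L).Nodup

lemma mid_deg [Fintype V] (G : SimpleGraph V) (s t : List V) (x y : V) (hs : s ≠ []) (ht : t ≠ [])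
    (hc : (s ++ x :: t).IsChain G.Adj) (hn : (s ++ x :: t).Nodup) (hy : y ∉ s ++ x :: t) (hxy : G.Adj x y) :
    3 ≤ G.degree x := by
  obtain ⟨s, z, rfl⟩ := (List.eq_nil_or_concat s).resolve_left hs
  obtain ⟨w, t, rfl⟩ := List.exists_cons_of_ne_nil ht
  have h1 : G.Adj z x := by
    have := List.isChain_append.1 hc
    exact this.2.2 z (by simp) x (by simp)
  have h2 : G.Adj x w := by
    have := (List.isChain_append.1 hc).2.1
    simpa using (List.isChain_cons_cons.1 this).1
  have hzw : z ≠ w := by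
    rintro rfl
    rw [List.nodup_append] at hn
    exact hn.2.2 z (by simp) z (by simp) rfl
  have hyz : y ≠ z := by rintro rfl; simp at hy
  have hyw : y ≠ w := by rintro rfl; simp at hy
  have : ({z, w, y} : Finset V) ⊆ G.neighborFinset x := by
    intro u hu
    simp only [Finset.mem_insert, Finset.mem_singleton] at hu
    rw [SimpleGraph.mem_neighborFinset]
    rcases hu with rfl | rfl | rfl
    · exact h1.symm
    · exact h2
    · exact hxy
  have h3 := Finset.card_le_card this
  rw [SimpleGraph.card_neighborFinset_eq_degree] at h3
  rw [Finset.card_eq_three.2 ⟨z, w, y, hzw, hyz.symm, hyw.symm, rfl⟩] at h3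
  exact h3

lemma Dec.core_nd {G : SimpleGraph V} {a b cs L} (h : Dec G a b cs L) : (a :: (cs ++ [b])).Nodup := by
  have := h.nd
  simp only [cov] at this
  have h2 : (a :: b :: cs).Nodup := List.Nodup.sublist (by simp) this
  refine (List.Perm.nodup_iff ?_).1 h2
  exact (List.perm_append_singleton b cs).symm.cons a

lemma Dec.leg_sub {a b : V} {cs L} {l : Bool × List V} (hl : l ∈ L) :
    (cond l.1 b a :: l.2).Sublist (cov a b cs L) ∨ (cond l.1 b a :: l.2).Sublist (b :: (cs ++ L.flatMap Prod.snd)) := by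
  have : l.2.Sublist (cs ++ L.flatMap Prod.snd) := by
    refine List.Sublist.trans ?_ (List.sublist_append_right _ _)
    obtain ⟨s, t, rfl⟩ := List.append_of_mem hl
    simp only [List.flatMap_append, List.flatMap_cons]
    exact (List.sublist_append_left _ _).trans (List.sublist_append_right _ _)
  obtain ⟨_ | _, ws⟩ := l
  · left
    exact List.Sublist.cons_cons _ (this.cons _)
  · right
    exact List.Sublist.cons_cons _ this

lemma Dec.leg_nd {G : SimpleGraph V} {a b cs L} (h : Dec G a b cs L) {l} (hl : l ∈ L) : (cond l.1 b a :: l.2).Nodup := by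
  rcases Dec.leg_sub (a := a) (b := b) (cs := cs) hl with h1 | h1
  · exact h.nd.sublist h1
  · exact (List.nodup_cons.1 h.nd).2.sublist h1

lemma Dec.leg_mem {a b : V} {cs L} {l : Bool × List V} (hl : l ∈ L) : ∀ x ∈ (cond l.1 b a :: l.2), x ∈ cov a b cs L := by
  intro x hx
  rcases Dec.leg_sub (a := a) (b := b) (cs := cs) hl with h1 | h1
  · exact h1.subset hx
  · exact List.mem_cons_of_mem _ (h1.subset hx)

lemma Dec.step [Fintype V] {G : SimpleGraph V} {a b cs L} (h : Dec G a b cs L) (hG : G.Connected)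
    (hd : ∀ v, 3 ≤ G.degree v → v = a ∨ v = b) (hne : ∃ v, v ∉ cov a b cs L) :
    ∃ L', Dec G a b cs L' ∧ (cov a b cs L').length = (cov a b cs L).length + 1 := by
  obtain ⟨v, hv⟩ := hne
  obtain ⟨p⟩ := hG.preconnected a v
  obtain ⟨d, -, hx, hy⟩ := p.exists_boundary_dart {u | u ∈ cov a b cs L} (by simp [cov]) hv
  obtain ⟨⟨x, y⟩, hxy⟩ := d
  simp only [Set.mem_setOf_eq] at hx hy hxy
  have new : ∀ c : Bool, G.Adj (cond c b a) y → ∃ L', Dec G a b cs L' ∧ (cov a b cs L').length = (cov a b cs L).length + 1 := by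
    intro c hc
    refine ⟨(c, [y]) :: L, ⟨h.core, ?_, ?_⟩, ?_⟩
    · intro l hl
      rcases List.mem_cons.1 hl with rfl | hl
      · simpa using hc
      · exact h.leg l hl
    · have : (cov a b cs ((c,[y]) :: L)).Perm (y :: cov a b cs L) := by
        rw [List.perm_iff_count]; intro z; simp [cov, List.count_cons]; omega
      rw [this.nodup_iff]
      exact List.nodup_cons.2 ⟨hy, h.nd⟩
    · simp [cov]; omega
  by_cases hxa : x = a
  · subst hxa; exact new false hxy
  by_cases hxb : x = b
  · subst hxb; exact new true hxy
  have hno : ¬ 3 ≤ G.degree x := fun h => by rcases hd x h with h | h <;> contradiction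
  have hx' : x ∈ cs ∨ ∃ l ∈ L, x ∈ l.2 := by
    simpa [cov, hxa, hxb] using hx
  rcases hx' with hx | ⟨l, hl, hx⟩
  · exfalso
    obtain ⟨s, t, rfl⟩ := List.append_of_mem hx
    have h1 := h.core
    have h2 := h.core_nd
    have e : a :: (s ++ x :: t ++ [b]) = (a :: s) ++ x :: (t ++ [b]) := by simp
    rw [e] at h1 h2
    refine hno (mid_deg G _ _ x y (by simp) (by simp) h1 h2 ?_ hxy)
    intro h3
    apply hy
    simp only [cov, List.mem_cons, List.mem_append, List.not_mem_nil] at h3 ⊢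
    tauto
  · obtain ⟨s, t, hst⟩ := List.append_of_mem hx
    have h1 := (h.leg l hl).2
    have h2 := h.leg_nd hl
    have h3 := fun h' => hy (Dec.leg_mem (a := a) (b := b) (cs := cs) hl y h')
    by_cases ht : t = []
    · subst ht
      obtain ⟨L1, L2, rfl⟩ := List.append_of_mem hl
      refine ⟨L1 ++ (l.1, l.2 ++ [y]) :: L2, ⟨h.core, ?_, ?_⟩, ?_⟩
      · intro l' hl'
        rw [List.mem_append, List.mem_cons] at hl'
        rcases hl' with h4 | rfl | h4
        · exact h.leg l' (by simp [h4])
        · refine ⟨by simp, ?_⟩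
          simp only
          rw [← List.cons_append, List.isChain_append]
          refine ⟨h1, by simp, ?_⟩
          rw [hst]
          intro z hz w hw
          rw [← List.cons_append, List.getLast?_append] at hz
          simp at hz hw
          subst hz; subst hw; exact hxy
        · exact h.leg l' (by simp [h4])
      · have : (cov a b cs (L1 ++ (l.1, l.2 ++ [y]) :: L2)).Perm (y :: cov a b cs (L1 ++ l :: L2)) := by
          rw [List.perm_iff_count]; intro z; simp [cov, List.count_cons]; omega
        rw [this.nodup_iff]
        exact List.nodup_cons.2 ⟨hy, h.nd⟩
      · simp [cov]; omega
    · exfalso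
      rw [hst, ← List.cons_append] at h1 h2 h3
      exact hno (mid_deg G _ _ x y (by simp) ht h1 h2 h3 hxy)

lemma Dec.all [Fintype V] {G : SimpleGraph V} {a b cs} (hG : G.Connected)
    (hd : ∀ v, 3 ≤ G.degree v → v = a ∨ v = b) (n : ℕ) : ∀ L, Dec G a b cs L → Fintype.card V ≤ (cov a b cs L).length + n →
    ∃ L', Dec G a b cs L' ∧ ∀ v, v ∈ cov a b cs L' := by
  induction n with
  | zero =>
    intro L h hn
    refine ⟨L, h, ?_⟩
    by_contra! hc
    obtain ⟨L', h1, h2⟩ := h.step hG hd hc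
    have := h1.nd.length_le_card
    omega
  | succ n ih =>
    intro L h hn
    by_cases hc : ∀ v, v ∈ cov a b cs L
    · exact ⟨L, h, hc⟩
    · push Not at hc
      obtain ⟨L', h1, h2⟩ := h.step hG hd hc
      exact ih L' h1 (by omega)

lemma Dec.ex [Fintype V] {G : SimpleGraph V} {a b} (hab : a ≠ b) (hG : G.Connected)
    (hd : ∀ v, 3 ≤ G.degree v → v = a ∨ v = b) : ∃ cs L, Dec G a b cs L ∧ ∀ v, v ∈ cov a b cs L := by
  obtain ⟨p0⟩ := hG.preconnected a b
  obtain ⟨p, hp⟩ : ∃ p : G.Walk a b, p.IsPath := ⟨p0.bypass, p0.bypass_isPath⟩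
  have h1 := p.isChain_adj_support
  have h2 := hp.support_nodup
  obtain ⟨cs, hcs⟩ : ∃ cs, p.support = a :: (cs ++ [b]) := by
    cases p with
    | nil => exact absurd rfl hab
    | cons h q =>
      refine ⟨q.support.dropLast, ?_⟩
      rw [SimpleGraph.Walk.support_cons]
      congr 1
      conv_lhs => rw [← List.dropLast_append_getLast q.support_ne_nil]
      simp
  rw [hcs] at h1 h2
  have : Dec G a b cs [] := ⟨h1, by simp, by
    refine (List.Perm.nodup_iff ?_).1 h2
    simp only [cov, List.flatMap_nil, List.append_nil]
    exact (List.perm_append_singleton b cs).cons a⟩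
  obtain ⟨L, h⟩ := Dec.all hG hd (Fintype.card V) [] this (by omega)
  exact ⟨cs, L, h⟩
end graph
end DS

namespace DS

section edges
variable {V : Type*}

/-- consecutive pairs of a vertex list, as edges -/
def eds : List V → List (Sym2 V)
  | x :: y :: l => s(x, y) :: eds (y :: l)
  | _ => []

lemma eds_cons_cons (x y : V) (l : List V) : eds (x :: y :: l) = s(x, y) :: eds (y :: l) := rfl
lemma eds_one (x : V) : eds [x] = [] := rfl

lemma eds_length (x : V) (l : List V) : (eds (x :: l)).length = l.length := by
  induction l generalizing x with
  | nil => rfl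
  | cons y l ih => simp [eds_cons_cons, ih]

lemma eds_mem (x : V) (l : List V) : ∀ e ∈ eds (x :: l), ∀ u ∈ e, u ∈ x :: l := by
  induction l generalizing x with
  | nil => simp [eds]
  | cons y l ih =>
    intro e he u hu
    rw [eds_cons_cons, List.mem_cons] at he
    rcases he with rfl | he
    · rcases Sym2.mem_iff.1 hu with rfl | rfl <;> simp
    · exact List.mem_cons_of_mem _ (ih y e he u hu)

lemma eds_child (x : V) (l : List V) : ∀ e ∈ eds (x :: l), ∃ u ∈ e, u ∈ l := by
  induction l generalizing x with
  | nil => simp [eds]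
  | cons y l ih =>
    intro e he
    rw [eds_cons_cons, List.mem_cons] at he
    rcases he with rfl | he
    · exact ⟨y, by simp, by simp⟩
    · obtain ⟨u, h1, h2⟩ := ih y e he
      exact ⟨u, h1, List.mem_cons_of_mem _ h2⟩

lemma eds_nodup (x : V) (l : List V) (h : (x :: l).Nodup) : (eds (x :: l)).Nodup := by
  induction l generalizing x with
  | nil => simp [eds]
  | cons y l ih =>
    rw [List.nodup_cons] at h
    rw [eds_cons_cons, List.nodup_cons]
    exact ⟨fun h' => h.1 (eds_mem y l _ h' x (by simp)), ih y h.2⟩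

lemma eds_adj {G : SimpleGraph V} (x : V) (l : List V) (h : (x :: l).IsChain G.Adj) : ∀ e ∈ eds (x :: l), e ∈ G.edgeSet := by
  induction l generalizing x with
  | nil => simp [eds]
  | cons y l ih =>
    rw [List.isChain_cons_cons] at h
    intro e he
    rw [eds_cons_cons, List.mem_cons] at he
    rcases he with rfl | he
    · exact h.1
    · exact ih y h.2 e he

/-- contribution of the path `l` to the vertex sum at `u` -/
noncomputable def ctr (f : Sym2 V → ℕ) (u : V) (l : List V) : ℕ :=
  ((eds l).map (fun e => if u ∈ e then f e else 0)).sum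

lemma ctr_zero (f : Sym2 V → ℕ) (u x : V) (l : List V) (h : u ∉ x :: l) : ctr f u (x :: l) = 0 := by
  unfold ctr
  rw [List.sum_eq_zero]
  intro n hn
  obtain ⟨e, he, rfl⟩ := List.mem_map.1 hn
  rw [if_neg]
  exact fun hu => h (eds_mem x l e he u hu)

lemma ctr_cons (f : Sym2 V → ℕ) (u x y : V) (l : List V) :
    ctr f u (x :: y :: l) = (if u ∈ s(x,y) then f s(x,y) else 0) + ctr f u (y :: l) := by
  simp [ctr, eds_cons_cons]

lemma ctr_head (f : Sym2 V → ℕ) (x : V) (l : List V) (h : (x :: l).Nodup) :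
    ctr f x (x :: l) = (((eds (x :: l)).map f).head?.toList).sum := by
  cases l with
  | nil => simp [ctr, eds]
  | cons y l =>
    rw [ctr_cons, ctr_zero f x y l (List.nodup_cons.1 h).1]
    simp [eds_cons_cons]

lemma ctr_last (f : Sym2 V → ℕ) (u x : V) (l : List V) (h : (x :: l).Nodup) (hu : l.getLast? = some u) :
    [ctr f u (x :: l)] = ((eds (x :: l)).map f).getLast?.toList := by
  induction l generalizing x with
  | nil => simp at hu
  | cons y l ih =>
    rw [List.nodup_cons] at h
    rw [ctr_cons, eds_cons_cons]
    cases l with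
    | nil =>
      simp at hu
      subst hu
      simp [eds_one, ctr]
    | cons z l =>
      rw [List.getLast?_cons_cons] at hu
      have hmem : u ∈ z :: l := List.mem_of_getLast? hu
      have h1 : u ≠ x := by rintro rfl; exact h.1 (List.mem_cons_of_mem _ hmem)
      have h2 : u ≠ y := by rintro rfl; exact (List.nodup_cons.1 h.2).1 hmem
      have := ih y h.2 hu
      rw [if_neg (by simp [h1, h2]), zero_add, this, eds_cons_cons, List.map_cons, List.map_cons, List.map_cons, List.getLast?_cons_cons]

lemma ctr_mid (f : Sym2 V → ℕ) (x : V) (l : List V) (h : (x :: l).Nodup) :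
    l.dropLast.map (fun u => ctr f u (x :: l)) = (prs ((eds (x :: l)).map f)).map (fun q => q.1 + q.2) := by
  induction l generalizing x with
  | nil => simp [eds, prs]
  | cons y l ih =>
    rw [List.nodup_cons] at h
    cases l with
    | nil => simp [eds, prs]
    | cons z l =>
      have h2 := List.nodup_cons.1 h.2
      have := ih y h.2
      rw [List.dropLast_cons_cons, List.map_cons]
      have e : List.map (fun u => ctr f u (x :: y :: z :: l)) (z :: l).dropLast = List.map (fun u => ctr f u (y :: z :: l)) (z :: l).dropLast := by
        apply List.map_congr_left
        intro u hu
        have hu := List.mem_of_mem_dropLast hu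
        have h1 : u ≠ x := by rintro rfl; exact h.1 (List.mem_cons_of_mem _ hu)
        have h3 : u ≠ y := by rintro rfl; exact h2.1 hu
        rw [ctr_cons, if_neg (by simp [h1, h3]), zero_add]
      rw [e, this, ctr_cons, ctr_head f y _ h.2]
      simp [eds_cons_cons, prs]

/-- the paths of a decomposition -/
def gp (a b : V) (cs : List V) (L : List (Bool × List V)) : List (Option Bool × List V) :=
  (none, a :: (cs ++ [b])) :: L.map (fun l => (some l.1, cond l.1 b a :: l.2))

def ED (a b : V) (cs : List V) (L : List (Bool × List V)) : List (Sym2 V) :=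
  (gp a b cs L).flatMap (fun P => eds P.2)

def lps (f : Sym2 V → ℕ) (P : List (Option Bool × List V)) : List Pth := P.map (fun P => (P.1, (eds P.2).map f))

noncomputable def vs (f : Sym2 V → ℕ) (a b : V) (cs : List V) (L : List (Bool × List V)) (u : V) : ℕ :=
  ((gp a b cs L).map (fun P => ctr f u P.2)).sum

lemma vs_eq (f : Sym2 V → ℕ) (a b : V) (cs : List V) (L : List (Bool × List V)) (u : V) :
    vs f a b cs L u = ctr f u (a :: (cs ++ [b])) + (L.map (fun l => ctr f u (cond l.1 b a :: l.2))).sum := by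
  simp [vs, gp, Function.comp_def]

lemma vs_ED (f : Sym2 V → ℕ) (a b : V) (cs : List V) (L : List (Bool × List V)) (u : V) :
    vs f a b cs L u = ((ED a b cs L).map (fun e => if u ∈ e then f e else 0)).sum := by
  simp only [vs, ED, List.map_flatMap, ctr]
  rw [List.flatMap, List.sum_flatten, List.map_map]
  rfl

variable {G : SimpleGraph V} {a b : V} {cs : List V} {L : List (Bool × List V)}

lemma Dec.tail {l} (h : Dec G a b cs (l :: L)) : Dec G a b cs L := by
  refine ⟨h.core, fun l' hl' => h.leg l' (by simp [hl']), h.nd.sublist ?_⟩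
  simp only [cov, List.flatMap_cons]
  exact ((List.Sublist.append_left (List.sublist_append_right _ _) _).cons_cons _).cons_cons _

lemma gp_mem : ∀ P ∈ gp a b cs L, ∀ u ∈ P.2, u ∈ cov a b cs L := by
  intro P hP u hu
  rw [gp, List.mem_cons] at hP
  rcases hP with rfl | hP
  · simp [cov] at hu ⊢; tauto
  · obtain ⟨l, hl, rfl⟩ := List.mem_map.1 hP
    exact Dec.leg_mem hl u hu

lemma ED_mem : ∀ e ∈ ED a b cs L, ∀ u ∈ e, u ∈ cov a b cs L := by
  intro e he u hu
  obtain ⟨P, hP, he⟩ := List.mem_flatMap.1 he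
  apply gp_mem P hP
  rw [gp, List.mem_cons] at hP
  rcases hP with rfl | hP
  · exact eds_mem _ _ _ he u hu
  · obtain ⟨l, hl, rfl⟩ := List.mem_map.1 hP
    exact eds_mem _ _ _ he u hu

lemma ED_cons (l : Bool × List V) : (ED a b cs (l :: L)).Perm (eds (cond l.1 b a :: l.2) ++ ED a b cs L) := by
  rw [List.perm_iff_count]; intro z; simp [ED, gp, List.flatMap_cons]; omega

lemma Dec.ED_nodup (h : Dec G a b cs L) : (ED a b cs L).Nodup := by
  induction L with
  | nil => simpa [ED, gp] using eds_nodup _ _ h.core_nd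
  | cons l L ih =>
    rw [(ED_cons l).nodup_iff, List.nodup_append]
    refine ⟨eds_nodup _ _ (h.leg_nd (by simp)), ih h.tail, ?_⟩
    rintro e he _ he' rfl
    obtain ⟨u, h1, h2⟩ := eds_child _ _ e he
    have h3 := ED_mem e he' u h1
    have : (cov a b cs (l :: L)).Perm (l.2 ++ cov a b cs L) := by
      rw [List.perm_iff_count]; intro z; simp [cov, List.count_cons]; omega
    have h4 := this.nodup_iff.1 h.nd
    exact (List.nodup_append.1 h4).2.2 u h2 u h3 rfl

lemma ED_length : (ED a b cs L).length + 1 = (cov a b cs L).length := by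
  induction L with
  | nil => simp [ED, gp, eds_length, cov]
  | cons l L ih =>
    rw [(ED_cons l).length_eq, List.length_append, eds_length]
    simp [cov] at ih ⊢
    omega

lemma Dec.ED_adj (h : Dec G a b cs L) : ∀ e ∈ ED a b cs L, e ∈ G.edgeSet := by
  intro e he
  obtain ⟨P, hP, he⟩ := List.mem_flatMap.1 he
  rw [gp, List.mem_cons] at hP
  rcases hP with rfl | hP
  · exact eds_adj _ _ h.core e he
  · obtain ⟨l, hl, rfl⟩ := List.mem_map.1 hP
    exact eds_adj _ _ (h.leg l hl).2 e he

lemma Dec.ED_eq [Fintype V] (h : Dec G a b cs L) (hc : ∀ v, v ∈ cov a b cs L) (hT : G.IsTree) :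
    (ED a b cs L).toFinset = G.edgeFinset := by
  apply Finset.eq_of_subset_of_card_le
  · intro e he
    rw [SimpleGraph.mem_edgeFinset]
    exact h.ED_adj e (List.mem_toFinset.1 he)
  · rw [List.toFinset_card_of_nodup h.ED_nodup]
    have h1 := hT.card_edgeFinset
    have h2 : Fintype.card V ≤ (cov a b cs L).length := by
      have : (cov a b cs L).toFinset = Finset.univ := by ext v; simp [hc v]
      rw [← Finset.card_univ, ← this]
      exact List.toFinset_card_le _
    have h3 := ED_length (a := a) (b := b) (cs := cs) (L := L)
    omega

lemma Dec.vsum [Fintype V] (h : Dec G a b cs L) (hc : ∀ v, v ∈ cov a b cs L) (hT : G.IsTree) (f : Sym2 V → ℕ) (u : V) :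
    ∑ e ∈ G.incidenceFinset u, f e = vs f a b cs L u := by
  rw [vs_ED, ← List.sum_toFinset _ h.ED_nodup, h.ED_eq hc hT, ← Finset.sum_filter, SimpleGraph.incidenceFinset_eq_filter]

lemma Dec.vs_core (h : Dec G a b cs L) (f : Sym2 V → ℕ) (u : V) (hu : u ∈ cs) : vs f a b cs L u = ctr f u (a :: (cs ++ [b])) := by
  rw [vs_eq, List.sum_eq_zero, add_zero]
  intro n hn
  obtain ⟨l, hl, rfl⟩ := List.mem_map.1 hn
  apply ctr_zero
  have h1 := h.nd
  simp only [cov, List.nodup_cons, List.nodup_append, List.mem_cons, List.mem_append, List.mem_flatMap, not_or] at h1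
  intro h2
  rcases List.mem_cons.1 h2 with h2 | h2
  · cases hl1 : l.1 <;> rw [hl1] at h2 <;> simp at h2 <;> subst h2
    · exact h1.1.2.1 hu
    · exact h1.2.1.1 hu
  · exact h1.2.2.2.2 u hu u ⟨l, hl, h2⟩ rfl

lemma Dec.vs_leg (h : Dec G a b cs L) (f : Sym2 V → ℕ) (u : V) (l) (hl : l ∈ L) (hu : u ∈ l.2) :
    vs f a b cs L u = ctr f u (cond l.1 b a :: l.2) := by
  obtain ⟨L1, L2, rfl⟩ := List.append_of_mem hl
  have h1 : (cov a b cs (L1 ++ l :: L2)).Perm (l.2 ++ cov a b cs (L1 ++ L2)) := by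
      rw [List.perm_iff_count]; intro z; simp [cov, List.count_cons]; omega
  have h1 := h1.nodup_iff.1 h.nd
  have h2 : u ∉ cov a b cs (L1 ++ L2) := fun h2 => (List.nodup_append.1 h1).2.2 u hu u h2 rfl
  have h3 : ∀ l' ∈ L1 ++ L2, ctr f u (cond l'.1 b a :: l'.2) = 0 := by
    intro l' hl'
    apply ctr_zero
    exact fun h3 => h2 (Dec.leg_mem hl' u h3)
  rw [vs_eq, List.map_append, List.map_cons, List.sum_append, List.sum_cons, ctr_zero, List.sum_eq_zero, List.sum_eq_zero]
  · simp
  · intro n hn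
    obtain ⟨l', hl', rfl⟩ := List.mem_map.1 hn
    exact h3 l' (by simp [hl'])
  · intro n hn
    obtain ⟨l', hl', rfl⟩ := List.mem_map.1 hn
    exact h3 l' (by simp [hl'])
  · intro h4
    apply h2
    simp [cov] at h4 ⊢
    tauto

def itr (cs : List V) (L : List (Bool × List V)) : List V := cs ++ L.flatMap (fun l => l.2.dropLast)
def lvs (L : List (Bool × List V)) : List V := L.flatMap (fun l => l.2.getLast?.toList)

lemma Dec.itr_eq (h : Dec G a b cs L) (f : Sym2 V → ℕ) :
    (itr cs L).map (vs f a b cs L) = (pairs (lps f (gp a b cs L))).map (fun q => q.1 + q.2) := by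
  simp only [itr, pairs, lps, gp, List.map_cons, List.map_append, List.flatMap_cons]
  congr 1
  · rw [← ctr_mid f a _ h.core_nd, List.dropLast_concat]
    exact List.map_congr_left fun u hu => h.vs_core f u hu
  · simp only [List.map_flatMap, List.map_map, List.flatMap_map, Function.comp_def]
    apply List.flatMap_congr
    intro l hl
    rw [← ctr_mid f _ _ (h.leg_nd hl)]
    exact List.map_congr_left fun u hu => h.vs_leg f u l hl (List.mem_of_mem_dropLast hu)

lemma Dec.lvs_eq (h : Dec G a b cs L) (f : Sym2 V → ℕ) :
    (lvs L).map (vs f a b cs L) = lfs (lps f (gp a b cs L)) := by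
  simp only [lvs, lfs, lps, gp, List.map_cons, List.flatMap_cons, lf, List.nil_append]
  simp only [List.map_flatMap, List.map_map, List.flatMap_map, Function.comp_def]
  apply List.flatMap_congr
  intro l hl
  obtain ⟨ws, u, hw⟩ := (List.eq_nil_or_concat l.2).resolve_left (h.leg l hl).1
  have hlast : l.2.getLast? = some u := by rw [hw]; simp
  simp only [lf]
  rw [← ctr_last f u _ l.2 (h.leg_nd hl) hlast, hlast]
  simp only [Option.toList_some, List.map_cons, List.map_nil]
  rw [h.vs_leg f u l hl (List.mem_of_getLast? hlast)]

lemma Dec.a_eq (h : Dec G a b cs L) (f : Sym2 V → ℕ) :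
    vs f a b cs L a = (incs false (lps f (gp a b cs L))).sum := by
  rw [vs_eq, ctr_head f a _ h.core_nd]
  simp only [incs, lps, gp, List.map_cons, List.flatMap_cons, List.sum_append, inc]
  congr 1
  rw [List.map_map, List.flatMap_map, List.flatMap, List.sum_flatten, List.map_map]
  congr 1
  apply List.map_congr_left
  intro l hl
  have h2 := h.leg_nd hl
  have h3 : a ≠ b := by have := h.nd; simp [cov] at this; tauto
  have h4 : l.1 = true → a ∉ l.2 := by
    intro _ h4
    have := h.nd
    simp only [cov, List.nodup_cons, List.mem_cons, List.mem_append, List.mem_flatMap] at this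
    exact this.1 (Or.inr (Or.inr ⟨l, hl, h4⟩))
  obtain ⟨_ | _, ws⟩ := l
  · simpa [inc] using ctr_head f a _ h2
  · simpa [inc] using ctr_zero f a b ws (by simpa [h3] using h4 rfl)

lemma Dec.b_eq (h : Dec G a b cs L) (f : Sym2 V → ℕ) :
    vs f a b cs L b = (incs true (lps f (gp a b cs L))).sum := by
  have := ctr_last f b a (cs ++ [b]) h.core_nd (by simp)
  rw [vs_eq]
  simp only [incs, lps, gp, List.map_cons, List.flatMap_cons, List.sum_append, inc]
  congr 1
  · simpa using congrArg List.sum this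
  rw [List.map_map, List.flatMap_map, List.flatMap, List.sum_flatten, List.map_map]
  congr 1
  apply List.map_congr_left
  intro l hl
  have h2 := h.leg_nd hl
  have h3 : b ≠ a := by have := h.nd; simp [cov] at this; tauto
  have h4 : l.1 = false → b ∉ l.2 := by
    intro _ h4
    have := (List.nodup_cons.1 h.nd).2
    simp only [List.nodup_cons, List.mem_append, List.mem_flatMap] at this
    exact this.1 (Or.inr ⟨l, hl, h4⟩)
  obtain ⟨_ | _, ws⟩ := l
  · simpa [inc] using ctr_zero f b a ws (by simpa [h3] using h4 rfl)
  · simpa [inc] using ctr_head f b _ h2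

lemma Dec.cases (h : Dec G a b cs L) (v : V) (hc : v ∈ cov a b cs L) : v = a ∨ v = b ∨ v ∈ itr cs L ∨ v ∈ lvs L := by
  simp only [cov, List.mem_cons, List.mem_append, List.mem_flatMap] at hc
  rcases hc with h1 | h1 | h1 | ⟨l, hl, h1⟩
  · exact Or.inl h1
  · exact Or.inr (Or.inl h1)
  · right; right; left; simp [itr, h1]
  · right; right
    simp only [itr, lvs, List.mem_append, List.mem_flatMap]
    obtain ⟨ws, u, hw⟩ := (List.eq_nil_or_concat l.2).resolve_left (h.leg l hl).1
    rw [List.concat_eq_append] at hw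
    rw [hw, List.mem_append, List.mem_singleton] at h1
    rcases h1 with h1 | h1
    · left; right; exact ⟨l, hl, by rw [hw]; simpa using h1⟩
    · right; exact ⟨l, hl, by rw [hw]; simp [h1]⟩
end edges
end DS

namespace DS

section final
variable {V : Type*}

/-- multiset of lengths of the legs on one side -/
def lens (v : Bool) (L : List (Bool × List V)) : Multiset ℕ :=
  ((L.filter (fun l => l.1 = v)).map (fun l => l.2.length) : List ℕ)

lemma lens_cons (v : Bool) (l : Bool × List V) (L) : lens v (l :: L) = if l.1 = v then l.2.length ::ₘ lens v L else lens v L := by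
  simp only [lens, List.filter_cons]
  split_ifs <;> simp_all

lemma gp_spec (a b : V) (cs : List V) (L : List (Bool × List V)) :
    (((gp a b cs L).map (fun P => (P.1, (eds P.2).length)) : List (Option Bool × ℕ)) : Multiset (Option Bool × ℕ))
      = SP (lens false L) (lens true L) (cs.length + 1) := by
  simp only [gp, List.map_cons, SP, eds_length, List.length_append, List.length_singleton, List.map_map, Function.comp_def]
  rw [← Multiset.cons_coe]
  congr 1
  induction L with
  | nil => simp [lens]
  | cons l L ih =>
    rw [List.map_cons, ← Multiset.cons_coe, ih, lens_cons, lens_cons]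
    obtain ⟨_ | _, ws⟩ := l <;> simp

lemma ones (x : V) (l : List V) : (eds (x :: l)).map (fun _ => 1) = List.replicate l.length 1 := by
  rw [List.map_const', eds_length]

lemma incs_ones (v : Bool) (a b : V) (cs : List V) (L : List (Bool × List V)) (h : ∀ l ∈ L, l.2 ≠ []) :
    (incs v (lps (fun _ => 1) (gp a b cs L))).sum = 1 + (lens v L).card := by
  simp only [incs, lps, gp, List.map_cons, List.flatMap_cons, ones, List.map_map, List.sum_append]
  congr 1
  · cases v <;> simp [inc, List.getLast?_replicate, List.head?_replicate]
  · induction L with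
    | nil => simp [lens]
    | cons l L ih =>
      have h1 := h l (by simp)
      have h1 : l.2.length ≠ 0 := by simpa using h1
      rw [List.map_cons, List.flatMap_cons, List.sum_append, ih (fun l' hl' => h l' (by simp [hl'])), lens_cons]
      simp only [Function.comp, ones, inc]
      split_ifs with h2
      · simp [List.head?_replicate, h1]; omega
      · simp

lemma lps_ones (P : List (Option Bool × List V)) : ∀ p ∈ lps (fun _ => 1) P, ∀ x ∈ p.2, x = 1 := by
  intro p hp x hx
  obtain ⟨Q, _, rfl⟩ := List.mem_map.1 hp
  simp at hx
  exact hx.2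

lemma pairs_ones (P : List (Option Bool × List V)) : ∀ s ∈ (pairs (lps (fun _ => 1) P)).map (fun q => q.1 + q.2), s = 2 := by
  intro s hs
  obtain ⟨q, hq, rfl⟩ := List.mem_map.1 hs
  obtain ⟨p, hp, hq⟩ := List.mem_flatMap.1 hq
  have := prs_sub _ q hq
  rw [lps_ones P p hp _ this.1, lps_ones P p hp _ this.2]

lemma lfs_ones (P : List (Option Bool × List V)) : ∀ s ∈ lfs (lps (fun _ => 1) P), s = 1 := by
  intro s hs
  obtain ⟨p, hp, hq⟩ := List.mem_flatMap.1 hs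
  refine lps_ones P p hp s ?_
  obtain ⟨_ | v, w⟩ := p
  · simp [lf] at hq
  · simp only [lf, Option.mem_toList] at hq
    exact List.mem_of_getLast? hq

lemma exists_lab (P : List (Option Bool × List V)) (hn : (P.flatMap (fun P => eds P.2)).Nodup) (qs : List Pth)
    (h : qs.map (fun p => (p.1, p.2.length)) = P.map (fun P => (P.1, (eds P.2).length))) :
    ∃ f : Sym2 V → ℕ, lps f P = qs := by
  have hl : (qs.flatMap Prod.snd).length = (P.flatMap (fun P => eds P.2)).length := by
    have := congrArg (fun l => (l.map Prod.snd).sum) h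
    simp only [List.map_map, Function.comp_def] at this
    rw [List.length_flatMap, List.length_flatMap]
    exact this
  obtain ⟨f, hf⟩ := lookup _ hn _ hl
  refine ⟨f, ?_⟩
  clear hn hl
  induction P generalizing qs with
  | nil => simp at h; subst h; rfl
  | cons Q P ih =>
    cases qs with
    | nil => simp at h
    | cons q qs =>
      simp only [List.map_cons, List.cons.injEq, Prod.mk.injEq] at h
      simp only [List.flatMap_cons, List.map_append] at hf
      obtain ⟨h1, h2⟩ := List.append_inj hf (by rw [List.length_map, h.1.2])
      have := ih qs h.2 h2
      simp only [lps] at this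
      simp only [lps, List.map_cons, this, h1, ← h.1.1]

theorem final [Fintype V] (G : SimpleGraph V) (hT : G.IsTree) (a b : V) (hab : a ≠ b)
    (hd : ∀ v, 3 ≤ G.degree v → v = a ∨ v = b) (ha : 3 ≤ G.degree a) (hle : G.degree a ≤ G.degree b) :
    IsStronglyAntimagic G := by
  obtain ⟨cs, L, h, hc⟩ := Dec.ex hab hT.connected hd
  have hdeg : ∀ u, G.degree u = vs (fun _ => 1) a b cs L u := by
    intro u
    rw [← h.vsum hc hT, ← SimpleGraph.card_incidenceFinset_eq_degree, Finset.card_eq_sum_ones]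
  have hda : G.degree a = 1 + (lens false L).card := by
    rw [hdeg, h.a_eq, incs_ones _ _ _ _ _ (fun l hl => (h.leg l hl).1)]
  have hdb : G.degree b = 1 + (lens true L).card := by
    rw [hdeg, h.b_eq, incs_ones _ _ _ _ _ (fun l hl => (h.leg l hl).1)]
  have hdi : ∀ u ∈ itr cs L, G.degree u = 2 := by
    intro u hu
    rw [hdeg]
    apply pairs_ones (gp a b cs L)
    rw [← h.itr_eq]
    exact List.mem_map_of_mem hu
  have hdl : ∀ u ∈ lvs L, G.degree u = 1 := by
    intro u hu
    rw [hdeg]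
    apply lfs_ones (gp a b cs L)
    rw [← h.lvs_eq]
    exact List.mem_map_of_mem hu
  have hpos : ∀ v, ∀ x ∈ lens v L, 1 ≤ x := by
    intro v x hx
    simp only [lens, Multiset.mem_coe, List.mem_map, List.mem_filter] at hx
    obtain ⟨l, ⟨hl, _⟩, rfl⟩ := hx
    exact List.length_pos_iff.2 (h.leg l hl).1
  obtain ⟨ps, h1, h2, h3, h4⟩ := main_le (la := lens false L) (lb := lens true L) (k := cs.length + 1) (by omega) (by omega) (by omega) (hpos _) (hpos _)
  rw [← gp_spec a b cs L] at h1
  obtain ⟨qs, hq, he⟩ := perm_lift _ _ ps (Multiset.coe_eq_coe.1 h1)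
  have h2 := h2.perm hq
  have e4 : ∀ v, (incs v qs).sum = (incs v ps).sum := fun v => (hq.symm.flatMap_right _).sum_eq
  rw [← e4, ← e4] at h3 h4
  obtain ⟨f, hf⟩ := exists_lab (gp a b cs L) h.ED_nodup qs he
  have hva := h.a_eq f
  have hvb := h.b_eq f
  have hvi := h.itr_eq f
  have hvl := h.lvs_eq f
  rw [hf] at hva hvb hvi hvl
  have hvs : ∀ u, vertexSum G f u = vs f a b cs L u := fun u => h.vsum hc hT f u
  obtain ⟨m, hm⟩ := h2.lab
  have hlab : (((ED a b cs L).map f : List ℕ) : Multiset ℕ) = R 1 (m+1) := by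
    rw [← hm, ← hf]
    simp only [labs, lps, ED, List.map_flatMap, List.flatMap_map]
  have hmE : m = G.edgeFinset.card := by
    have := congrArg Multiset.card hlab
    rw [R_card, Multiset.coe_card, List.length_map] at this
    rw [← h.ED_eq hc hT, List.toFinset_card_of_nodup h.ED_nodup, this]; rfl
  have hmem : ∀ e, e ∈ G.edgeSet ↔ e ∈ ED a b cs L := by
    intro e
    rw [← SimpleGraph.mem_edgeFinset, ← h.ED_eq hc hT, List.mem_toFinset]
  have hnd : ((ED a b cs L).map f).Nodup := by
    have := R_nodup 1 (m+1)
    rw [← hlab] at this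
    exact this
  have hmR : ∀ x, x ∈ (ED a b cs L).map f ↔ 1 ≤ x ∧ x ≤ m := by
    intro x
    rw [← Multiset.mem_coe, hlab, mem_R]; omega
  have hbij : Set.BijOn f G.edgeSet (Set.Icc 1 G.edgeFinset.card) := by
    rw [← hmE]
    refine ⟨?_, ?_, ?_⟩
    · intro e he
      exact (hmR _).1 (List.mem_map_of_mem ((hmem e).1 he))
    · intro e he e' he' hee
      exact List.inj_on_of_nodup_map hnd ((hmem e).1 he) ((hmem e').1 he') hee
    · intro x hx
      obtain ⟨e, he, rfl⟩ := List.mem_map.1 ((hmR x).2 hx)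
      exact ⟨e, (hmem e).2 he, rfl⟩
  have hini : ((itr cs L).map (vs f a b cs L)).Nodup := by
    rw [hvi]; exact h2.nd
  have hinl : ((lvs L).map (vs f a b cs L)).Nodup := by
    rw [hvl]
    have := Multiset.nodup_of_le (lfs_le qs) (by rw [hm]; exact R_nodup _ _)
    exact this
  have mi : ∀ u ∈ itr cs L, vs f a b cs L u ∈ sms qs := by
    intro u hu
    have := List.mem_map_of_mem (f := vs f a b cs L) hu
    rw [hvi] at this
    exact this
  have ml : ∀ u ∈ lvs L, vs f a b cs L u ∈ lfs qs := by
    intro u hu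
    have := List.mem_map_of_mem (f := vs f a b cs L) hu
    rwa [hvl] at this
  have li : ∀ u ∈ lvs L, ∀ v ∈ itr cs L, vs f a b cs L u < vs f a b cs L v :=
    fun u hu v hv => h2.ls _ (ml u hu) _ (mi v hv)
  have la : ∀ u ∈ lvs L, vs f a b cs L u < vs f a b cs L a :=
    fun u hu => by rw [hva]; exact h2.lv _ _ (ml u hu)
  have lb : ∀ u ∈ lvs L, vs f a b cs L u < vs f a b cs L b :=
    fun u hu => by rw [hvb]; exact h2.lv _ _ (ml u hu)
  have ia : ∀ u ∈ itr cs L, vs f a b cs L u < vs f a b cs L a :=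
    fun u hu => by rw [hva]; exact h2.sv _ _ (mi u hu)
  have ib : ∀ u ∈ itr cs L, vs f a b cs L u < vs f a b cs L b :=
    fun u hu => by rw [hvb]; exact h2.sv _ _ (mi u hu)
  rw [← hva, ← hvb] at h3 h4
  refine ⟨f, hbij, ?_, ?_⟩
  · intro u v huv
    rw [hvs, hvs] at huv
    rcases h.cases u (hc u) with rfl | rfl | hu | hu <;> rcases h.cases v (hc v) with rfl | rfl | hv | hv
    · rfl
    · exact absurd huv h3
    · exact absurd huv (ia v hv).ne'
    · exact absurd huv (la v hv).ne'
    · exact absurd huv h3.symm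
    · rfl
    · exact absurd huv (ib v hv).ne'
    · exact absurd huv (lb v hv).ne'
    · exact absurd huv (ia u hu).ne
    · exact absurd huv (ib u hu).ne
    · exact List.inj_on_of_nodup_map hini hu hv huv
    · exact absurd huv (li v hv u hu).ne'
    · exact absurd huv (la u hu).ne
    · exact absurd huv (lb u hu).ne
    · exact absurd huv (li u hu v hv).ne
    · exact List.inj_on_of_nodup_map hinl hu hv huv
  · intro u v huv
    rw [hvs, hvs]
    rcases h.cases u (hc u) with rfl | rfl | hu | hu <;> rcases h.cases v (hc v) with rfl | rfl | hv | hv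
    · omega
    · exact h4 (by omega)
    · have := hdi v hv; omega
    · have := hdl v hv; omega
    · omega
    · omega
    · have := hdi v hv; omega
    · have := hdl v hv; omega
    · exact ia u hu
    · exact ib u hu
    · have := hdi v hv; have := hdi u hu; omega
    · have := hdl v hv; have := hdi u hu; omega
    · exact la u hu
    · exact lb u hu
    · exact li u hu v hv
    · have := hdl v hv; have := hdl u hu; omega
end final
end DS

/-- Every double spider — a tree containing exactly two vertices of
degree at least 3 — is strongly antimagic. -/
theorem doubleSpider_tree_isStronglyAntimagic {V : Type*} [Fintype V] (G : SimpleGraph V)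
    (hT : G.IsTree) (hbranch : {v : V | 3 ≤ G.degree v}.ncard = 2) :
    IsStronglyAntimagic G := by
  obtain ⟨a, b, hab, hs⟩ := Set.ncard_eq_two.1 hbranch
  have hd : ∀ v, 3 ≤ G.degree v ↔ v = a ∨ v = b := by
    intro v
    have : v ∈ {v : V | 3 ≤ G.degree v} ↔ v ∈ ({a, b} : Set V) := by rw [hs]
    simpa using this
  rcases le_total (G.degree a) (G.degree b) with h | h
  · exact DS.final G hT a b hab (fun v => (hd v).1) ((hd a).2 (Or.inl rfl)) h
  · exact DS.final G hT b a hab.symm (fun v hv => ((hd v).1 hv).symm) ((hd b).2 (Or.inr rfl)) h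

end
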